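/- Sobolev–Korn inequality: let n ≥ 2 and 1 < p < 2. Then there exists a constant c = c(n,p) > 0 such that for every ball B_ρ(x₀) ⊂ ℝⁿ and every vector field u that is continuously differentiable on an open neighborhood of the closed ball, one has ⨍_{B_ρ(x₀)} |Du(x)|^p dx ≤ c ⨍_{B_ρ(x₀)} |𝓔u(x)|^p dx + c ( ⨍_{B_ρ(x₀)} |u(x) − (u)_{x₀,ρ}| / ρ dx )^p, where (u)_{x₀,ρ} = ⨍_{B_ρ(x₀)} u(x) dx is the mean value of u over the ball and ⨍ denotes the average integral. -/

import Mathlib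

open MeasureTheory Metric

/-- The Jacobian matrix `Du(x) ∈ ℝ^{n×n}` of a vector field `u : ℝⁿ → ℝⁿ`,
with entries `(Du(x))_{ij} = ∂u_i/∂x_j (x)`. -/
noncomputable def jacobian {n : ℕ} (u : EuclideanSpace ℝ (Fin n) → EuclideanSpace ℝ (Fin n))
    (x : EuclideanSpace ℝ (Fin n)) : Matrix (Fin n) (Fin n) ℝ :=
  fun i j => fderiv ℝ u x (EuclideanSpace.single j 1) i

/-- The symmetric part `𝓔u(x) = (Du(x) + Du(x)ᵀ)/2` of the gradient. -/
noncomputable def symGrad {n : ℕ} (u : EuclideanSpace ℝ (Fin n) → EuclideanSpace ℝ (Fin n))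
    (x : EuclideanSpace ℝ (Fin n)) : Matrix (Fin n) (Fin n) ℝ :=
  fun i j => (jacobian u x i j + jacobian u x j i) / 2

/-- The Frobenius norm of a real `n × n` matrix. -/
noncomputable def frob {n : ℕ} (M : Matrix (Fin n) (Fin n) ℝ) : ℝ :=
  Real.sqrt (∑ i, ∑ j, M i j ^ 2)

namespace Korn

/-- The Euclidean space `ℝⁿ`. -/
abbrev Euc (n : ℕ) := EuclideanSpace ℝ (Fin n)

/-- The `k`-th coordinate vector. -/
noncomputable abbrev bv {n : ℕ} (k : Fin n) : Euc n := EuclideanSpace.single k 1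

/-- The density of the standard Gaussian measure on `ℝⁿ`. -/
noncomputable def gaussDensity (n : ℕ) (z : Euc n) : ℝ :=
  (∫ y : Euc n, Real.exp (-(1 / 2) * ‖y‖ ^ 2))⁻¹ * Real.exp (-(1 / 2) * ‖z‖ ^ 2)

/-- The standard Gaussian measure on `ℝⁿ`. -/
noncomputable def gauss (n : ℕ) : Measure (Euc n) :=
  volume.withDensity fun z => ENNReal.ofReal (gaussDensity n z)

variable {n : ℕ}

lemma integrable_exp_neg_mul_sq_norm {b : ℝ} (hb : 0 < b) :
    Integrable fun z : Euc n => Real.exp (-b * ‖z‖ ^ 2) := by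
  have h := GaussianFourier.integral_rexp_neg_mul_sq_norm (V := Euc n) hb
  by_contra hc
  rw [integral_undef hc] at h
  have : 0 < (Real.pi / b) ^ ((Module.finrank ℝ (Euc n) : ℝ) / 2) := by positivity
  exact this.ne h

lemma gaussDensity_pos (z : Euc n) : 0 < gaussDensity n z := by
  have h := GaussianFourier.integral_rexp_neg_mul_sq_norm (V := Euc n) (b := 1 / 2) (by norm_num)
  unfold gaussDensity
  rw [h]
  positivity

lemma continuous_gaussDensity : Continuous (gaussDensity n) := by
  unfold gaussDensity; fun_prop

lemma integral_gauss (f : Euc n → ℝ) : ∫ z, f z ∂gauss n = ∫ z, f z * gaussDensity n z := by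
  unfold gauss
  rw [integral_withDensity_eq_integral_toReal_smul₀]
  · refine integral_congr_ae (.of_forall fun z => ?_)
    simp [ENNReal.toReal_ofReal (gaussDensity_pos z).le, mul_comm]
  · exact (continuous_gaussDensity.measurable.ennreal_ofReal).aemeasurable
  · exact .of_forall fun z => ENNReal.ofReal_lt_top

lemma integrable_gauss_iff {f : Euc n → ℝ} :
    Integrable f (gauss n) ↔ Integrable fun z => f z * gaussDensity n z := by
  unfold gauss
  rw [integrable_withDensity_iff (continuous_gaussDensity.measurable.ennreal_ofReal)
    (.of_forall fun z => ENNReal.ofReal_lt_top)]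
  simp [ENNReal.toReal_ofReal (gaussDensity_pos _).le]

instance : IsProbabilityMeasure (gauss n) := by
  constructor
  have hi := integrable_exp_neg_mul_sq_norm (n := n) (b := 1 / 2) (by norm_num)
  have h := GaussianFourier.integral_rexp_neg_mul_sq_norm (V := Euc n) (b := 1 / 2) (by norm_num)
  rw [gauss, withDensity_apply _ MeasurableSet.univ, setLIntegral_univ,
    ← ofReal_integral_eq_lintegral_ofReal (by exact hi.const_mul _)
      (.of_forall fun z => (gaussDensity_pos z).le)]
  unfold gaussDensity
  rw [integral_const_mul, inv_mul_cancel₀, ENNReal.ofReal_one]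
  rw [h]; positivity

lemma integrable_norm_gauss : Integrable (fun z : Euc n => ‖z‖) (gauss n) := by
  rw [integrable_gauss_iff]
  have hi := (integrable_exp_neg_mul_sq_norm (n := n) (b := 1 / 4) (by norm_num)).const_mul
    (2 * (∫ y : Euc n, Real.exp (-(1 / 2) * ‖y‖ ^ 2))⁻¹)
  refine hi.mono' ?_ (.of_forall fun z => ?_)
  · exact (continuous_norm.mul continuous_gaussDensity).aestronglyMeasurable
  · have hp := gaussDensity_pos z
    rw [Real.norm_of_nonneg (by positivity)]
    have h1 : ‖z‖ ≤ 2 * Real.exp (1 / 4 * ‖z‖ ^ 2) := by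
      have := Real.add_one_le_exp (1 / 4 * ‖z‖ ^ 2)
      nlinarith [sq_nonneg (‖z‖ - 2)]
    calc ‖z‖ * gaussDensity n z ≤ 2 * Real.exp (1 / 4 * ‖z‖ ^ 2) * gaussDensity n z := by gcongr
      _ = _ := by
        unfold gaussDensity
        have : Real.exp (-(1 / 4) * ‖z‖ ^ 2)
            = Real.exp (1 / 4 * ‖z‖ ^ 2) * Real.exp (-(1 / 2) * ‖z‖ ^ 2) := by
          rw [← Real.exp_add]; ring_nf
        rw [this]; ring

lemma hasLineDerivAt_gaussDensity (z : Euc n) (k : Fin n) :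
    HasLineDerivAt ℝ (gaussDensity n) (-(z k * gaussDensity n z)) z (bv k) := by
  have h : HasFDerivAt (gaussDensity n) _ z :=
    (((hasStrictFDerivAt_norm_sq z).hasFDerivAt.const_mul (-(1 / 2))).exp).const_mul _
  have e := h.hasLineDerivAt (bv k)
  have e2 : ((∫ y : Euc n, Real.exp (-(1 / 2) * ‖y‖ ^ 2))⁻¹ •
      Real.exp (-(1 / 2) * ‖z‖ ^ 2) • (-(1 / 2) : ℝ) • 2 • (innerSL ℝ) z) (bv k)
      = -(z k * gaussDensity n z) := by
    simp [gaussDensity, EuclideanSpace.inner_single_right]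
    ring
  rw [e2] at e
  exact e

/-- Gaussian integration by parts. -/
lemma integral_mul_coord_gauss {h h' : Euc n → ℝ} {k : Fin n} {M : ℝ}
    (hc : Continuous h) (hc' : Continuous h') (hM : ∀ z, |h z| ≤ M) (hM' : ∀ z, |h' z| ≤ M)
    (hd : ∀ z, HasLineDerivAt ℝ h (h' z) z (bv k)) :
    ∫ z, h z * z k ∂gauss n = ∫ z, h' z ∂gauss n := by
  have hb : ∀ {f : Euc n → ℝ}, Continuous f → (∀ z, |f z| ≤ M) → Integrable f (gauss n) :=
    fun hf hfM => (integrable_const M).mono' hf.aestronglyMeasurable (.of_forall hfM)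
  have hcoord : Continuous fun z : Euc n => z k := by fun_prop
  have hz : Integrable (fun z => h z * z k) (gauss n) := by
    refine (integrable_norm_gauss.const_mul M).mono' (hc.mul hcoord).aestronglyMeasurable
      (.of_forall fun z => ?_)
    rw [norm_mul]
    exact mul_le_mul (hM z) (PiLp.norm_apply_le z k) (norm_nonneg _)
      ((abs_nonneg _).trans (hM z))
  have h1 := integrable_gauss_iff.1 (hb hc hM)
  have h2 := integrable_gauss_iff.1 (hb hc' hM')
  have h3 := integrable_gauss_iff.1 hz
  have := integral_bilinear_hasLineDerivAt_right_eq_neg_left_of_integrable (μ := volume)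
    (B := ContinuousLinearMap.mul ℝ ℝ) (f := h) (f' := h') (g := gaussDensity n)
    (g' := fun z => -(z k * gaussDensity n z)) (v := bv k) h2
    (by simpa [mul_assoc] using h3.neg) h1 (fun z _ => hd z)
    (fun z _ => hasLineDerivAt_gaussDensity z k)
  rw [integral_gauss, integral_gauss]
  simp only [ContinuousLinearMap.mul_apply', mul_neg, integral_neg, neg_inj] at this
  simpa [mul_assoc] using this

end Korn

namespace Korn
variable {n : ℕ}

open scoped ContDiff

/-- The `k`-th partial derivative. -/
noncomputable def pd (k : Fin n) (f : Euc n → ℝ) (x : Euc n) : ℝ := fderiv ℝ f x (bv k)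

/-- Smooth functions that are constant outside a compact set. -/
structure Nice (f : Euc n → ℝ) : Prop where
  smooth : ContDiff ℝ ∞ f
  compact : ∃ c, HasCompactSupport fun x => f x - c

/-- Smooth functions of compact support. -/
structure Test (f : Euc n → ℝ) : Prop where
  smooth : ContDiff ℝ ∞ f
  compact : HasCompactSupport f

lemma Test.nice {f : Euc n → ℝ} (hf : Test f) : Nice f := ⟨hf.smooth, 0, by simpa using hf.compact⟩

lemma Nice.const (c : ℝ) : Nice (fun _ : Euc n => c) :=
  ⟨contDiff_const, c, by simp [HasCompactSupport, tsupport]⟩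

lemma Nice.pd {f : Euc n → ℝ} (hf : Nice f) (k : Fin n) : Test (pd k f) := by
  obtain ⟨h1, c, h2⟩ := hf
  refine ⟨(h1.fderiv_right (m := ∞) (by simp)).clm_apply contDiff_const, ?_⟩
  have := h2.fderiv_apply (𝕜 := ℝ) (bv k)
  simp only [fderiv_sub_const] at this
  exact this

lemma Test.pd {f : Euc n → ℝ} (hf : Test f) (k : Fin n) : Test (pd k f) := hf.nice.pd k

lemma Nice.bounded {f : Euc n → ℝ} (hf : Nice f) : ∃ M, ∀ x, |f x| ≤ M := by
  obtain ⟨h1, c, h2⟩ := hf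
  obtain ⟨M, hM⟩ := h2.exists_bound_of_continuous (h1.continuous.sub continuous_const)
  refine ⟨M + |c|, fun x => ?_⟩
  have := hM x
  rw [Real.norm_eq_abs] at this
  calc |f x| = |(f x - c) + c| := by ring_nf
    _ ≤ |f x - c| + |c| := abs_add_le _ _
    _ ≤ _ := by gcongr

lemma Nice.continuous {f : Euc n → ℝ} (hf : Nice f) : Continuous f := hf.smooth.continuous

lemma Test.integrable {f : Euc n → ℝ} (hf : Test f) : Integrable f :=
  hf.smooth.continuous.integrable_of_hasCompactSupport hf.compact

lemma Nice.hasFDerivAt {f : Euc n → ℝ} (hf : Nice f) (x : Euc n) :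
    HasFDerivAt f (fderiv ℝ f x) x :=
  (hf.smooth.differentiable (by simp) x).hasFDerivAt

lemma fderiv_apply_eq_sum_pd (f : Euc n → ℝ) (x z : Euc n) :
    fderiv ℝ f x z = ∑ k, pd k f x * z k := by
  conv_lhs => rw [← (EuclideanSpace.basisFun (Fin n) ℝ).sum_repr z]
  simp [pd, mul_comm]

/-- The heat extension of `f`, in the time variable `σ` for which `∂_σ = σ Δ`. -/
noncomputable def heat (f : Euc n → ℝ) (σ : ℝ) (x : Euc n) : ℝ := ∫ z, f (x + σ • z) ∂gauss n

lemma Nice.integrable_comp {f : Euc n → ℝ} (hf : Nice f) (σ : ℝ) (x : Euc n) :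
    Integrable (fun z => f (x + σ • z)) (gauss n) := by
  obtain ⟨M, hM⟩ := hf.bounded
  have := hf.continuous
  exact (integrable_const M).mono'
    (by fun_prop : Continuous fun z => f (x + σ • z)).aestronglyMeasurable
    (.of_forall fun z => hM _)

lemma heat_zero (f : Euc n → ℝ) (x : Euc n) : heat f 0 x = f x := by simp [heat]

lemma heat_const (c : ℝ) (σ : ℝ) (x : Euc n) : heat (fun _ => c) σ x = c := by simp [heat]

lemma abs_heat_le {f : Euc n → ℝ} {M : ℝ} (hM : ∀ x, |f x| ≤ M) (σ : ℝ) (x : Euc n) :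
    |heat f σ x| ≤ M := by
  have := norm_integral_le_of_norm_le_const (μ := gauss n) (f := fun z => f (x + σ • z))
    (.of_forall fun z => hM _)
  simpa [heat] using this

lemma heat_mono {f g : Euc n → ℝ} (hf : Nice f) (hg : Nice g) (h : ∀ x, f x ≤ g x) (σ : ℝ)
    (x : Euc n) : heat f σ x ≤ heat g σ x :=
  integral_mono (hf.integrable_comp σ x) (hg.integrable_comp σ x) fun _ => h _

lemma heat_sub {f g : Euc n → ℝ} (hf : Nice f) (hg : Nice g) (σ : ℝ)
    (x : Euc n) : heat (fun y => f y - g y) σ x = heat f σ x - heat g σ x :=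
  integral_sub (hf.integrable_comp σ x) (hg.integrable_comp σ x)

lemma Nice.continuous_heat {f : Euc n → ℝ} (hf : Nice f) (σ : ℝ) : Continuous (heat f σ) := by
  obtain ⟨M, hM⟩ := hf.bounded
  have := hf.continuous
  refine continuous_of_dominated (bound := fun _ => M) (fun x => ?_)
    (fun x => .of_forall fun z => hM _) (integrable_const M) (.of_forall fun z => by fun_prop)
  exact (by fun_prop : Continuous fun z => f (x + σ • z)).aestronglyMeasurable

lemma Nice.hasLineDerivAt_heat {f : Euc n → ℝ} (hf : Nice f) (σ : ℝ) (x : Euc n) (k : Fin n) :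
    HasLineDerivAt ℝ (heat f σ) (heat (Korn.pd k f) σ x) x (bv k) := by
  obtain ⟨M, hM⟩ := (hf.pd k).nice.bounded
  have h1 := hf.continuous
  have h2 := (hf.pd k).nice.continuous
  have := (hasDerivAt_integral_of_dominated_loc_of_deriv_le (μ := gauss n) (s := Set.univ)
    (F := fun (t : ℝ) z => f (x + t • bv k + σ • z)) (x₀ := 0)
    (F' := fun t z => Korn.pd k f (x + t • bv k + σ • z)) (bound := fun _ => M)
    Filter.univ_mem (.of_forall fun t => (by fun_prop :
      Continuous fun z => f (x + t • bv k + σ • z)).aestronglyMeasurable)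
    (by simpa using hf.integrable_comp σ x)
    (by fun_prop :
      Continuous fun z => Korn.pd k f (x + (0 : ℝ) • bv k + σ • z)).aestronglyMeasurable
    (.of_forall fun z t _ => hM _) (integrable_const M) (.of_forall fun z t _ => ?_)).2
  · simpa [HasLineDerivAt, heat] using this
  · have hg : HasDerivAt (fun t : ℝ => x + t • bv k + σ • z) (bv k) t := by
      simpa using (((hasDerivAt_id t).smul_const (bv k : Euc n)).const_add x).add_const (σ • z)
    exact (hf.hasFDerivAt _).comp_hasDerivAt t hg

lemma Nice.integral_mul_coord {f : Euc n → ℝ} (hf : Nice f) (σ : ℝ) (x : Euc n) (k : Fin n) :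
    ∫ z, f (x + σ • z) * z k ∂gauss n = σ * heat (Korn.pd k f) σ x := by
  obtain ⟨M, hM⟩ := hf.bounded
  obtain ⟨M', hM'⟩ := (hf.pd k).nice.bounded
  have h1 := hf.continuous
  have h2 := (hf.pd k).nice.continuous
  rw [heat, ← integral_const_mul]
  refine integral_mul_coord_gauss (M := max M (|σ| * M')) (by fun_prop) (by fun_prop)
    (fun z => (hM _).trans (le_max_left _ _)) (fun z => ?_) (fun z => ?_)
  · rw [abs_mul]
    exact (mul_le_mul_of_nonneg_left (hM' _) (abs_nonneg _)).trans (le_max_right _ _)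
  · have hg : HasDerivAt (fun t : ℝ => x + σ • (z + t • bv k)) (σ • bv k) 0 := by
      simpa using ((((hasDerivAt_id (0 : ℝ)).smul_const (bv k : Euc n)).const_add z).const_smul
        σ).const_add x
    have := (hf.hasFDerivAt _).comp_hasDerivAt (0 : ℝ) hg
    simp only [zero_smul, add_zero, map_smul, smul_eq_mul] at this
    exact this

/-- The heat equation. -/
lemma Nice.hasDerivAt_heat {f : Euc n → ℝ} (hf : Nice f) (σ : ℝ) (x : Euc n) :
    HasDerivAt (fun τ => heat f τ x) (σ * ∑ k, heat (Korn.pd k (Korn.pd k f)) σ x) σ := by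
  obtain ⟨M, hM⟩ : ∃ M : Fin n → ℝ, ∀ k x, |Korn.pd k f x| ≤ M k := by
    choose M hM using fun k => (hf.pd k).nice.bounded
    exact ⟨M, hM⟩
  have h1 := hf.continuous
  have h2 : ∀ k, Continuous (Korn.pd k f) := fun k => (hf.pd k).nice.continuous
  have hI : ∀ k, Integrable (fun z : Euc n => Korn.pd k f (x + σ • z) * z k) (gauss n) := by
    intro k
    refine (integrable_norm_gauss.const_mul (M k)).mono' ?_ (.of_forall fun z => ?_)
    · have := h2 k
      exact (by fun_prop :
        Continuous fun z : Euc n => Korn.pd k f (x + σ • z) * z k).aestronglyMeasurable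
    · rw [norm_mul]
      exact mul_le_mul (hM k _) (PiLp.norm_apply_le z k) (norm_nonneg _)
        ((abs_nonneg _).trans (hM k 0))
  have := (hasDerivAt_integral_of_dominated_loc_of_deriv_le (μ := gauss n) (s := Set.univ)
    (F := fun (t : ℝ) z => f (x + t • z)) (x₀ := σ)
    (F' := fun t z => ∑ k, Korn.pd k f (x + t • z) * z k) (bound := fun z => ∑ k, M k * ‖z‖)
    Filter.univ_mem (.of_forall fun t => (by fun_prop :
      Continuous fun z => f (x + t • z)).aestronglyMeasurable)
    (hf.integrable_comp σ x)
    (by fun_prop : Continuous fun z : Euc n =>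
      ∑ k, Korn.pd k f (x + σ • z) * z k).aestronglyMeasurable
    (.of_forall fun z t _ => ?_)
    (integrable_finsetSum _ fun k _ => integrable_norm_gauss.const_mul _)
    (.of_forall fun z t _ => ?_)).2
  · rw [integral_finsetSum _ fun k _ => hI k] at this
    simp only [(hf.pd _).nice.integral_mul_coord] at this
    rwa [← Finset.mul_sum] at this
  · refine (norm_sum_le _ _).trans (Finset.sum_le_sum fun k _ => ?_)
    rw [norm_mul]
    exact mul_le_mul (hM k _) (PiLp.norm_apply_le z k) (norm_nonneg _)
        ((abs_nonneg _).trans (hM k 0))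
  · have hg : HasDerivAt (fun t : ℝ => x + t • z) z t := by
      simpa using ((hasDerivAt_id t).smul_const z).const_add x
    have := (hf.hasFDerivAt (x + t • z)).comp_hasDerivAt t hg
    rwa [fderiv_apply_eq_sum_pd] at this

lemma Nice.abs_heat_pd_le {f : Euc n → ℝ} (hf : Nice f) (k : Fin n) :
    ∃ C, 0 ≤ C ∧ ∀ σ, 0 < σ → ∀ x, |heat (Korn.pd k f) σ x| ≤ C / σ := by
  obtain ⟨M, hM⟩ := hf.bounded
  have hM0 : 0 ≤ M := (abs_nonneg _).trans (hM 0)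
  refine ⟨∫ z, M * ‖z‖ ∂gauss n, integral_nonneg fun z => by positivity, fun σ hσ x => ?_⟩
  rw [le_div_iff₀ hσ, mul_comm, ← abs_of_pos hσ, ← abs_mul, abs_of_pos hσ,
    ← hf.integral_mul_coord]
  refine norm_integral_le_of_norm_le (G := ℝ) (integrable_norm_gauss.const_mul M)
    (.of_forall fun z => ?_)
  rw [norm_mul]
  exact mul_le_mul (hM _) (PiLp.norm_apply_le z k) (norm_nonneg _) hM0

lemma Test.integrable_heat {f : Euc n → ℝ} (hf : Test f) (σ : ℝ) :
    Integrable (heat f σ) ∧ ∫ x, |heat f σ x| ≤ ∫ x, |f x| := by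
  have hc := hf.nice.continuous
  have hi := hf.integrable
  have hp : Integrable (fun q : Euc n × Euc n => f (q.1 + σ • q.2)) (volume.prod (gauss n)) := by
    rw [integrable_prod_iff' (by fun_prop :
      Continuous fun q : Euc n × Euc n => f (q.1 + σ • q.2)).aestronglyMeasurable]
    refine ⟨.of_forall fun z => hi.comp_add_right (σ • z), ?_⟩
    simp only [integral_add_right_eq_self (fun x => ‖f x‖)]
    exact integrable_const _
  refine ⟨hp.integral_prod_left, ?_⟩
  calc ∫ x, |heat f σ x| ≤ ∫ x, ∫ z, |f (x + σ • z)| ∂gauss n := by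
        refine integral_mono hp.integral_prod_left.abs hp.abs.integral_prod_left fun x => ?_
        exact abs_integral_le_integral_abs
    _ = ∫ z, ∫ x, |f (x + σ • z)| ∂volume ∂gauss n := integral_integral_swap hp.abs
    _ = _ := by
      simp only [integral_add_right_eq_self (fun x => |f x|)]
      simp

/-- Jensen's inequality for the heat extension. -/
lemma rpow_abs_heat_le {e w : Euc n → ℝ} (he : Nice e) (hw : Nice w) {r : ℝ} (hr : 1 ≤ r)
    (h : ∀ x, |e x| ^ r ≤ w x) (σ : ℝ) (x : Euc n) : |heat e σ x| ^ r ≤ heat w σ x := by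
  have hc := he.continuous
  have hcr : Continuous fun z => |e (x + σ • z)| ^ r :=
    (by fun_prop : Continuous fun z => |e (x + σ • z)|).rpow_const
      fun _ => Or.inr (by linarith)
  have hI : Integrable (fun z => |e (x + σ • z)| ^ r) (gauss n) := by
    refine (hw.integrable_comp σ x).mono' hcr.aestronglyMeasurable (.of_forall fun z => ?_)
    rw [Real.norm_of_nonneg (by positivity)]
    exact h _
  have h1 : |heat e σ x| ≤ ∫ z, |e (x + σ • z)| ∂gauss n := abs_integral_le_integral_abs
  have h2 := (convexOn_rpow hr).map_integral_le (μ := gauss n)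
    (f := fun z => |e (x + σ • z)|)
    (continuous_id.rpow_const fun _ => Or.inr (by linarith)).continuousOn
    isClosed_Ici (.of_forall fun z => Set.mem_Ici.2 (abs_nonneg _))
    (he.integrable_comp σ x).abs hI
  calc |heat e σ x| ^ r ≤ (∫ z, |e (x + σ • z)| ∂gauss n) ^ r := by gcongr
    _ ≤ ∫ z, |e (x + σ • z)| ^ r ∂gauss n := h2
    _ ≤ _ := integral_mono hI (hw.integrable_comp σ x) fun z => h _

end Korn

namespace Korn
variable {n : ℕ}

/-- Uniform boundedness in space and time. -/
def Bd (φ : ℝ → Euc n → ℝ) : Prop := ∃ M, ∀ σ x, |φ σ x| ≤ M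

lemma Bd.add {φ ψ : ℝ → Euc n → ℝ} (h1 : Bd φ) (h2 : Bd ψ) : Bd fun σ x => φ σ x + ψ σ x := by
  obtain ⟨M, hM⟩ := h1
  obtain ⟨N, hN⟩ := h2
  exact ⟨M + N, fun σ x => (abs_add_le _ _).trans (add_le_add (hM _ _) (hN _ _))⟩

lemma Bd.mul {φ ψ : ℝ → Euc n → ℝ} (h1 : Bd φ) (h2 : Bd ψ) : Bd fun σ x => φ σ x * ψ σ x := by
  obtain ⟨M, hM⟩ := h1
  obtain ⟨N, hN⟩ := h2
  refine ⟨M * N, fun σ x => ?_⟩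
  rw [abs_mul]
  exact mul_le_mul (hM _ _) (hN _ _) (abs_nonneg _) ((abs_nonneg _).trans (hM σ x))

lemma Bd.const (c : ℝ) : Bd fun _ (_ : Euc n) => c := ⟨|c|, fun _ _ => le_rfl⟩

lemma Bd.sum {ι : Type*} (s : Finset ι) {φ : ι → ℝ → Euc n → ℝ} (h : ∀ i, Bd (φ i)) :
    Bd fun σ x => ∑ i ∈ s, φ i σ x := by
  choose M hM using h
  exact ⟨∑ i ∈ s, M i, fun σ x =>
    (Finset.abs_sum_le_sum_abs _ _).trans (Finset.sum_le_sum fun i _ => hM i σ x)⟩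

lemma Nice.bd_heat {f : Euc n → ℝ} (hf : Nice f) : Bd (heat f) := by
  obtain ⟨M, hM⟩ := hf.bounded
  exact ⟨M, fun σ x => abs_heat_le hM σ x⟩

lemma Nice.le_heat {w : Euc n → ℝ} (hw : Nice w) {m : ℝ} (h : ∀ x, m ≤ w x) (σ : ℝ) (x : Euc n) :
    m ≤ heat w σ x := by
  simpa [heat_const] using heat_mono (Nice.const m) hw h σ x

lemma Nice.bd_rpow_heat {w : Euc n → ℝ} (hw : Nice w) {m : ℝ} (hm : 0 < m) (h : ∀ x, m ≤ w x)
    (r : ℝ) : Bd fun σ x => heat w σ x ^ r := by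
  obtain ⟨M, hM⟩ := hw.bd_heat
  refine ⟨m ^ r + |M| ^ r, fun σ x => ?_⟩
  have h1 := hw.le_heat h σ x
  have h2 : heat w σ x ≤ |M| := (le_abs_self _).trans ((hM σ x).trans (le_abs_self _))
  have h3 : 0 < heat w σ x := hm.trans_le h1
  have h4 : 0 < |M| := h3.trans_le h2
  rw [abs_of_nonneg (by positivity)]
  rcases le_total 0 r with hr | hr
  · have := Real.rpow_le_rpow h3.le h2 hr
    have : 0 < m ^ r := by positivity
    linarith
  · have := Real.rpow_le_rpow_of_nonpos hm h1 hr
    have : 0 < |M| ^ r := by positivity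
    linarith

/-- The product `w ^ r * b * c` of heat extensions. -/
noncomputable def term (w b c : Euc n → ℝ) (r σ : ℝ) (x : Euc n) : ℝ :=
  heat w σ x ^ r * heat b σ x * heat c σ x

/-- The contribution of the `k`-th direction to `(Δ - ∂_t) (w ^ r * b * c)`. -/
noncomputable def carre (w b c : Euc n → ℝ) (r σ : ℝ) (k : Fin n) (x : Euc n) : ℝ :=
  r * (r - 1) * heat w σ x ^ (r - 2) * heat (pd k w) σ x ^ 2 * heat b σ x * heat c σ x
    + 2 * r * heat w σ x ^ (r - 1) * heat (pd k w) σ x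
      * (heat (pd k b) σ x * heat c σ x + heat b σ x * heat (pd k c) σ x)
    + 2 * heat w σ x ^ r * heat (pd k b) σ x * heat (pd k c) σ x

lemma continuous_rpow_heat {w : Euc n → ℝ} (hw : Nice w) {m : ℝ} (hm : 0 < m)
    (hwm : ∀ x, m ≤ w x) (r σ : ℝ) : Continuous fun x => heat w σ x ^ r :=
  (hw.continuous_heat σ).rpow_const fun x => Or.inl (hm.trans_le (hw.le_heat hwm σ x)).ne'

lemma continuous_term {w b c : Euc n → ℝ} (hw : Nice w) (hb : Nice b) (hc : Nice c)
    {m : ℝ} (hm : 0 < m) (hwm : ∀ x, m ≤ w x) (r σ : ℝ) :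
    Continuous (term w b c r σ) :=
  ((continuous_rpow_heat hw hm hwm r σ).mul (hb.continuous_heat σ)).mul (hc.continuous_heat σ)

lemma continuous_carre {w b c : Euc n → ℝ} (hw : Nice w) (hb : Nice b) (hc : Nice c)
    {m : ℝ} (hm : 0 < m) (hwm : ∀ x, m ≤ w x) (r σ : ℝ) (k : Fin n) :
    Continuous (carre w b c r σ k) := by
  have h1 := continuous_rpow_heat hw hm hwm (σ := σ)
  have h2 := h1 r
  have h3 := h1 (r - 1)
  have h4 := h1 (r - 2)
  have := hb.continuous_heat σ
  have := hc.continuous_heat σ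
  have := (hw.pd k).nice.continuous_heat σ
  have := (hb.pd k).nice.continuous_heat σ
  have := (hc.pd k).nice.continuous_heat σ
  unfold carre
  fun_prop

/-- The derivative of `term` in direction `k`. -/
lemma hasLineDerivAt_term {w b c : Euc n → ℝ} (hw : Nice w) (hb : Nice b) (hc : Nice c)
    {m : ℝ} (hm : 0 < m) (hwm : ∀ x, m ≤ w x) (r σ : ℝ)
    (x : Euc n) (k : Fin n) :
    HasLineDerivAt ℝ (term w b c r σ)
      (r * term w (pd k w) b (r - 1) σ x * heat c σ x
        + term w (pd k b) c r σ x + term w b (pd k c) r σ x) x (bv k) := by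
  have h1 := hw.hasLineDerivAt_heat σ x k
  have h2 := hb.hasLineDerivAt_heat σ x k
  have h3 := hc.hasLineDerivAt_heat σ x k
  have hne : heat w σ (x + (0 : ℝ) • bv k) ≠ 0 := (hm.trans_le (hw.le_heat hwm σ _)).ne'
  have := ((HasDerivAt.rpow_const (p := r) h1 (Or.inl hne)).mul h2).mul h3
  refine HasDerivAt.congr_deriv this ?_
  simp only [zero_smul, add_zero, term, Pi.mul_apply]
  ring

lemma hasDerivAt_term {w b c : Euc n → ℝ} (hw : Nice w) (hb : Nice b) (hc : Nice c)
    {m : ℝ} (hm : 0 < m) (hwm : ∀ x, m ≤ w x) (r σ : ℝ)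
    (x : Euc n) :
    HasDerivAt (fun τ => term w b c r τ x)
      (σ * ∑ k, (r * heat w σ x ^ (r - 1) * heat (pd k (pd k w)) σ x * heat b σ x * heat c σ x
        + heat w σ x ^ r * (heat (pd k (pd k b)) σ x * heat c σ x
          + heat b σ x * heat (pd k (pd k c)) σ x))) σ := by
  have h1 := hw.hasDerivAt_heat σ x
  have h2 := hb.hasDerivAt_heat σ x
  have h3 := hc.hasDerivAt_heat σ x
  have hne : heat w σ x ≠ 0 := (hm.trans_le (hw.le_heat hwm σ _)).ne'
  have := ((HasDerivAt.rpow_const (p := r) h1 (Or.inl hne)).mul h2).mul h3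
  refine HasDerivAt.congr_deriv this ?_
  simp only [Pi.mul_apply, Finset.mul_sum, Finset.sum_mul, ← Finset.sum_add_distrib]
  refine Finset.sum_congr rfl fun k _ => ?_
  ring

/-- Integration by parts against a test function. -/
lemma integral_test_mul_lineDeriv {χ φ φ' : Euc n → ℝ} (hχ : Test χ) (hφ : Continuous φ)
    (hφ' : Continuous φ') {k : Fin n} (h : ∀ x, HasLineDerivAt ℝ φ (φ' x) x (bv k)) :
    ∫ x, χ x * φ' x = - ∫ x, pd k χ x * φ x := by
  have h1 := hχ.nice.continuous
  have h2 := (hχ.pd k).nice.continuous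
  refine integral_bilinear_hasLineDerivAt_right_eq_neg_left_of_integrable (μ := volume)
    (B := ContinuousLinearMap.mul ℝ ℝ) (v := bv k) ?_ ?_ ?_
    (fun x _ => (hχ.nice.hasFDerivAt x).hasLineDerivAt _) (fun x _ => h x)
  · exact (h2.mul hφ).integrable_of_hasCompactSupport (hχ.pd k).compact.mul_right
  · exact (h1.mul hφ').integrable_of_hasCompactSupport hχ.compact.mul_right
  · exact (h1.mul hφ).integrable_of_hasCompactSupport hχ.compact.mul_right

/-- The time derivative of a localized integral of `w ^ r * b * c`. -/
lemma hasDerivAt_integral_term {w b c χ : Euc n → ℝ} (hw : Nice w) (hb : Nice b) (hc : Nice c)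
    {m : ℝ} (hm : 0 < m) (hwm : ∀ x, m ≤ w x) (r : ℝ) (hχ : Test χ) (a σ : ℝ) :
    HasDerivAt (fun τ => ∫ x, χ x * (term w b c r τ x - a))
      (σ * ∑ k, ((∫ x, pd k (pd k χ) x * (term w b c r σ x - a))
        - ∫ x, χ x * carre w b c r σ k x)) σ := by
  have hχc := hχ.nice.continuous
  set D : Fin n → ℝ → Euc n → ℝ := fun k σ x =>
    r * heat w σ x ^ (r - 1) * heat (pd k (pd k w)) σ x * heat b σ x * heat c σ x
        + heat w σ x ^ r * (heat (pd k (pd k b)) σ x * heat c σ x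
          + heat b σ x * heat (pd k (pd k c)) σ x) with hD
  have hDb : Bd fun σ x => ∑ k, D k σ x := by
    refine Bd.sum _ fun k => ?_
    refine ((((((Bd.const r).mul (hw.bd_rpow_heat hm hwm (r - 1))).mul
      ((hw.pd k).pd k).nice.bd_heat).mul hb.bd_heat).mul hc.bd_heat)).add
      ((hw.bd_rpow_heat hm hwm r).mul ((((hb.pd k).pd k).nice.bd_heat.mul hc.bd_heat).add
        (hb.bd_heat.mul ((hc.pd k).pd k).nice.bd_heat)))
  have hDc : ∀ k σ, Continuous (D k σ) := by
    intro k σ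
    have h1 := continuous_rpow_heat hw hm hwm (σ := σ)
    have h2 := h1 r
    have h3 := h1 (r - 1)
    have := hb.continuous_heat σ
    have := hc.continuous_heat σ
    have := ((hw.pd k).pd k).nice.continuous_heat σ
    have := ((hb.pd k).pd k).nice.continuous_heat σ
    have := ((hc.pd k).pd k).nice.continuous_heat σ
    simp only [hD]
    fun_prop
  obtain ⟨M, hM⟩ := hDb
  have hTc : ∀ τ, Continuous (fun x => χ x * (term w b c r τ x - a)) := fun τ =>
    hχc.mul ((continuous_term hw hb hc hm hwm r τ).sub continuous_const)
  have hSc : Continuous fun x => χ x * (σ * ∑ k, D k σ x) := by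
    have := fun k => hDc k σ
    fun_prop
  have key := (hasDerivAt_integral_of_dominated_loc_of_deriv_le (μ := volume) (s := ball σ 1)
    (F := fun τ x => χ x * (term w b c r τ x - a)) (x₀ := σ)
    (F' := fun τ x => χ x * (τ * ∑ k, D k τ x)) (bound := fun x => |χ x| * ((|σ| + 1) * M))
    (ball_mem_nhds _ one_pos) (.of_forall fun τ => (hTc τ).aestronglyMeasurable)
    ((hTc σ).integrable_of_hasCompactSupport hχ.compact.mul_right)
    hSc.aestronglyMeasurable (.of_forall fun x τ hτ => ?_) (hχ.integrable.abs.mul_const _)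
    (.of_forall fun x τ _ => ((hasDerivAt_term hw hb hc hm hwm r τ x).sub_const a).const_mul _)).2
  · refine HasDerivAt.congr_deriv key (Eq.symm ?_)
    have hi : ∀ {φ : Euc n → ℝ}, Continuous φ → Integrable fun x => χ x * φ x := fun hφ =>
      (hχc.mul hφ).integrable_of_hasCompactSupport hχ.compact.mul_right
    have h1 : ∀ k, (∫ x, pd k (pd k χ) x * (term w b c r σ x - a))
        = ∫ x, χ x * (D k σ x + carre w b c r σ k x) := by
      intro k
      have hw' := (hw.pd k).nice
      have hb' := (hb.pd k).nice
      have hc' := (hc.pd k).nice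
      set T' : Euc n → ℝ := fun x => r * term w (pd k w) b (r - 1) σ x * heat c σ x
        + term w (pd k b) c r σ x + term w b (pd k c) r σ x with hT'
      have hcc := hc.continuous_heat σ
      have hT'c : Continuous T' :=
        ((((continuous_const.mul (continuous_term hw hw' hb hm hwm (r - 1) σ)).mul hcc).add
          (continuous_term hw hb' hc hm hwm r σ))).add (continuous_term hw hb hc' hm hwm r σ)
      have e1 := integral_test_mul_lineDeriv (hχ.pd k) (φ := fun x => term w b c r σ x - a)
        ((continuous_term hw hb hc hm hwm r σ).sub continuous_const) hT'c (k := k) (fun x =>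
          (hasLineDerivAt_term hw hb hc hm hwm r σ x k).sub_const a)
      have e2 := integral_test_mul_lineDeriv hχ (φ := T')
        (φ' := fun x => D k σ x + carre w b c r σ k x) hT'c
        ((hDc k σ).add (continuous_carre hw hb hc hm hwm r σ k)) (k := k) (fun x => ?_)
      · rw [e2, e1, neg_neg]
      · have d1 := (((hasLineDerivAt_term hw hw' hb hm hwm (r - 1) σ x k).const_mul r).mul
          (hc.hasLineDerivAt_heat σ x k))
        have d2 := hasLineDerivAt_term hw hb' hc hm hwm r σ x k
        have d3 := hasLineDerivAt_term hw hb hc' hm hwm r σ x k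
        have d4 := HasDerivAt.add (HasDerivAt.add d1 d2) d3
        have d5 : HasLineDerivAt ℝ T' _ x (bv k) := d4
        refine HasDerivAt.congr_deriv d5 ?_
        simp only [hD, carre, term, zero_smul, add_zero, show r - 1 - 1 = r - 2 by ring]
        ring
    calc σ * ∑ k, ((∫ x, pd k (pd k χ) x * (term w b c r σ x - a))
          - ∫ x, χ x * carre w b c r σ k x) = σ * ∑ k, ∫ x, χ x * D k σ x := by
          congr 1
          refine Finset.sum_congr rfl fun k _ => ?_
          rw [h1 k, ← integral_sub (hi (φ := fun x => D k σ x + carre w b c r σ k x)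
              ((hDc k σ).add (continuous_carre hw hb hc hm hwm r σ k)))
            (hi (continuous_carre hw hb hc hm hwm r σ k))]
          congr 1 with x
          ring
      _ = _ := by
          rw [← integral_finsetSum _ fun k _ => hi (hDc k σ), ← integral_const_mul]
          congr 1 with x
          rw [Finset.mul_sum, Finset.mul_sum, Finset.mul_sum]
          refine Finset.sum_congr rfl fun k _ => by ring
  · rw [norm_mul, norm_mul]
    have h1 : |τ| ≤ |σ| + 1 := by
      have : |τ - σ| < 1 := by simpa [Real.dist_eq] using hτ
      have := abs_sub_abs_le_abs_sub τ σ
      linarith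
    exact mul_le_mul_of_nonneg_left (mul_le_mul h1 (hM τ x) (abs_nonneg _) (by positivity))
      (abs_nonneg _)

end Korn

namespace Korn
variable {n : ℕ}

/-- Uniformly bounded integrals in space. -/
def UI (φ : ℝ → Euc n → ℝ) : Prop := ∃ M, ∀ σ, Integrable (φ σ) ∧ ∫ x, |φ σ x| ≤ M

lemma UI.add {φ ψ : ℝ → Euc n → ℝ} (h1 : UI φ) (h2 : UI ψ) : UI fun σ x => φ σ x + ψ σ x := by
  obtain ⟨M, hM⟩ := h1
  obtain ⟨N, hN⟩ := h2
  refine ⟨M + N, fun σ => ⟨(hM σ).1.add (hN σ).1, ?_⟩⟩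
  calc ∫ x, |φ σ x + ψ σ x| ≤ ∫ x, |φ σ x| + |ψ σ x| :=
        integral_mono ((hM σ).1.add (hN σ).1).abs ((hM σ).1.abs.add (hN σ).1.abs)
          fun x => abs_add_le _ _
    _ = (∫ x, |φ σ x|) + ∫ x, |ψ σ x| := integral_add (hM σ).1.abs (hN σ).1.abs
    _ ≤ _ := add_le_add (hM σ).2 (hN σ).2

lemma UI.const_mul {φ : ℝ → Euc n → ℝ} (h1 : UI φ) (c : ℝ) : UI fun σ x => c * φ σ x := by
  obtain ⟨M, hM⟩ := h1
  refine ⟨|c| * M, fun σ => ⟨(hM σ).1.const_mul c, ?_⟩⟩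
  simp only [abs_mul]
  rw [integral_const_mul]
  exact mul_le_mul_of_nonneg_left (hM σ).2 (abs_nonneg _)

lemma UI.sum {ι : Type*} (s : Finset ι) {φ : ι → ℝ → Euc n → ℝ} (h : ∀ i, UI (φ i)) :
    UI fun σ x => ∑ i ∈ s, φ i σ x := by
  classical
  induction s using Finset.induction_on with
  | empty => exact ⟨0, fun σ => by simp⟩
  | insert a s ha ih =>
    simp only [Finset.sum_insert ha]
    exact (h a).add ih

lemma UI.of_le {φ : ℝ → Euc n → ℝ} {f : Euc n → ℝ} (hφ : ∀ σ, Continuous (φ σ)) (hf : Test f)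
    {M : ℝ} (h : ∀ σ x, |φ σ x| ≤ M * |heat f σ x|) : UI φ := by
  refine ⟨|M| * ∫ x, |f x|, fun σ => ?_⟩
  have hi : Integrable (fun x => |M| * |heat f σ x|) := (hf.integrable_heat σ).1.abs.const_mul _
  have hle : ∀ x, |φ σ x| ≤ |M| * |heat f σ x| := fun x =>
    (h σ x).trans (mul_le_mul_of_nonneg_right (le_abs_self _) (abs_nonneg _))
  have h2 : Integrable (φ σ) := hi.mono' (hφ σ).aestronglyMeasurable (.of_forall hle)
  refine ⟨h2, (integral_mono h2.abs hi hle).trans ?_⟩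
  rw [integral_const_mul]
  exact mul_le_mul_of_nonneg_left (hf.integrable_heat σ).2 (abs_nonneg _)

lemma ui_term {w b c : Euc n → ℝ} (hw : Nice w) (hb : Nice b) (hc : Test c) {m : ℝ} (hm : 0 < m)
    (hwm : ∀ x, m ≤ w x) (r : ℝ) : UI (term w b c r) := by
  obtain ⟨M, hM⟩ := (hw.bd_rpow_heat hm hwm r).mul hb.bd_heat
  refine UI.of_le (continuous_term hw hb hc.nice hm hwm r) hc (M := M) fun σ x => ?_
  rw [term, abs_mul]
  exact mul_le_mul_of_nonneg_right (hM σ x) (abs_nonneg _)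

lemma rpow_sub_rpow_le {a b M s : ℝ} (ha : 0 < a) (hab : a ≤ b) (hbM : b ≤ M) (hs : 1 ≤ s) :
    b ^ s - a ^ s ≤ s * M ^ (s - 1) * (b - a) := by
  have hb : 0 < b := ha.trans_le hab
  have h : -1 ≤ a / b - 1 := by have : 0 < a / b := by positivity
                                linarith
  have h1 := one_add_mul_self_le_rpow_one_add h hs
  have h2 : (1 + (a / b - 1)) ^ s = a ^ s / b ^ s := by
    rw [← Real.div_rpow ha.le hb.le]; ring_nf
  rw [h2, le_div_iff₀ (by positivity)] at h1
  have h3 : b ^ s = b ^ (s - 1) * b := by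
    rw [← Real.rpow_add_one hb.ne']; ring_nf
  have h4 : (1 + s * (a / b - 1)) * b ^ s = b ^ s - s * b ^ (s - 1) * (b - a) := by
    rw [h3]; field_simp; ring
  have h5 : b ^ (s - 1) ≤ M ^ (s - 1) := Real.rpow_le_rpow hb.le hbM (by linarith)
  have h6 : s * b ^ (s - 1) * (b - a) ≤ s * M ^ (s - 1) * (b - a) := by
    have : 0 ≤ b - a := by linarith
    gcongr
  linarith

lemma ui_rpow {w : Euc n → ℝ} (hw : Nice w) {m : ℝ} (hm : 0 < m)
    (hwm : ∀ x, m ≤ w x) (hwt : HasCompactSupport fun x => w x - m) {s : ℝ} (hs : 1 ≤ s) :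
    UI fun σ x => term w (fun _ => 1) (fun _ => 1) s σ x - m ^ s := by
  obtain ⟨M, hM⟩ := hw.bd_heat
  have hc : Continuous fun x => w x - m := hw.continuous.sub continuous_const
  have ht : Test fun x => w x - m := ⟨hw.smooth.sub contDiff_const, hwt⟩
  refine UI.of_le (fun σ => (continuous_term hw (Nice.const 1) (Nice.const 1) hm hwm s σ).sub
    continuous_const) ht (M := s * M ^ (s - 1)) fun σ x => ?_
  have h1 := hw.le_heat hwm σ x
  have h2 : heat (fun x => w x - m) σ x = heat w σ x - m := by
    rw [heat_sub hw (Nice.const m), heat_const]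
  simp only [term, heat_const, mul_one]
  rw [h2, abs_of_nonneg (sub_nonneg.2 h1), abs_of_nonneg]
  · exact rpow_sub_rpow_le hm h1 ((le_abs_self _).trans (hM σ x)) hs
  · exact sub_nonneg.2 (Real.rpow_le_rpow hm.le h1 (by linarith))

/-- Lower bound for the carré du champ of `w ^ r * b ^ 2`. -/
lemma carre_lower {w b wk bk r s : ℝ} (hw : 0 < w) (hb : b ^ 2 ≤ w ^ (s - r)) :
    w ^ r * bk ^ 2 - (3 * r ^ 2 + |r|) * (w ^ (s - 2) * wk ^ 2) ≤
      r * (r - 1) * w ^ (r - 2) * wk ^ 2 * b * b + 2 * r * w ^ (r - 1) * wk * (bk * b + b * bk)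
        + 2 * w ^ r * bk * bk := by
  have hP : 0 < w ^ (r - 2) := by positivity
  have h1 : w ^ (r - 1) = w ^ (r - 2) * w := by rw [← Real.rpow_add_one hw.ne']; ring_nf
  have h2 : w ^ r = w ^ (r - 2) * w ^ 2 := by
    rw [← Real.rpow_natCast, ← Real.rpow_add hw]; norm_num
  have h3 : w ^ (r - 2) * b ^ 2 ≤ w ^ (s - 2) := by
    have : w ^ (s - 2) = w ^ (r - 2) * w ^ (s - r) := by rw [← Real.rpow_add hw]; ring_nf
    rw [this]; gcongr
  rw [h1, h2]
  have h4 : (3 * r ^ 2 + |r|) * (w ^ (r - 2) * b ^ 2 * wk ^ 2)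
      ≤ (3 * r ^ 2 + |r|) * (w ^ (s - 2) * wk ^ 2) := by gcongr
  have h5 : 0 ≤ w ^ (r - 2) * (w * bk + 2 * r * wk * b) ^ 2 := by positivity
  have h6 : r * (w ^ (r - 2) * b ^ 2 * wk ^ 2) ≤ |r| * (w ^ (r - 2) * b ^ 2 * wk ^ 2) :=
    mul_le_mul_of_nonneg_right (le_abs_self r) (by positivity)
  nlinarith

lemma sq_le_of_rpow_abs_le {b w r a : ℝ} (hr : 0 < r) (ha : 2 / r = a) (h : |b| ^ r ≤ w) :
    b ^ 2 ≤ w ^ a := by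
  have h1 : b ^ 2 = (|b| ^ r) ^ a := by
    rw [← Real.rpow_mul (abs_nonneg b), ← ha, mul_div_cancel₀ _ hr.ne', Real.rpow_two, sq_abs]
  rw [h1]
  exact Real.rpow_le_rpow (by positivity) h (by rw [← ha]; positivity)

/-- The data for the heat flow argument. -/
structure Flow {ι : Type*} [Fintype ι] (e : ι → Euc n → ℝ) (g W w : Euc n → ℝ) (m s β : ℝ) :
    Prop where
  he : ∀ a, Test (e a)
  hg : Test g
  hW : Test W
  hw : Nice w
  hm : 0 < m
  hwm : ∀ x, m ≤ w x
  hwt : HasCompactSupport fun x => w x - m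
  hs : 1 < s
  sq_e : ∀ a σ x, heat (e a) σ x ^ 2 ≤ heat w σ x ^ (s + β)
  sq_g : ∀ σ x, heat g σ x ^ 2 ≤ heat w σ x ^ (s - β)
  grad : ∀ σ x, ∑ k, heat (pd k W) σ x ^ 2 ≤ 4 * ∑ k, ∑ a, heat (pd k (e a)) σ x ^ 2
  decay : ∃ C, 0 ≤ C ∧ ∀ σ, 0 < σ → ∀ x, |heat W σ x| ≤ C / σ

lemma integral_combination {ι : Type*} [Fintype ι] {f : ι → Euc n → ℝ} {f₁ f₂ f₃ : Euc n → ℝ}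
    (h : ∀ a, Integrable (f a)) (h1 : Integrable f₁) (h2 : Integrable f₂) (h3 : Integrable f₃)
    (c d : ℝ) : ∫ x, ((∑ a, f a x) + f₁ x + c * f₂ x + d * f₃ x)
      = (∑ a, ∫ x, f a x) + (∫ x, f₁ x) + c * (∫ x, f₂ x) + d * ∫ x, f₃ x := by
  have hs := integrable_finsetSum Finset.univ fun a _ => h a
  have e1 : ∫ x, ((∑ a, f a x) + f₁ x) = (∫ x, ∑ a, f a x) + ∫ x, f₁ x := integral_add hs h1
  have e2 : ∫ x, ((∑ a, f a x) + f₁ x + c * f₂ x)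
      = (∫ x, ((∑ a, f a x) + f₁ x)) + ∫ x, c * f₂ x := integral_add (hs.add h1) (h2.const_mul c)
  have e3 : ∫ x, ((∑ a, f a x) + f₁ x + c * f₂ x + d * f₃ x)
      = (∫ x, ((∑ a, f a x) + f₁ x + c * f₂ x)) + ∫ x, d * f₃ x :=
    integral_add ((hs.add h1).add (h2.const_mul c)) (h3.const_mul d)
  rw [e3, e2, e1, integral_finsetSum _ fun a _ => h a, integral_const_mul, integral_const_mul]

namespace Flow
variable {ι : Type*} [Fintype ι] {e : ι → Euc n → ℝ} {g W w : Euc n → ℝ} {m s β : ℝ}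

/-- The constant in front of `w ^ s`. -/
noncomputable def coef (N : ℕ) (s β : ℝ) : ℝ := (N + 1) * (3 * β ^ 2 + |β|) / (s * (s - 1))

lemma carre_nonneg (h : Flow e g W w m s β) (σ : ℝ) (x : Euc n) :
    0 ≤ ∑ k, ((∑ a, carre w (e a) (e a) (-β) σ k x) + carre w g g β σ k x
      + coef (Fintype.card ι) s β * carre w (fun _ => 1) (fun _ => 1) s σ k x
      + (-(1 / 4)) * carre w W g 0 σ k x) := by
  have hwp : 0 < heat w σ x := h.hm.trans_le (h.hw.le_heat h.hwm σ x)
  have hs := h.hs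
  set ω := heat w σ x with hω
  have key : ∀ k, (∑ a, ω ^ (-β) * heat (pd k (e a)) σ x ^ 2)
      - 1 / 4 * (ω ^ (-β) * heat (pd k W) σ x ^ 2) ≤
      (∑ a, carre w (e a) (e a) (-β) σ k x) + carre w g g β σ k x
      + coef (Fintype.card ι) s β * carre w (fun _ => 1) (fun _ => 1) s σ k x
      + (-(1 / 4)) * carre w W g 0 σ k x := by
    intro k
    set wk := heat (pd k w) σ x with hwk
    set A := ω ^ (s - 2) * wk ^ 2 with hA
    have h1 : ∀ a, ω ^ (-β) * heat (pd k (e a)) σ x ^ 2 - (3 * β ^ 2 + |β|) * A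
        ≤ carre w (e a) (e a) (-β) σ k x := by
      intro a
      have := carre_lower (w := ω) (b := heat (e a) σ x) (wk := wk) (bk := heat (pd k (e a)) σ x)
        (r := -β) (s := s) hwp (by simpa using h.sq_e a σ x)
      simpa [carre] using this
    have h2 : ω ^ β * heat (pd k g) σ x ^ 2 - (3 * β ^ 2 + |β|) * A
        ≤ carre w g g β σ k x := by
      have := carre_lower (w := ω) (b := heat g σ x) (wk := wk) (bk := heat (pd k g) σ x)
        (r := β) (s := s) hwp (h.sq_g σ x)
      simpa [carre] using this
    have h3 : coef (Fintype.card ι) s β * carre w (fun _ => 1) (fun _ => 1) s σ k x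
        = (Fintype.card ι + 1) * (3 * β ^ 2 + |β|) * A := by
      have hz : pd k (fun _ : Euc n => (1 : ℝ)) = fun _ => 0 := by ext y; simp [pd]
      have : s - 1 ≠ 0 := by linarith
      simp only [carre, hz, heat_const, coef, hA, ← hω, ← hwk]
      field_simp
      ring
    have h4 : (-(1 / 4)) * carre w W g 0 σ k x
        = - (1 / 2) * (heat (pd k W) σ x * heat (pd k g) σ x) := by
      simp [carre]; ring
    have h5 : ∑ a, (ω ^ (-β) * heat (pd k (e a)) σ x ^ 2 - (3 * β ^ 2 + |β|) * A)
        ≤ ∑ a, carre w (e a) (e a) (-β) σ k x := Finset.sum_le_sum fun a _ => h1 a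
    rw [Finset.sum_sub_distrib, Finset.sum_const, Finset.card_univ, nsmul_eq_mul] at h5
    have h6 : 1 / 2 * (heat (pd k W) σ x * heat (pd k g) σ x)
        ≤ 1 / 4 * (ω ^ (-β) * heat (pd k W) σ x ^ 2) + ω ^ β * heat (pd k g) σ x ^ 2 := by
      have hp : 0 < ω ^ β := by positivity
      have e1 : ω ^ (-β) = (ω ^ β)⁻¹ := Real.rpow_neg hwp.le β
      rw [e1]
      set y := ω ^ β
      set A' := heat (pd k W) σ x
      set B' := heat (pd k g) σ x
      have e2 : 1 / 4 * (y⁻¹ * A' ^ 2) + y * B' ^ 2 - 1 / 2 * (A' * B')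
          = y⁻¹ * ((A' / 2 - y * B' / 2) ^ 2 + 3 / 4 * (y * B') ^ 2) := by
        field_simp; ring
      have : 0 ≤ y⁻¹ * ((A' / 2 - y * B' / 2) ^ 2 + 3 / 4 * (y * B') ^ 2) := by positivity
      linarith
    rw [h3, h4]
    linarith
  refine le_trans ?_ (Finset.sum_le_sum fun k _ => key k)
  have h7 := h.grad σ x
  have h8 : 0 < ω ^ (-β) := by positivity
  simp only [Finset.sum_sub_distrib, ← Finset.mul_sum]
  nlinarith

/-- The monotone quantity. -/
noncomputable def phi (e : ι → Euc n → ℝ) (g W w : Euc n → ℝ) (m s β σ : ℝ) (x : Euc n) : ℝ :=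
  (∑ a, (term w (e a) (e a) (-β) σ x - 0)) + (term w g g β σ x - 0)
    + coef (Fintype.card ι) s β * (term w (fun _ => 1) (fun _ => 1) s σ x - m ^ s)
    + (-(1 / 4)) * (term w W g 0 σ x - 0)

lemma ui_phi (h : Flow e g W w m s β) : UI (phi e g W w m s β) := by
  unfold phi
  simp only [sub_zero]
  exact (((UI.sum _ fun a => ui_term h.hw (h.he a).nice (h.he a) h.hm h.hwm _).add
    (ui_term h.hw h.hg.nice h.hg h.hm h.hwm _)).add
    ((ui_rpow h.hw h.hm h.hwm h.hwt h.hs.le).const_mul _)).add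
    ((ui_term h.hw h.hW.nice h.hg h.hm h.hwm _).const_mul _)

lemma hasDerivAt_integral_phi (h : Flow e g W w m s β) {χ : Euc n → ℝ} (hχ : Test χ) (σ : ℝ) :
    HasDerivAt (fun τ => ∫ x, χ x * phi e g W w m s β τ x)
      (σ * ((∑ k, ∫ x, pd k (pd k χ) x * phi e g W w m s β σ x)
        - ∫ x, χ x * ∑ k, ((∑ a, carre w (e a) (e a) (-β) σ k x) + carre w g g β σ k x
      + coef (Fintype.card ι) s β * carre w (fun _ => 1) (fun _ => 1) s σ k x
      + (-(1 / 4)) * carre w W g 0 σ k x))) σ := by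
  have hi : ∀ {χ φ : Euc n → ℝ}, Test χ → Continuous φ → Integrable fun x => χ x * φ x :=
    fun hχ hφ => (hχ.nice.continuous.mul hφ).integrable_of_hasCompactSupport hχ.compact.mul_right
  have hw := h.hw
  have hm := h.hm
  have hwm := h.hwm
  have he := fun a => (h.he a).nice
  have hg := h.hg.nice
  have hW := h.hW.nice
  have h1 := Nice.const (n := n) 1
  have ct : ∀ {b c : Euc n → ℝ} (hb : Nice b) (hc : Nice c) (r a τ : ℝ),
      Continuous fun x => term w b c r τ x - a := fun hb hc r a τ =>
    (continuous_term hw hb hc hm hwm r τ).sub continuous_const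
  have split : ∀ {χ : Euc n → ℝ}, Test χ → ∀ τ, ∫ x, χ x * phi e g W w m s β τ x
      = (∑ a, ∫ x, χ x * (term w (e a) (e a) (-β) τ x - 0))
        + (∫ x, χ x * (term w g g β τ x - 0))
        + coef (Fintype.card ι) s β
          * (∫ x, χ x * (term w (fun _ => 1) (fun _ => 1) s τ x - m ^ s))
        + (-(1 / 4)) * (∫ x, χ x * (term w W g 0 τ x - 0)) := by
    intro χ hχ τ
    have i1 := fun a => hi hχ (ct (he a) (he a) (-β) 0 τ)
    have i2 := hi hχ (ct hg hg β 0 τ)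
    have i3 := hi hχ (ct h1 h1 s (m ^ s) τ)
    have i4 := hi hχ (ct hW hg 0 0 τ)
    rw [← integral_combination i1 i2 i3 i4]
    congr 1 with x
    simp only [phi, mul_add, Finset.mul_sum]
    ring
  have cc : ∀ {b c : Euc n → ℝ} (hb : Nice b) (hc : Nice c) (r : ℝ) (k : Fin n),
      Continuous fun x => carre w b c r σ k x := fun hb hc r k =>
    continuous_carre hw hb hc hm hwm r σ k
  have d1 := fun a => hasDerivAt_integral_term hw (he a) (he a) hm hwm (-β) hχ 0 σ
  have d2 := hasDerivAt_integral_term hw hg hg hm hwm β hχ 0 σ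
  have d3 := (hasDerivAt_integral_term hw h1 h1 hm hwm s hχ (m ^ s) σ).const_mul
    (coef (Fintype.card ι) s β)
  have d4 := (hasDerivAt_integral_term hw hW hg hm hwm 0 hχ 0 σ).const_mul (-(1 / 4))
  have d := ((((HasDerivAt.fun_sum (u := Finset.univ) fun a _ => d1 a).add d2).add d3).add d4)
  have ef : (fun τ => ∫ x, χ x * phi e g W w m s β τ x) = _ := funext fun τ => split hχ τ
  rw [ef]
  refine HasDerivAt.congr_deriv d ?_
  have split2 : ∫ x, χ x * ∑ k, ((∑ a, carre w (e a) (e a) (-β) σ k x) + carre w g g β σ k x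
      + coef (Fintype.card ι) s β * carre w (fun _ => 1) (fun _ => 1) s σ k x
      + (-(1 / 4)) * carre w W g 0 σ k x) = ∑ k, ((∑ a, ∫ x, χ x * carre w (e a) (e a) (-β) σ k x)
        + (∫ x, χ x * carre w g g β σ k x) + coef (Fintype.card ι) s β
          * (∫ x, χ x * carre w (fun _ => 1) (fun _ => 1) s σ k x)
        + (-(1 / 4)) * ∫ x, χ x * carre w W g 0 σ k x) := by
    have i1 := fun k a => hi hχ (cc (he a) (he a) (-β) k)
    have i2 := fun k => hi hχ (cc hg hg β k)
    have i3 := fun k => hi hχ (cc h1 h1 s k)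
    have i4 := fun k => hi hχ (cc hW hg 0 k)
    simp only [Finset.mul_sum]
    rw [integral_finsetSum]
    · refine Finset.sum_congr rfl fun k _ => ?_
      rw [← integral_combination (i1 k) (i2 k) (i3 k) (i4 k)]
      congr 1 with x
      simp only [mul_add, Finset.mul_sum]
      ring
    · intro k _
      refine hi hχ ?_
      have c1 := fun a => cc (he a) (he a) (-β) k
      have c2 := cc hg hg β k
      have c3 := cc h1 h1 s k
      have c4 := cc hW hg 0 k
      fun_prop
  rw [split2]
  simp only [fun k => split ((hχ.pd k).pd k) σ]
  rw [← Finset.mul_sum]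
  simp only [Finset.sum_add_distrib, Finset.sum_sub_distrib, ← Finset.mul_sum]
  rw [Finset.sum_comm (s := (Finset.univ : Finset ι))
      (f := fun a k => ∫ x, pd k (pd k χ) x * (term w (e a) (e a) (-β) σ x - 0)),
    Finset.sum_comm (s := (Finset.univ : Finset ι))
      (f := fun a k => ∫ x, χ x * carre w (e a) (e a) (-β) σ k x)]
  ring

end Flow
end Korn

namespace Korn
variable {n : ℕ}

lemma pd_comp_smul {f : Euc n → ℝ} (hf : Differentiable ℝ f) (k : Fin n) (c : ℝ) :
    pd k (fun x => f (c • x)) = fun x => c * pd k f (c • x) := by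
  ext x
  have h1 : HasFDerivAt (fun x : Euc n => c • x) (c • ContinuousLinearMap.id ℝ (Euc n)) x :=
    (hasFDerivAt_id x).const_smul c
  have := ((hf (c • x)).hasFDerivAt.comp x h1).fderiv
  simp only [Function.comp_def] at this
  simp [pd, this]

lemma Test.comp_smul {f : Euc n → ℝ} (hf : Test f) {c : ℝ} (hc : c ≠ 0) :
    Test fun x => f (c • x) :=
  ⟨hf.smooth.comp (contDiff_const_smul c),
    hf.compact.comp_homeomorph (Homeomorph.smulOfNeZero c hc)⟩

/-- Smooth cutoff functions at scale `R` with second derivatives of size `R ^ (-2)`. -/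
lemma exists_cutoff (n : ℕ) : ∃ χ : Euc n → ℝ, Test χ ∧ (∀ x, 0 ≤ χ x) ∧ (∀ x, χ x ≤ 1) ∧
    χ 0 = 1 := by
  let b : ContDiffBump (0 : Euc n) := ⟨1, 2, one_pos, one_lt_two⟩
  refine ⟨b, ⟨b.contDiff, b.hasCompactSupport⟩, fun x => b.nonneg, fun x => b.le_one, ?_⟩
  exact b.one_of_mem_closedBall (by simp [b])

namespace Flow
variable {ι : Type*} [Fintype ι] {e : ι → Euc n → ℝ} {g W w : Euc n → ℝ} {m s β : ℝ}

lemma integral_cutoff_le (h : Flow e g W w m s β) {M : ℝ}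
    (hM : ∀ σ, Integrable (phi e g W w m s β σ) ∧ ∫ x, |phi e g W w m s β σ x| ≤ M)
    {χ : Euc n → ℝ} (hχ : Test χ) (hχ0 : ∀ x, 0 ≤ χ x) {D : ℝ} (hD0 : 0 ≤ D)
    (hD : ∀ k x, |pd k (pd k χ) x| ≤ D)
    {T : ℝ} (hT : 0 ≤ T) :
    ∫ x, χ x * phi e g W w m s β T x ≤ (∫ x, χ x * phi e g W w m s β 0 x)
      + n * (D * M) * T ^ 2 / 2 := by
  have hd := h.hasDerivAt_integral_phi hχ
  set H := fun τ => ∫ x, χ x * phi e g W w m s β τ x with hH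
  set c : ℝ := n * (D * M)
  have hG : ∀ τ, HasDerivAt (fun τ => H τ - c * τ ^ 2 / 2) _ τ := fun τ =>
    (hd τ).sub (((hasDerivAt_pow 2 τ).const_mul c).div_const 2)
  have hanti : AntitoneOn (fun τ => H τ - c * τ ^ 2 / 2) (Set.Ici 0) := by
    refine antitoneOn_of_deriv_nonpos (convex_Ici 0)
      (fun τ _ => (hG τ).continuousAt.continuousWithinAt)
      (fun τ _ => (hG τ).differentiableAt.differentiableWithinAt) fun τ hτ => ?_
    rw [interior_Ici, Set.mem_Ioi] at hτ
    rw [(hG τ).deriv]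
    have h1 : ∑ k, ∫ x, pd k (pd k χ) x * phi e g W w m s β τ x ≤ c := by
      have : ∀ k : Fin n, ∫ x, pd k (pd k χ) x * phi e g W w m s β τ x ≤ D * M := by
        intro k
        have hi := (hM τ).1.abs.const_mul D
        refine (le_abs_self _).trans ((norm_integral_le_of_norm_le (G := ℝ) hi
          (.of_forall fun x => ?_)).trans ?_)
        · rw [norm_mul]
          exact mul_le_mul_of_nonneg_right (hD k x) (norm_nonneg _)
        · rw [integral_const_mul]
          exact mul_le_mul_of_nonneg_left (hM τ).2 hD0
      calc _ ≤ ∑ _k : Fin n, D * M := Finset.sum_le_sum fun k _ => this k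
        _ = c := by simp [c]
    have h2 := integral_nonneg (μ := volume) (f := fun x => χ x * _) fun x =>
      mul_nonneg (hχ0 x) (h.carre_nonneg τ x)
    simp only [Nat.cast_ofNat, Nat.add_one_sub_one, pow_one]
    have h3 := mul_le_mul_of_nonneg_left (sub_le_sub h1 h2) hτ.le
    linarith
  have := hanti (Set.mem_Ici.2 le_rfl) (Set.mem_Ici.2 hT) hT
  simp only at this
  have h0 : H 0 - c * 0 ^ 2 / 2 = H 0 := by simp
  rw [h0] at this
  linarith

lemma le_phi (h : Flow e g W w m s β) (σ : ℝ) (x : Euc n) :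
    -(1 / 4) * (heat W σ x * heat g σ x) ≤ phi e g W w m s β σ x := by
  have hge := h.hw.le_heat h.hwm σ x
  have hwp : 0 < heat w σ x := h.hm.trans_le hge
  have h1 : 0 ≤ ∑ a, (term w (e a) (e a) (-β) σ x - 0) := by
    refine Finset.sum_nonneg fun a _ => ?_
    rw [sub_zero, term, mul_assoc]
    exact mul_nonneg (by positivity) (mul_self_nonneg _)
  have h2 : 0 ≤ term w g g β σ x - 0 := by
    rw [sub_zero, term, mul_assoc]
    exact mul_nonneg (by positivity) (mul_self_nonneg _)
  have h3 : 0 ≤ coef (Fintype.card ι) s β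
      * (term w (fun _ => 1) (fun _ => 1) s σ x - m ^ s) := by
    have hs := h.hs
    have h4 : 0 < s - 1 := by linarith
    have h5 : 0 < s := by linarith
    refine mul_nonneg (by unfold coef; positivity) ?_
    simp only [term, heat_const, mul_one]
    exact sub_nonneg.2 (Real.rpow_le_rpow h.hm.le hge h5.le)
  have h4 : term w W g 0 σ x = heat W σ x * heat g σ x := by simp [term]
  rw [phi, h4]
  linarith

lemma integral_phi_nonneg (h : Flow e g W w m s β) :
    Integrable (phi e g W w m s β 0) ∧ 0 ≤ ∫ x, phi e g W w m s β 0 x := by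
  obtain ⟨M, hM⟩ := h.ui_phi
  refine ⟨(hM 0).1, ?_⟩
  obtain ⟨χ, hχ, hχ0, hχ1, hχe⟩ := exists_cutoff n
  obtain ⟨C, hC, hdec⟩ := h.decay
  obtain ⟨D, hD0, hD⟩ : ∃ D, 0 ≤ D ∧ ∀ k x, |pd k (pd k χ) x| ≤ D := by
    choose D hD using fun k => ((hχ.pd k).pd k).nice.bounded
    refine ⟨∑ k, |D k|, Finset.sum_nonneg fun k _ => abs_nonneg _, fun k x => ?_⟩
    exact (hD k x).trans ((le_abs_self _).trans
      (Finset.single_le_sum (f := fun k => |D k|) (fun i _ => abs_nonneg _) (Finset.mem_univ k)))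
  have key : ∀ T : ℝ, 0 < T → ∀ r : ℝ, 0 < r →
      -(1 / 4) * (C / T) * ∫ x, |g x| ≤ (∫ x, χ (r • x) * phi e g W w m s β 0 x)
        + n * ((r ^ 2 * D) * M) * T ^ 2 / 2 := by
    intro T hT r hr
    have hχr : Test fun x => χ (r • x) := hχ.comp_smul hr.ne'
    have hpp : ∀ k, pd k (pd k fun x => χ (r • x))
        = fun x => r * (r * pd k (pd k χ) (r • x)) := by
      intro k
      have hd : ∀ {f : Euc n → ℝ}, Test f → Differentiable ℝ f := fun hf =>
        hf.smooth.differentiable (by simp)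
      rw [pd_comp_smul (hd hχ)]
      have := pd_comp_smul (hd (hχ.pd k)) k r
      ext x
      have h2 : pd k (fun x => r * pd k χ (r • x)) x
          = r * pd k (fun x => pd k χ (r • x)) x := by
        unfold pd
        rw [fderiv_const_mul]
        · simp
        · exact hd ((hχ.pd k).comp_smul hr.ne') x
      rw [h2, this]
    have h1 := h.integral_cutoff_le hM hχr (fun x => hχ0 _) (D := r ^ 2 * D) (by positivity)
      (fun k x => by
        rw [hpp, abs_mul, abs_mul, abs_of_pos hr, sq, mul_assoc]
        gcongr
        exact hD k _) hT.le
    refine le_trans ?_ h1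
    have hi := (h.hg.integrable_heat T)
    calc -(1 / 4) * (C / T) * ∫ x, |g x| ≤ -(1 / 4) * (C / T) * ∫ x, |heat g T x| := by
          have : 0 ≤ C / T := by positivity
          nlinarith [hi.2]
      _ = ∫ x, -(1 / 4) * (C / T) * |heat g T x| := (integral_const_mul _ _).symm
      _ ≤ _ := by
        refine integral_mono (hi.1.abs.const_mul _) ?_ fun x => ?_
        · refine (hM T).1.abs.mono' ?_ (.of_forall fun x => ?_)
          · exact hχr.nice.continuous.aestronglyMeasurable.mul (hM T).1.aestronglyMeasurable
          · rw [norm_mul, Real.norm_of_nonneg (hχ0 _)]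
            exact mul_le_of_le_one_left (norm_nonneg _) (hχ1 _)
        · have h2 := h.le_phi T x
          have h3 : heat W T x * heat g T x ≤ C / T * |heat g T x| :=
            (le_abs_self _).trans (by
              rw [abs_mul]; exact mul_le_mul_of_nonneg_right (hdec T hT x) (abs_nonneg _))
          have h4 : 0 ≤ C / T * |heat g T x| := by positivity
          have h5 : -(1 / 4) * (C / T) * |heat g T x| ≤ phi e g W w m s β T x := by linarith
          have := hχ0 (r • x)
          have := hχ1 (r • x)
          calc -(1 / 4) * (C / T) * |heat g T x|
              ≤ χ (r • x) * (-(1 / 4) * (C / T) * |heat g T x|) := by nlinarith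
            _ ≤ _ := mul_le_mul_of_nonneg_left h5 (hχ0 _)
  have lim : Filter.Tendsto (fun r : ℝ => ∫ x, χ (r • x) * phi e g W w m s β 0 x)
      (nhdsWithin 0 (Set.Ioi 0)) (nhds (∫ x, phi e g W w m s β 0 x)) := by
    have hχc := hχ.nice.continuous
    refine tendsto_integral_filter_of_dominated_convergence
      (fun x => |phi e g W w m s β 0 x|) (.of_forall fun r => ?_)
      (.of_forall fun r => .of_forall fun x => ?_) (hM 0).1.abs (.of_forall fun x => ?_)
    · exact (by fun_prop : Continuous fun x : Euc n => χ (r • x)).aestronglyMeasurable.mul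
        (hM 0).1.aestronglyMeasurable
    · rw [norm_mul, Real.norm_of_nonneg (hχ0 _)]
      exact mul_le_of_le_one_left (norm_nonneg _) (hχ1 _)
    · have : Continuous fun r : ℝ => χ (r • x) * phi e g W w m s β 0 x := by fun_prop
      have h2 := (this.tendsto 0).mono_left (nhdsWithin_le_nhds (s := Set.Ioi 0))
      simpa [hχe] using h2
  have step : ∀ T : ℝ, 0 < T →
      -(1 / 4) * (C / T) * ∫ x, |g x| ≤ ∫ x, phi e g W w m s β 0 x := by
    intro T hT
    have l2 : Filter.Tendsto (fun r : ℝ => (n : ℝ) * ((r ^ 2 * D) * M) * T ^ 2 / 2)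
        (nhdsWithin 0 (Set.Ioi 0)) (nhds 0) := by
      have : Continuous fun r : ℝ => (n : ℝ) * ((r ^ 2 * D) * M) * T ^ 2 / 2 := by fun_prop
      have h2 := (this.tendsto 0).mono_left (nhdsWithin_le_nhds (s := Set.Ioi 0))
      simpa using h2
    have l3 := lim.add l2
    rw [add_zero] at l3
    exact ge_of_tendsto l3 (by
      filter_upwards [self_mem_nhdsWithin] with r hr using key T hT r hr)
  have l4 : Filter.Tendsto (fun T : ℝ => -(1 / 4) * (C / T) * ∫ x, |g x|) Filter.atTop
      (nhds 0) := by
    have : Filter.Tendsto (fun T : ℝ => C / T) Filter.atTop (nhds 0) :=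
      tendsto_const_nhds.div_atTop Filter.tendsto_id
    have h := (this.const_mul (-(1 / 4))).mul_const (∫ x, |g x|)
    rwa [mul_zero, zero_mul] at h
  exact le_of_tendsto l4 (by
    filter_upwards [Filter.eventually_gt_atTop 0] with T hT using step T hT)

end Flow
end Korn

namespace Korn
variable {n : ℕ}

lemma Test.add {f g : Euc n → ℝ} (hf : Test f) (hg : Test g) : Test fun x => f x + g x :=
  ⟨hf.smooth.add hg.smooth, hf.compact.add hg.compact⟩

lemma Test.zero : Test fun _ : Euc n => (0 : ℝ) :=
  ⟨contDiff_const, by simp [HasCompactSupport, tsupport]⟩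

lemma Test.sum {ι : Type*} (s : Finset ι) {f : ι → Euc n → ℝ} (h : ∀ i, Test (f i)) :
    Test fun x => ∑ i ∈ s, f i x := by
  classical
  induction s using Finset.induction_on with
  | empty => simpa using Test.zero
  | insert a s ha ih =>
    simp only [Finset.sum_insert ha]
    exact (h a).add ih

lemma Test.rpow_sq_add {f : Euc n → ℝ} (hf : Test f) {ε : ℝ} (hε : 0 < ε) (r : ℝ) :
    Test fun x => (f x ^ 2 + ε ^ 2) ^ r - (ε ^ 2) ^ r := by
  refine ⟨(((hf.smooth.pow 2).add contDiff_const).rpow_const_of_ne fun x => ?_).sub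
    contDiff_const, hf.compact.comp_left (g := fun t => (t ^ 2 + ε ^ 2) ^ r - (ε ^ 2) ^ r)
      (by simp)⟩
  positivity

lemma Test.integrable_rpow_abs {f : Euc n → ℝ} (hf : Test f) {p : ℝ} (hp : 0 < p) :
    Integrable fun x => |f x| ^ p := by
  refine Continuous.integrable_of_hasCompactSupport
    (hf.nice.continuous.abs.rpow_const fun _ => Or.inr hp.le) ?_
  exact hf.compact.comp_left (g := fun t => |t| ^ p) (by simp [hp.ne'])

lemma rpow_abs_le_rpow_sq_add (b ε r : ℝ) (hr : 0 ≤ r) : |b| ^ r ≤ (b ^ 2 + ε ^ 2) ^ (r / 2) := by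
  have : |b| ^ r = (b ^ 2) ^ (r / 2) := by
    rw [← sq_abs, ← Real.rpow_two, ← Real.rpow_mul (abs_nonneg b)]; ring_nf
  rw [this]
  exact Real.rpow_le_rpow (sq_nonneg b) (by nlinarith [sq_nonneg ε]) (by linarith)

lemma add_rpow_le {x y s : ℝ} (hx : 0 ≤ x) (hy : 0 ≤ y) (hs : 0 ≤ s) :
    (x + y) ^ s ≤ 2 ^ s * (x ^ s + y ^ s) := by
  have h1 : (x + y) ^ s ≤ (2 * max x y) ^ s := by
    refine Real.rpow_le_rpow (by positivity) ?_ hs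
    linarith [le_max_left x y, le_max_right x y]
  rw [Real.mul_rpow zero_le_two (le_max_of_le_left hx)] at h1
  refine h1.trans (mul_le_mul_of_nonneg_left ?_ (by positivity))
  have := Real.rpow_nonneg hx s
  have := Real.rpow_nonneg hy s
  rcases max_choice x y with h | h <;> rw [h] <;> linarith

lemma sum_rpow_le {ι : Type*} (t : Finset ι) {x : ι → ℝ} (hx : ∀ i, 0 ≤ x i) {s : ℝ}
    (hs : 1 ≤ s) : (∑ i ∈ t, x i) ^ s ≤ (t.card : ℝ) ^ (s - 1) * ∑ i ∈ t, x i ^ s := by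
  have := Real.rpow_sum_le_const_mul_sum_rpow t x hs
  simpa only [abs_of_nonneg (hx _)] using this

/-- A function `W` controlled by a family `e` in the way the antisymmetric part of a gradient is
controlled by the symmetric part. -/
structure Controlled {ι : Type*} [Fintype ι] (e : ι → Euc n → ℝ) (W : Euc n → ℝ) : Prop where
  he : ∀ a, Test (e a)
  hW : Test W
  grad : ∀ σ x, ∑ k, heat (pd k W) σ x ^ 2 ≤ 4 * ∑ k, ∑ a, heat (pd k (e a)) σ x ^ 2
  decay : ∃ C, 0 ≤ C ∧ ∀ σ, 0 < σ → ∀ x, |heat W σ x| ≤ C / σ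

/-- The weight dominating `e` and `g`. -/
noncomputable def weight {ι : Type*} [Fintype ι] (e : ι → Euc n → ℝ) (g : Euc n → ℝ)
    (r t ε : ℝ) (x : Euc n) : ℝ :=
  (∑ a, (e a x ^ 2 + ε ^ 2) ^ (r / 2)) + (g x ^ 2 + ε ^ 2) ^ (t / 2)

namespace Controlled
variable {ι : Type*} [Fintype ι] {e : ι → Euc n → ℝ} {g W : Euc n → ℝ}

lemma flow (h : Controlled e W) (hg : Test g) {p s ε : ℝ} (hp : 1 < p) (hs : 1 < s)
    (hsp : s ≤ p) (hs2 : s * (p - 1) ≤ p) (hε : 0 < ε) :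
    Flow e g W (weight e g (p / s) (p / (p - 1) / s) ε)
      (weight (fun (_ : ι) (_ : Euc n) => 0) (fun _ => 0) (p / s) (p / (p - 1) / s) ε 0)
      s (s * (2 - p) / p) := by
  set r := p / s with hr
  set t := p / (p - 1) / s with ht
  have hs0 : 0 < s := by linarith
  have hp1 : 0 < p - 1 := by linarith
  have hp0 : 0 < p := by linarith
  have hr1 : 1 ≤ r := by rw [hr, le_div_iff₀ hs0]; linarith
  have ht1 : 1 ≤ t := by rw [ht, le_div_iff₀ hs0, le_div_iff₀ hp1]; linarith
  set m := weight (fun (_ : ι) (_ : Euc n) => 0) (fun _ => 0) r t ε 0 with hm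
  have htest : Test fun x => weight e g r t ε x - m := by
    have := (Test.sum Finset.univ fun a => (h.he a).rpow_sq_add hε (r / 2)).add
      (hg.rpow_sq_add hε (t / 2))
    convert this using 2 with x
    simp only [hm, weight, Finset.sum_sub_distrib, zero_pow two_ne_zero, zero_add]
    ring
  have hnice : Nice (weight e g r t ε) := by
    refine ⟨?_, m, htest.compact⟩
    have := htest.smooth.add (contDiff_const (c := m))
    simpa using this
  have hle : ∀ a x, |e a x| ^ r ≤ weight e g r t ε x := by
    intro a x
    have h1 := rpow_abs_le_rpow_sq_add (e a x) ε r (by linarith)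
    have h2 := Finset.single_le_sum (f := fun a => (e a x ^ 2 + ε ^ 2) ^ (r / 2))
      (fun i _ => by positivity) (Finset.mem_univ a)
    have h3 : 0 ≤ (g x ^ 2 + ε ^ 2) ^ (t / 2) := by positivity
    unfold weight
    linarith
  have hlg : ∀ x, |g x| ^ t ≤ weight e g r t ε x := by
    intro x
    have h1 := rpow_abs_le_rpow_sq_add (g x) ε t (by linarith)
    have h2 : 0 ≤ ∑ a, (e a x ^ 2 + ε ^ 2) ^ (r / 2) := by positivity
    unfold weight
    linarith
  refine ⟨h.he, hg, h.hW, hnice, ?_, fun x => ?_, htest.compact, hs, fun a σ x => ?_,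
    fun σ x => ?_, h.grad, h.decay⟩
  · have h2 : 0 ≤ ∑ _a : ι, ((0 : ℝ) ^ 2 + ε ^ 2) ^ (r / 2) := by positivity
    have h3 : 0 < ((0 : ℝ) ^ 2 + ε ^ 2) ^ (t / 2) := by positivity
    simp only [hm, weight]
    linarith
  · have h2 : ∑ _a : ι, ((0 : ℝ) ^ 2 + ε ^ 2) ^ (r / 2) ≤ ∑ a, (e a x ^ 2 + ε ^ 2) ^ (r / 2) :=
      Finset.sum_le_sum fun a _ => Real.rpow_le_rpow (by positivity)
        (by nlinarith [sq_nonneg (e a x)]) (by linarith)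
    have h3 : ((0 : ℝ) ^ 2 + ε ^ 2) ^ (t / 2) ≤ (g x ^ 2 + ε ^ 2) ^ (t / 2) :=
      Real.rpow_le_rpow (by positivity) (by nlinarith [sq_nonneg (g x)]) (by linarith)
    simp only [hm, weight]
    linarith
  · refine sq_le_of_rpow_abs_le (r := r) (by linarith) ?_
      (rpow_abs_heat_le (h.he a).nice hnice hr1 (hle a) σ x)
    rw [hr]; field_simp; ring
  · refine sq_le_of_rpow_abs_le (r := t) (by linarith) ?_
      (rpow_abs_heat_le hg.nice hnice ht1 hlg σ x)
    rw [ht]; field_simp; ring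

lemma integral_mul_le_weight (h : Controlled e W) (hg : Test g) {p s ε : ℝ} (hp : 1 < p)
    (hs : 1 < s) (hsp : s ≤ p) (hs2 : s * (p - 1) ≤ p) (hε : 0 < ε) {S : Set (Euc n)}
    (hS : IsCompact S) (heS : ∀ a, ∀ x ∉ S, e a x = 0) (hgS : ∀ x ∉ S, g x = 0) :
    1 / 4 * ∫ x, W x * g x ≤
      (Fintype.card ι + 1 + Flow.coef (Fintype.card ι) s (s * (2 - p) / p))
        * ∫ x in S, weight e g (p / s) (p / (p - 1) / s) ε x ^ s := by
  have hf := h.flow hg hp hs hsp hs2 hε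
  set w := weight e g (p / s) (p / (p - 1) / s) ε with hw
  set m := weight (fun (_ : ι) (_ : Euc n) => 0) (fun _ => 0) (p / s) (p / (p - 1) / s) ε 0 with hm
  set β := s * (2 - p) / p
  set K := Flow.coef (Fintype.card ι) s β with hK
  have hK0 : 0 ≤ K := by
    have : 0 < s - 1 := by linarith
    rw [hK]; unfold Flow.coef; positivity
  obtain ⟨hi, hnn⟩ := hf.integral_phi_nonneg
  have hWg : Integrable fun x => W x * g x :=
    (h.hW.nice.continuous.mul hg.nice.continuous).integrable_of_hasCompactSupport
      h.hW.compact.mul_right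
  have hwp : ∀ x, 0 < w x := fun x => hf.hm.trans_le (hf.hwm x)
  have hwc : Continuous fun x => w x ^ s :=
    hf.hw.continuous.rpow_const fun x => Or.inl (hwp x).ne'
  have hwS : IntegrableOn (fun x => w x ^ s) S := hwc.continuousOn.integrableOn_compact hS
  have hpt : ∀ x, Flow.phi e g W w m s β 0 x ≤
      S.indicator (fun x => (Fintype.card ι + 1 + K) * w x ^ s) x - 1 / 4 * (W x * g x) := by
    intro x
    have h0 : term w W g 0 0 x = W x * g x := by simp [term, heat_zero]
    rw [Flow.phi, h0]
    by_cases hx : x ∈ S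
    · rw [Set.indicator_of_mem hx]
      have h1 : ∀ a, term w (e a) (e a) (-β) 0 x - 0 ≤ w x ^ s := by
        intro a
        have := hf.sq_e a 0 x
        simp only [heat_zero] at this
        rw [sub_zero, term, heat_zero, heat_zero, mul_assoc, ← sq]
        calc _ ≤ w x ^ (-β) * w x ^ (s + β) :=
              mul_le_mul_of_nonneg_left this (Real.rpow_nonneg (hwp x).le _)
          _ = _ := by rw [← Real.rpow_add (hwp x)]; ring_nf
      have h2 : term w g g β 0 x - 0 ≤ w x ^ s := by
        have := hf.sq_g 0 x
        simp only [heat_zero] at this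
        rw [sub_zero, term, heat_zero, heat_zero, mul_assoc, ← sq]
        calc _ ≤ w x ^ β * w x ^ (s - β) :=
              mul_le_mul_of_nonneg_left this (Real.rpow_nonneg (hwp x).le _)
          _ = _ := by rw [← Real.rpow_add (hwp x)]; ring_nf
      have h3 : term w (fun _ => 1) (fun _ => 1) s 0 x - m ^ s ≤ w x ^ s := by
        have := Real.rpow_nonneg hf.hm.le s
        simp only [term, heat_zero, mul_one]
        linarith
      have h4 : ∑ a, (term w (e a) (e a) (-β) 0 x - 0) ≤ Fintype.card ι * w x ^ s := by
        refine (Finset.sum_le_sum fun a _ => h1 a).trans ?_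
        simp
      have h5 := mul_le_mul_of_nonneg_left h3 hK0
      linarith
    · rw [Set.indicator_of_notMem hx]
      have hwx : w x = m := by simp [hw, hm, weight, heS _ x hx, hgS x hx]
      simp [term, heat_zero, heS _ x hx, hgS x hx, hwx]
  have hind : Integrable (S.indicator fun x => (Fintype.card ι + 1 + K) * w x ^ s) :=
    (integrable_indicator_iff hS.measurableSet).2 (hwS.const_mul _)
  have := hnn.trans (integral_mono hi (hind.sub (hWg.const_mul _)) hpt)
  have e1 : ∫ x, (S.indicator (fun x => (Fintype.card ι + 1 + K) * w x ^ s) x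
      - 1 / 4 * (W x * g x)) = (Fintype.card ι + 1 + K) * (∫ x in S, w x ^ s)
        - 1 / 4 * ∫ x, W x * g x := by
    rw [integral_sub hind (hWg.const_mul _), integral_indicator hS.measurableSet,
      integral_const_mul, integral_const_mul]
  have e2 := this.trans_eq e1
  linarith

lemma integral_mul_le (h : Controlled e W) (hg : Test g) {p s : ℝ} (hp : 1 < p)
    (hs : 1 < s) (hsp : s ≤ p) (hs2 : s * (p - 1) ≤ p) :
    1 / 4 * ∫ x, W x * g x ≤
      (Fintype.card ι + 1 + Flow.coef (Fintype.card ι) s (s * (2 - p) / p))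
        * (2 ^ s * (Fintype.card ι : ℝ) ^ (s - 1) * (∑ a, ∫ x, |e a x| ^ p)
          + 2 ^ s * ∫ x, |g x| ^ (p / (p - 1))) := by
  set K := Flow.coef (Fintype.card ι) s (s * (2 - p) / p) with hK
  have hs0 : 0 < s := by linarith
  have hp1 : 0 < p - 1 := by linarith
  have hp0 : 0 < p := by linarith
  have hK0 : 0 ≤ K := by
    have : 0 < s - 1 := by linarith
    rw [hK]; unfold Flow.coef; positivity
  set r := p / s with hr
  set t := p / (p - 1) / s with ht
  have hr0 : 0 < r := by positivity
  have ht0 : 0 < t := by positivity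
  let S : Set (Euc n) := (⋃ a, tsupport (e a)) ∪ tsupport g
  have hS : IsCompact S := (isCompact_iUnion fun a => (h.he a).compact).union hg.compact
  have heS : ∀ a, ∀ x ∉ S, e a x = 0 := fun a x hx =>
    image_eq_zero_of_notMem_tsupport fun hc => hx (Or.inl (Set.mem_iUnion.2 ⟨a, hc⟩))
  have hgS : ∀ x ∉ S, g x = 0 := fun x hx =>
    image_eq_zero_of_notMem_tsupport fun hc => hx (Or.inr hc)
  have hec := fun a => (h.he a).nice.continuous
  have hgc := hg.nice.continuous
  have hcont : Continuous fun ε : ℝ => ∫ x in S, weight e g r t ε x ^ s := by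
    refine continuous_parametric_integral_of_continuous (f := fun ε x => weight e g r t ε x ^ s)
      ?_ hS
    refine Continuous.rpow_const ?_ fun _ => Or.inr hs0.le
    unfold weight
    refine Continuous.add (continuous_finsetSum _ fun a _ => ?_) ?_
    · exact Continuous.rpow_const (by have := hec a; fun_prop) fun _ => Or.inr (by positivity)
    · exact Continuous.rpow_const (by fun_prop) fun _ => Or.inr (by positivity)
  have lim := ((hcont.tendsto 0).mono_left (nhdsWithin_le_nhds (s := Set.Ioi 0))).const_mul
    (Fintype.card ι + 1 + K)
  have h1 := ge_of_tendsto lim (by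
    filter_upwards [self_mem_nhdsWithin] with ε hε using
      h.integral_mul_le_weight hg hp hs hsp hs2 hε hS heS hgS)
  refine h1.trans (mul_le_mul_of_nonneg_left ?_ (by positivity))
  have hie := fun a => (h.he a).integrable_rpow_abs hp0
  have hig := hg.integrable_rpow_abs (p := p / (p - 1)) (by positivity)
  have hzero : ∀ b a : ℝ, 0 < a → ((b ^ 2 + 0 ^ 2) ^ (a / s / 2)) ^ s = |b| ^ a := by
    intro b a ha
    rw [zero_pow two_ne_zero, add_zero, ← sq_abs, ← Real.rpow_two, ← Real.rpow_mul (abs_nonneg b),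
      ← Real.rpow_mul (abs_nonneg b)]
    congr 1
    field_simp
  have hpt : ∀ x, weight e g r t 0 x ^ s ≤ 2 ^ s * (Fintype.card ι : ℝ) ^ (s - 1)
      * (∑ a, |e a x| ^ p) + 2 ^ s * |g x| ^ (p / (p - 1)) := by
    intro x
    have h2 := add_rpow_le (x := ∑ a, (e a x ^ 2 + 0 ^ 2) ^ (r / 2))
      (y := (g x ^ 2 + 0 ^ 2) ^ (t / 2)) (s := s) (by positivity) (by positivity) hs0.le
    have h3 := sum_rpow_le Finset.univ (x := fun a => (e a x ^ 2 + 0 ^ 2) ^ (r / 2))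
      (fun a => by positivity) hs.le
    simp only [hr, hzero _ p hp0, Finset.card_univ] at h3
    rw [ht, hzero _ _ (by positivity)] at h2
    have h4 := mul_le_mul_of_nonneg_left h3 (by positivity : (0 : ℝ) ≤ 2 ^ s)
    unfold weight
    calc _ ≤ _ := h2
      _ ≤ _ := by rw [mul_add]; linarith
  have hir : Integrable fun x => 2 ^ s * (Fintype.card ι : ℝ) ^ (s - 1)
      * (∑ a, |e a x| ^ p) + 2 ^ s * |g x| ^ (p / (p - 1)) :=
    ((integrable_finsetSum _ fun a _ => hie a).const_mul _).add (hig.const_mul _)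
  have hwi : IntegrableOn (fun x => weight e g r t 0 x ^ s) S := by
    refine ContinuousOn.integrableOn_compact hS (Continuous.continuousOn ?_)
    exact (Continuous.rpow_const (by
      unfold weight
      refine Continuous.add (continuous_finsetSum _ fun a _ => ?_) ?_
      · exact Continuous.rpow_const (by have := hec a; fun_prop) fun _ => Or.inr (by positivity)
      · exact Continuous.rpow_const (by fun_prop) fun _ => Or.inr (by positivity))
      fun _ => Or.inr hs0.le)
  calc ∫ x in S, weight e g r t 0 x ^ s ≤ ∫ x in S, (2 ^ s * (Fintype.card ι : ℝ) ^ (s - 1)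
      * (∑ a, |e a x| ^ p) + 2 ^ s * |g x| ^ (p / (p - 1))) :=
        integral_mono hwi hir.integrableOn hpt
    _ ≤ ∫ x, (2 ^ s * (Fintype.card ι : ℝ) ^ (s - 1)
      * (∑ a, |e a x| ^ p) + 2 ^ s * |g x| ^ (p / (p - 1))) :=
        setIntegral_le_integral hir (.of_forall fun x => by positivity)
    _ = _ := by
      rw [integral_add ((integrable_finsetSum _ fun a _ => hie a).const_mul _) (hig.const_mul _),
        integral_const_mul, integral_const_mul, integral_finsetSum _ fun a _ => hie a]

end Controlled

/-- The `L ^ p` bound of `W` by `e`. -/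
lemma exists_integral_rpow_le (ι : Type*) [Fintype ι] {p : ℝ} (hp : 1 < p) (hp2 : p < 2) :
    ∃ C : ℝ, 0 ≤ C ∧ ∀ (n : ℕ) (e : ι → Euc n → ℝ) (W : Euc n → ℝ), Controlled e W →
      ∫ x, |W x| ^ p ≤ C * ∑ a, ∫ x, |e a x| ^ p := by
  set s := (1 + p) / 2 with hs
  set q := p / (p - 1) with hq
  have hp1 : 0 < p - 1 := by linarith
  have hp0 : 0 < p := by linarith
  have hs1 : 1 < s := by rw [hs]; linarith
  have hsp : s ≤ p := by rw [hs]; linarith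
  have hs2 : s * (p - 1) ≤ p := by rw [hs]; nlinarith
  have hq0 : 0 < q := by positivity
  have hq1 : 0 < q - 1 := by
    have : q - 1 = 1 / (p - 1) := by rw [hq]; field_simp; ring
    rw [this]; positivity
  obtain ⟨A, hA, B, hB, hAB⟩ : ∃ A : ℝ, 0 ≤ A ∧ ∃ B : ℝ, 0 < B ∧ ∀ (n : ℕ) (e : ι → Euc n → ℝ)
      (W g : Euc n → ℝ), Controlled e W → Test g →
      1 / 4 * ∫ x, W x * g x ≤ A * (∑ a, ∫ x, |e a x| ^ p) + B * ∫ x, |g x| ^ q := by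
    have hK0 : 0 ≤ Flow.coef (Fintype.card ι) s (s * (2 - p) / p) := by
      have : 0 < s - 1 := by linarith
      unfold Flow.coef; positivity
    refine ⟨(Fintype.card ι + 1 + Flow.coef (Fintype.card ι) s (s * (2 - p) / p))
        * (2 ^ s * (Fintype.card ι : ℝ) ^ (s - 1)), by positivity,
        (Fintype.card ι + 1 + Flow.coef (Fintype.card ι) s (s * (2 - p) / p)) * 2 ^ s,
        by positivity, fun n e W g h hg => ?_⟩
    have := h.integral_mul_le hg hp hs1 hsp hs2
    linarith
  obtain ⟨l, hl, hlB⟩ : ∃ l : ℝ, 0 < l ∧ B * l ^ q = l / 8 := by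
    refine ⟨(1 / (8 * B)) ^ (1 / (q - 1)), by positivity, ?_⟩
    set l := (1 / (8 * B)) ^ (1 / (q - 1)) with hl
    have hl0 : 0 < l := by positivity
    have h1 : l ^ (q - 1) = 1 / (8 * B) := by
      rw [hl, ← Real.rpow_mul (by positivity), one_div_mul_cancel hq1.ne', Real.rpow_one]
    have h2 : l ^ q = l ^ (q - 1) * l := by rw [← Real.rpow_add_one hl0.ne']; ring_nf
    rw [h2, h1]; field_simp
  refine ⟨8 * A / l, by positivity, fun n e W h => ?_⟩
  have hWi := h.hW.integrable_rpow_abs hp0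
  set V := volume.real (tsupport W) with hV
  have hVf : volume (tsupport W) ≠ ⊤ := IsCompact.measure_ne_top h.hW.compact
  have key : ∀ δ : ℝ, 0 < δ →
      ∫ x, |W x| ^ p ≤ 8 * A / l * (∑ a, ∫ x, |e a x| ^ p) + 2 * V * δ ^ p := by
    intro δ hδ
    set g : Euc n → ℝ := fun x => l * (W x ^ 2 + δ ^ 2) ^ ((p - 2) / 2) * W x with hg
    have hgt : Test g := by
      refine ⟨(contDiff_const.mul ((((h.hW.smooth.pow 2).add contDiff_const).rpow_const_of_ne
        fun x => ?_))).mul h.hW.smooth, h.hW.compact.mul_left⟩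
      positivity
    have h1 := hAB n e W g h hgt
    have h2 : ∫ x, |g x| ^ q ≤ l ^ q * ∫ x, |W x| ^ p := by
      rw [← integral_const_mul]
      refine integral_mono (hgt.integrable_rpow_abs hq0) (hWi.const_mul _) fun x => ?_
      simp only [hg]
      have hb : 0 < W x ^ 2 + δ ^ 2 := by positivity
      rw [abs_mul, abs_mul, abs_of_pos hl,
          abs_of_pos (by positivity : 0 < (W x ^ 2 + δ ^ 2) ^ ((p - 2) / 2)),
        Real.mul_rpow (by positivity) (abs_nonneg _),
          Real.mul_rpow hl.le (by positivity), mul_assoc]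
      refine mul_le_mul_of_nonneg_left ?_ (by positivity)
      rcases eq_or_ne (W x) 0 with h0 | h0
      · simp [h0, hq0.ne', hp0.ne']
      · have ha : 0 < |W x| := abs_pos.2 h0
        have h3 : (W x ^ 2 + δ ^ 2) ^ ((p - 2) / 2) ≤ |W x| ^ (p - 2) := by
          have : |W x| ^ (p - 2) = (W x ^ 2) ^ ((p - 2) / 2) := by
            rw [← sq_abs, ← Real.rpow_two, ← Real.rpow_mul (abs_nonneg _)]; ring_nf
          rw [this]
          exact Real.rpow_le_rpow_of_nonpos (by positivity) (by nlinarith [sq_nonneg δ])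
            (by linarith)
        calc ((W x ^ 2 + δ ^ 2) ^ ((p - 2) / 2)) ^ q * |W x| ^ q
            ≤ (|W x| ^ (p - 2)) ^ q * |W x| ^ q := by gcongr
          _ = |W x| ^ p := by
            rw [← Real.rpow_mul ha.le, ← Real.rpow_add ha]
            congr 1
            rw [hq]; field_simp; ring
    have h3 : l * ((∫ x, |W x| ^ p) - V * δ ^ p) ≤ ∫ x, W x * g x := by
      have hind : Integrable ((tsupport W).indicator fun _ : Euc n => δ ^ p) :=
        (integrable_indicator_iff (isClosed_tsupport W).measurableSet).2 (by simp [hVf.lt_top])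
      have : l * ((∫ x, |W x| ^ p) - V * δ ^ p)
          = ∫ x, l * (|W x| ^ p - (tsupport W).indicator (fun _ => δ ^ p) x) := by
        rw [integral_const_mul, integral_sub hWi hind,
          integral_indicator (isClosed_tsupport W).measurableSet]
        simp [hV]
      rw [this]
      refine integral_mono ((hWi.sub hind).const_mul _)
        ((h.hW.nice.continuous.mul hgt.nice.continuous).integrable_of_hasCompactSupport
          h.hW.compact.mul_right) fun x => ?_
      simp only [hg]
      have hb : 0 < W x ^ 2 + δ ^ 2 := by positivity
      have e0 : W x * (l * (W x ^ 2 + δ ^ 2) ^ ((p - 2) / 2) * W x)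
          = l * ((W x ^ 2 + δ ^ 2) ^ ((p - 2) / 2) * W x ^ 2) := by ring
      rw [e0]
      refine mul_le_mul_of_nonneg_left ?_ hl.le
      by_cases hx : x ∈ tsupport W
      · rw [Set.indicator_of_mem hx]
        have e1 : (W x ^ 2 + δ ^ 2) ^ (p / 2)
            = (W x ^ 2 + δ ^ 2) ^ ((p - 2) / 2) * (W x ^ 2 + δ ^ 2) := by
          rw [← Real.rpow_add_one hb.ne']; ring_nf
        have e2 := rpow_abs_le_rpow_sq_add (W x) δ p hp0.le
        have e3 : (W x ^ 2 + δ ^ 2) ^ ((p - 2) / 2) * δ ^ 2 ≤ δ ^ p := by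
          have : δ ^ p = (δ ^ 2) ^ ((p - 2) / 2) * δ ^ 2 := by
            rw [← Real.rpow_two, ← Real.rpow_mul hδ.le, ← Real.rpow_add hδ]; ring_nf
          rw [this]
          refine mul_le_mul_of_nonneg_right ?_ (by positivity)
          exact Real.rpow_le_rpow_of_nonpos (by positivity) (by nlinarith [sq_nonneg (W x)])
            (by linarith)
        linarith
      · rw [Set.indicator_of_notMem hx, image_eq_zero_of_notMem_tsupport hx]
        simp [hp0.ne']
    have h4 : B * (∫ x, |g x| ^ q) ≤ l / 8 * ∫ x, |W x| ^ p := by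
      rw [← hlB, mul_assoc]
      exact mul_le_mul_of_nonneg_left h2 hB.le
    have h5 : l / 8 * (∫ x, |W x| ^ p) ≤ A * (∑ a, ∫ x, |e a x| ^ p) + l / 4 * (V * δ ^ p) := by
      linarith
    calc ∫ x, |W x| ^ p = 8 / l * (l / 8 * ∫ x, |W x| ^ p) := by field_simp
      _ ≤ 8 / l * (A * (∑ a, ∫ x, |e a x| ^ p) + l / 4 * (V * δ ^ p)) := by gcongr
      _ = _ := by field_simp; ring
  have lim : Filter.Tendsto (fun δ : ℝ => 8 * A / l * (∑ a, ∫ x, |e a x| ^ p) + 2 * V * δ ^ p)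
      (nhdsWithin 0 (Set.Ioi 0)) (nhds (8 * A / l * (∑ a, ∫ x, |e a x| ^ p))) := by
    have hc : Continuous fun δ : ℝ => 8 * A / l * (∑ a, ∫ x, |e a x| ^ p) + 2 * V * δ ^ p :=
      continuous_const.add (continuous_const.mul (continuous_id.rpow_const fun _ => Or.inr hp0.le))
    have := (hc.tendsto 0).mono_left (nhdsWithin_le_nhds (s := Set.Ioi 0))
    simpa [hp0.ne'] using this
  exact ge_of_tendsto lim (by filter_upwards [self_mem_nhdsWithin] with δ hδ using key δ hδ)

end Korn

namespace Korn
variable {n : ℕ}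

lemma Test.differentiable {f : Euc n → ℝ} (hf : Test f) : Differentiable ℝ f :=
  hf.smooth.differentiable (by simp)

lemma Test.sub {f g : Euc n → ℝ} (hf : Test f) (hg : Test g) : Test fun x => f x - g x :=
  ⟨hf.smooth.sub hg.smooth, hf.compact.sub hg.compact⟩

lemma pd_add {f g : Euc n → ℝ} (hf : Test f) (hg : Test g) (k : Fin n) (x : Euc n) :
    pd k (fun y => f y + g y) x = pd k f x + pd k g x := by
  simp [pd, fderiv_fun_add (hf.differentiable x) (hg.differentiable x)]

lemma pd_sub {f g : Euc n → ℝ} (hf : Test f) (hg : Test g) (k : Fin n) (x : Euc n) :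
    pd k (fun y => f y - g y) x = pd k f x - pd k g x := by
  simp [pd, fderiv_fun_sub (hf.differentiable x) (hg.differentiable x)]

lemma pd_comm {f : Euc n → ℝ} (hf : Test f) (j k : Fin n) (x : Euc n) :
    pd j (pd k f) x = pd k (pd j f) x := by
  have hd : DifferentiableAt ℝ (fderiv ℝ f) x :=
    ((hf.smooth.fderiv_right (m := (⊤ : ℕ∞)) (by simp)).differentiable (by simp)) x
  have h : ∀ a b : Fin n, pd a (pd b f) x = fderiv ℝ (fderiv ℝ f) x (bv a) (bv b) := by
    intro a b
    have e : pd b f = fun y => fderiv ℝ f y (bv b) := rfl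
    rw [pd, e, fderiv_clm_apply hd (differentiableAt_const _)]
    simp
  rw [h, h]
  exact (hf.smooth.contDiffAt.isSymmSndFDerivAt (by
    simp only [minSmoothness_of_isRCLikeNormedField]
    exact WithTop.coe_le_coe.2 (le_top : (2 : ℕ∞) ≤ ⊤))) _ _

/-- Korn's inequality for one component of the antisymmetric part. -/
lemma controlled {u : Fin n → Euc n → ℝ} (hu : ∀ a, Test (u a)) (i j : Fin n) :
    Controlled (fun (a : Fin n × Fin n) x => pd a.2 (u a.1) x + pd a.1 (u a.2) x)
      (fun x => pd j (u i) x - pd i (u j) x) := by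
  have hE : ∀ a b, Test fun x => pd b (u a) x + pd a (u b) x := fun a b =>
    ((hu a).pd b).add ((hu b).pd a)
  have hW : Test fun x => pd j (u i) x - pd i (u j) x := ((hu i).pd j).sub ((hu j).pd i)
  refine ⟨fun a => hE a.1 a.2, hW, fun σ x => ?_, ?_⟩
  · set E : Fin n → Fin n → Euc n → ℝ := fun a b x => pd b (u a) x + pd a (u b) x with hEd
    have hk : ∀ k, heat (pd k fun x => pd j (u i) x - pd i (u j) x) σ x
        = heat (pd j (E i k)) σ x - heat (pd i (E j k)) σ x := by
      intro k
      rw [← heat_sub ((hE i k).pd j).nice ((hE j k).pd i).nice]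
      congr 1 with y
      rw [pd_sub ((hu i).pd j) ((hu j).pd i), pd_add ((hu i).pd k) ((hu k).pd i),
        pd_add ((hu j).pd k) ((hu k).pd j), pd_comm (hu i) k j, pd_comm (hu j) k i,
        pd_comm (hu k) j i]
      ring
    have hb : ∀ i j : Fin n, ∑ k, heat (pd j (E i k)) σ x ^ 2
        ≤ ∑ k, ∑ a : Fin n × Fin n, heat (pd k (E a.1 a.2)) σ x ^ 2 := by
      intro i j
      rw [Finset.sum_comm]
      calc ∑ k, heat (pd j (E i k)) σ x ^ 2
          ≤ ∑ k, ∑ l, heat (pd l (E i k)) σ x ^ 2 := Finset.sum_le_sum fun k _ =>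
            Finset.single_le_sum (f := fun l => heat (pd l (E i k)) σ x ^ 2)
              (fun _ _ => sq_nonneg _) (Finset.mem_univ j)
        _ ≤ ∑ i, ∑ k, ∑ l, heat (pd l (E i k)) σ x ^ 2 :=
            Finset.single_le_sum (f := fun i => ∑ k, ∑ l, heat (pd l (E i k)) σ x ^ 2)
              (fun _ _ => by positivity) (Finset.mem_univ i)
        _ = _ := by rw [Fintype.sum_prod_type]
    have h1 := hb i j
    have h2 := hb j i
    simp only [hk]
    calc ∑ k, (heat (pd j (E i k)) σ x - heat (pd i (E j k)) σ x) ^ 2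
        ≤ ∑ k, (2 * heat (pd j (E i k)) σ x ^ 2 + 2 * heat (pd i (E j k)) σ x ^ 2) :=
          Finset.sum_le_sum fun k _ => by
            nlinarith [sq_nonneg (heat (pd j (E i k)) σ x + heat (pd i (E j k)) σ x)]
      _ ≤ _ := by
        rw [Finset.sum_add_distrib, ← Finset.mul_sum, ← Finset.mul_sum]
        linarith
  · obtain ⟨C, hC, h1⟩ := (hu i).nice.abs_heat_pd_le j
    obtain ⟨D, hD, h2⟩ := (hu j).nice.abs_heat_pd_le i
    refine ⟨C + D, by positivity, fun σ hσ x => ?_⟩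
    rw [heat_sub ((hu i).pd j).nice ((hu j).pd i).nice, add_div]
    exact (abs_sub _ _).trans (add_le_add (h1 σ hσ x) (h2 σ hσ x))

lemma abs_add_rpow_le (x y : ℝ) {p : ℝ} (hp : 0 ≤ p) :
    |x + y| ^ p ≤ 2 ^ p * (|x| ^ p + |y| ^ p) :=
  (Real.rpow_le_rpow (abs_nonneg _) (abs_add_le x y) hp).trans
    (add_rpow_le (abs_nonneg _) (abs_nonneg _) hp)

/-- Korn's inequality in the whole space, for smooth fields of compact support. -/
lemma korn_test (n : ℕ) {p : ℝ} (hp : 1 < p) (hp2 : p < 2) :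
    ∃ C : ℝ, 0 ≤ C ∧ ∀ u : Fin n → Euc n → ℝ, (∀ a, Test (u a)) → ∀ i j,
      ∫ x, |pd j (u i) x| ^ p
        ≤ C * ∑ a : Fin n × Fin n, ∫ x, |pd a.2 (u a.1) x + pd a.1 (u a.2) x| ^ p := by
  obtain ⟨C, hC, h⟩ := exists_integral_rpow_le (Fin n × Fin n) hp hp2
  have hp0 : 0 < p := by linarith
  refine ⟨2 ^ p * (1 + C), by positivity, fun u hu i j => ?_⟩
  have h1 := h n _ _ (controlled hu i j)
  set S := ∑ a : Fin n × Fin n, ∫ x, |pd a.2 (u a.1) x + pd a.1 (u a.2) x| ^ p with hS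
  have h2 : ∫ x, |pd j (u i) x + pd i (u j) x| ^ p ≤ S :=
    Finset.single_le_sum (f := fun a : Fin n × Fin n =>
      ∫ x, |pd a.2 (u a.1) x + pd a.1 (u a.2) x| ^ p)
      (fun a _ => integral_nonneg fun x => by positivity) (Finset.mem_univ (i, j))
  have hE : Test fun x => pd j (u i) x + pd i (u j) x := ((hu i).pd j).add ((hu j).pd i)
  have hW : Test fun x => pd j (u i) x - pd i (u j) x := ((hu i).pd j).sub ((hu j).pd i)
  have iE := hE.integrable_rpow_abs hp0
  have iW := hW.integrable_rpow_abs hp0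
  calc ∫ x, |pd j (u i) x| ^ p ≤ ∫ x, 2 ^ p * (|pd j (u i) x + pd i (u j) x| ^ p
        + |pd j (u i) x - pd i (u j) x| ^ p) := by
        refine integral_mono (((hu i).pd j).integrable_rpow_abs hp0)
          ((iE.add iW).const_mul _) fun x => ?_
        have h3 := abs_add_rpow_le ((pd j (u i) x + pd i (u j) x) / 2)
          ((pd j (u i) x - pd i (u j) x) / 2) hp0.le
        have h4 : ∀ y : ℝ, |y / 2| ^ p ≤ |y| ^ p := fun y =>
          Real.rpow_le_rpow (abs_nonneg _) (by
            rw [abs_div, abs_two]; linarith [abs_nonneg y]) hp0.le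
        have h5 : (pd j (u i) x + pd i (u j) x) / 2 + (pd j (u i) x - pd i (u j) x) / 2
            = pd j (u i) x := by ring
        rw [h5] at h3
        refine h3.trans ?_
        gcongr ?_ * (?_ + ?_)
        · exact h4 _
        · exact h4 _
    _ = 2 ^ p * ((∫ x, |pd j (u i) x + pd i (u j) x| ^ p)
        + ∫ x, |pd j (u i) x - pd i (u j) x| ^ p) := by
        rw [integral_const_mul, integral_add iE iW]
    _ ≤ 2 ^ p * (S + C * S) := by gcongr
    _ = _ := by ring

end Korn

namespace Korn
variable {n : ℕ}
open Filter Topology ContinuousLinearMap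
open scoped Convolution ContDiff Pointwise

/-- A bump function supported in the ball of radius `1 / (i + 1)`. -/
noncomputable def mollifier (n i : ℕ) : ContDiffBump (0 : Euc n) where
  rIn := 1 / (2 * (i + 1))
  rOut := 1 / (i + 1)
  rIn_pos := by positivity
  rIn_lt_rOut := by
    have : (0 : ℝ) < i + 1 := by positivity
    apply one_div_lt_one_div_of_lt <;> linarith

/-- Mollification of a function at scale `1 / (i + 1)`. -/
noncomputable def mollify (i : ℕ) (f : Euc n → ℝ) : Euc n → ℝ :=
  (mollifier n i).normed volume ⋆[lsmul ℝ ℝ, volume] f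

lemma tendsto_mollify {f : Euc n → ℝ} (hf : Continuous f) (x : Euc n) :
    Tendsto (fun i => mollify i f x) atTop (𝓝 (f x)) :=
  ContDiffBump.convolution_tendsto_right_of_continuous tendsto_one_div_add_atTop_nhds_zero_nat hf x

lemma locallyIntegrable_mollifier (i : ℕ) :
    LocallyIntegrable ((mollifier n i).normed volume) volume :=
  (mollifier n i).integrable_normed.locallyIntegrable

lemma test_mollify {f : Euc n → ℝ} (hf : Continuous f) (hc : HasCompactSupport f) (i : ℕ) :
    Test (mollify i f) :=
  ⟨(mollifier n i).hasCompactSupport_normed.contDiff_convolution_left _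
    (mollifier n i).contDiff_normed hf.locallyIntegrable,
    (mollifier n i).hasCompactSupport_normed.convolution _ hc⟩

lemma pd_mollify {f : Euc n → ℝ} (hf : ContDiff ℝ 1 f) (hc : HasCompactSupport f) (i : ℕ)
    (j : Fin n) : pd j (mollify i f) = mollify i (pd j f) := by
  ext x
  unfold pd mollify
  rw [(hc.hasFDerivAt_convolution_right (lsmul ℝ ℝ) (locallyIntegrable_mollifier i) hf x).fderiv]
  exact convolution_precompR_apply _ (locallyIntegrable_mollifier i) (hc.fderiv ℝ)
    (hf.continuous_fderiv one_ne_zero) x (bv j)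

lemma mollify_add {f g : Euc n → ℝ} (hf : Continuous f) (hg : Continuous g) (i : ℕ) (x : Euc n) :
    mollify i (fun y => f y + g y) x = mollify i f x + mollify i g x := by
  have h : ∀ g : Euc n → ℝ, Continuous g →
      ConvolutionExists ((mollifier n i).normed volume) g (lsmul ℝ ℝ) volume := fun g hg =>
    HasCompactSupport.convolutionExists_left (lsmul ℝ ℝ) (mollifier n i).hasCompactSupport_normed
      (mollifier n i).continuous_normed hg.locallyIntegrable
  exact (h f hf x).distrib_add (h g hg x)

lemma abs_mollify_le {f : Euc n → ℝ} {M : ℝ} (hf : ∀ x, |f x| ≤ M) (i : ℕ) (x : Euc n) :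
    |mollify i f x| ≤ M := by
  have h0 := fun y => (mollifier n i).nonneg_normed (μ := volume) y
  unfold mollify convolution
  calc _ ≤ ∫ t, (mollifier n i).normed volume t * M := by
        rw [← Real.norm_eq_abs]
        refine norm_integral_le_of_norm_le ((mollifier n i).integrable_normed.mul_const M)
          (.of_forall fun t => ?_)
        simp only [lsmul_apply, smul_eq_mul, norm_mul, Real.norm_eq_abs, abs_of_nonneg (h0 t)]
        exact mul_le_mul_of_nonneg_left (hf _) (h0 t)
    _ = M := by
        rw [integral_mul_const, (mollifier n i).integral_normed, one_mul]

lemma mollify_eq_zero {f : Euc n → ℝ} {i : ℕ} {x : Euc n}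
    (hx : x ∉ closedBall (0 : Euc n) 1 + tsupport f) : mollify i f x = 0 := by
  by_contra h
  refine hx (Set.add_subset_add ?_ (subset_tsupport f) (support_convolution_subset _ h))
  rw [(mollifier n i).support_normed_eq]
  refine ball_subset_closedBall.trans (closedBall_subset_closedBall ?_)
  have : (0 : ℝ) ≤ i := by positivity
  exact (div_le_one (by positivity)).2 (by linarith)

lemma tendsto_integral_mollify {f : Euc n → ℝ} (hf : Continuous f) (hc : HasCompactSupport f)
    {p : ℝ} (hp : 0 < p) :
    Tendsto (fun i => ∫ x, |mollify i f x| ^ p) atTop (𝓝 (∫ x, |f x| ^ p)) := by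
  obtain ⟨M, hM⟩ := hc.exists_bound_of_continuous hf
  have hK : IsCompact (closedBall (0 : Euc n) 1 + tsupport f) :=
    (isCompact_closedBall 0 1).add hc
  have hM0 : 0 ≤ M := (norm_nonneg _).trans (hM 0)
  refine tendsto_integral_of_dominated_convergence
    ((closedBall (0 : Euc n) 1 + tsupport f).indicator fun _ => M ^ p) (fun i => ?_) ?_
    (fun i => .of_forall fun x => ?_) (.of_forall fun x => ?_)
  · exact (((test_mollify hf hc i).nice.continuous.abs).rpow_const
      fun _ => .inr hp.le).aestronglyMeasurable
  · rw [integrable_indicator_iff hK.measurableSet]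
    exact integrableOn_const hK.measure_lt_top.ne
  · by_cases hx : x ∈ closedBall (0 : Euc n) 1 + tsupport f
    · rw [Set.indicator_of_mem hx, Real.norm_of_nonneg (by positivity)]
      exact Real.rpow_le_rpow (abs_nonneg _) (abs_mollify_le hM i x) hp.le
    · rw [Set.indicator_of_notMem hx, mollify_eq_zero hx, abs_zero, Real.zero_rpow hp.ne',
        norm_zero]
  · exact (((tendsto_mollify hf x).abs).rpow_const (.inr hp.le))

/-- Korn's first inequality for compactly supported `C¹` vector fields. -/
lemma korn_compact (n : ℕ) {p : ℝ} (hp : 1 < p) (hp2 : p < 2) :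
    ∃ C : ℝ, 0 ≤ C ∧ ∀ u : Fin n → Euc n → ℝ, (∀ a, ContDiff ℝ 1 (u a)) →
      (∀ a, HasCompactSupport (u a)) → ∀ i j, ∫ x, |pd j (u i) x| ^ p ≤
        C * ∑ a : Fin n × Fin n, ∫ x, |pd a.2 (u a.1) x + pd a.1 (u a.2) x| ^ p := by
  obtain ⟨C, hC, h⟩ := korn_test n hp hp2
  have hp0 : 0 < p := by linarith
  refine ⟨C, hC, fun u hu hc i j => ?_⟩
  have hcont : ∀ a b, Continuous (pd a (u b)) := fun a b =>
    ((hu b).continuous_fderiv one_ne_zero).clm_apply continuous_const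
  have hcomp : ∀ a b, HasCompactSupport (pd a (u b)) := fun a b =>
    (hc b).fderiv_apply (𝕜 := ℝ) (bv a)
  have hadd : ∀ a : Fin n × Fin n, Tendsto
      (fun k => ∫ x, |mollify k (fun x => pd a.2 (u a.1) x + pd a.1 (u a.2) x) x| ^ p) atTop
      (𝓝 (∫ x, |pd a.2 (u a.1) x + pd a.1 (u a.2) x| ^ p)) := fun a =>
    tendsto_integral_mollify (f := fun x => pd a.2 (u a.1) x + pd a.1 (u a.2) x)
      ((hcont a.2 a.1).add (hcont a.1 a.2)) ((hcomp a.2 a.1).add (hcomp a.1 a.2)) hp0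
  have hlim := (tendsto_finsetSum Finset.univ fun a _ => hadd a).const_mul C
  refine le_of_tendsto_of_tendsto' (tendsto_integral_mollify (hcont j i) (hcomp j i) hp0) hlim
    fun k => ?_
  have hk := h (fun a => mollify k (u a)) (fun a => test_mollify (hu a).continuous (hc a) k) i j
  have hpd : ∀ a b, pd a (mollify k (u b)) = mollify k (pd a (u b)) := fun a b =>
    pd_mollify (hu b) (hc b) k a
  have hsum : ∀ a b x, mollify k (fun x => pd b (u a) x + pd a (u b) x) x
      = mollify k (pd b (u a)) x + mollify k (pd a (u b)) x := fun a b x =>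
    mollify_add (hcont b a) (hcont a b) k x
  simp only [hsum]
  simpa only [hpd] using hk

end Korn

namespace Korn
variable {n : ℕ}
open Filter Topology
open scoped ContDiff RealInnerProductSpace

/-- The derivative of the radial projection `x ↦ x / ‖x‖`. -/
noncomputable def dproj (x : Euc n) : Euc n →L[ℝ] Euc n :=
  ‖x‖⁻¹ • ContinuousLinearMap.id ℝ (Euc n) - (‖x‖⁻¹ ^ 3) • (innerSL ℝ x).smulRight x

/-- The reflection across the unit sphere that stretches radial distances by the factor `l`. -/
noncomputable def reflect (l : ℝ) (x : Euc n) : Euc n := ((1 + l) * ‖x‖⁻¹ - l) • x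

/-- The derivative of `reflect l`. -/
noncomputable def dreflect (l : ℝ) (x : Euc n) : Euc n →L[ℝ] Euc n :=
  (1 + l) • dproj x - l • ContinuousLinearMap.id ℝ (Euc n)

lemma hasFDerivAt_reflect (l : ℝ) {x : Euc n} (hx : x ≠ 0) :
    HasFDerivAt (reflect l) (dreflect l x) x := by
  have hx' : ‖x‖ ≠ 0 := norm_ne_zero_iff.2 hx
  have h1 : HasFDerivAt (fun y : Euc n => ‖y‖) (‖x‖⁻¹ • innerSL ℝ x) x := by
    have h := (hasStrictFDerivAt_norm_sq x).hasFDerivAt.sqrt (by positivity)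
    simp only [Real.sqrt_sq (norm_nonneg _)] at h
    refine h.congr_fderiv ?_
    ext v
    simp
    field_simp
  have h2 : HasFDerivAt (fun y : Euc n => (1 + l) * ‖y‖⁻¹ - l)
      ((1 + l) • -((‖x‖ ^ 2)⁻¹ • (‖x‖⁻¹ • innerSL ℝ x))) x := by
    have h := ((hasDerivAt_inv hx').comp_hasFDerivAt x h1)
    refine ((h.const_mul (1 + l)).sub_const l).congr_fderiv ?_
    ext v; simp
  refine (h2.smul (hasFDerivAt_id x)).congr_fderiv ?_
  ext v i
  simp [dreflect, dproj]
  field_simp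
  ring

lemma contDiffAt_dproj {x : Euc n} (hx : x ≠ 0) : ContDiffAt ℝ 1 (dproj (n := n)) x := by
  have h1 : ContDiffAt ℝ 1 (fun y : Euc n => ‖y‖⁻¹) x :=
    (contDiffAt_norm ℝ hx).inv (norm_ne_zero_iff.2 hx)
  unfold dproj
  refine (h1.smul contDiffAt_const).sub ((h1.pow 3).smul ?_)
  exact ((innerSL ℝ).contDiff.contDiffAt).smulRight contDiffAt_id

lemma contDiffAt_dreflect (l : ℝ) {x : Euc n} (hx : x ≠ 0) :
    ContDiffAt ℝ 1 (dreflect l (n := n)) x :=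
  ((contDiffAt_dproj hx).const_smul _).sub contDiffAt_const

lemma fderiv_dreflect (l : ℝ) {x : Euc n} (hx : x ≠ 0) :
    fderiv ℝ (dreflect l (n := n)) x = (1 + l) • fderiv ℝ dproj x := by
  have h := ((contDiffAt_dproj hx).differentiableAt one_ne_zero).hasFDerivAt
  exact ((h.const_smul (1 + l)).sub_const _).fderiv

lemma inner_dreflect (l : ℝ) (x v w : Euc n) : ⟪dreflect l x v, w⟫ = ⟪v, dreflect l x w⟫ := by
  simp only [dreflect, dproj, sub_apply, smul_apply,
    ContinuousLinearMap.id_apply, ContinuousLinearMap.smulRight_apply, innerSL_apply_apply,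
    inner_sub_left, inner_sub_right, inner_smul_left, inner_smul_right, RCLike.conj_to_real]
  rw [real_inner_comm v x]
  ring

lemma reflect_of_norm_eq_one (l : ℝ) {x : Euc n} (hx : ‖x‖ = 1) : reflect l x = x := by
  simp [reflect, hx]

lemma norm_reflect (l : ℝ) {x : Euc n} (hx : x ≠ 0) (h : 0 ≤ 1 + l - l * ‖x‖) :
    ‖reflect l x‖ = 1 + l - l * ‖x‖ := by
  have hx' : 0 < ‖x‖ := norm_pos_iff.2 hx
  have h1 : (1 + l) * ‖x‖⁻¹ - l = (1 + l - l * ‖x‖) / ‖x‖ := by field_simp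
  rw [reflect, norm_smul, h1, Real.norm_of_nonneg (by positivity)]
  field_simp

lemma reflect_reflect {l m : ℝ} (hlm : l * m = 1) {x : Euc n} (hx : x ≠ 0)
    (h : 0 < 1 + l - l * ‖x‖) : reflect m (reflect l x) = x := by
  have hx' : 0 < ‖x‖ := norm_pos_iff.2 hx
  have h1 : (1 + l) * ‖x‖⁻¹ - l = (1 + l - l * ‖x‖) / ‖x‖ := by field_simp
  rw [reflect, norm_reflect l hx h.le, reflect, h1, smul_smul]
  have : ((1 + m) * (1 + l - l * ‖x‖)⁻¹ - m) * ((1 + l - l * ‖x‖) / ‖x‖) = 1 := by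
    field_simp
    linear_combination (‖x‖ - 1) * hlm
  rw [this, one_smul]

lemma continuousOn_reflect (l : ℝ) : ContinuousOn (reflect l (n := n)) {0}ᶜ := fun _ hx =>
  (hasFDerivAt_reflect l hx).continuousAt.continuousWithinAt

lemma continuousOn_dreflect (l : ℝ) : ContinuousOn (dreflect l (n := n)) {0}ᶜ := fun _ hx =>
  (contDiffAt_dreflect l hx).continuousAt.continuousWithinAt

lemma continuousOn_fderiv_dreflect (l : ℝ) :
    ContinuousOn (fderiv ℝ (dreflect l (n := n))) {0}ᶜ := fun _ hx =>
  ((contDiffAt_dreflect l hx).fderiv_right (m := 0) (by simp)).continuousAt.continuousWithinAt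

lemma isCompact_annulus (a b : ℝ) : IsCompact {x : Euc n | a ≤ ‖x‖ ∧ ‖x‖ ≤ b} := by
  refine (isCompact_closedBall (0 : Euc n) b).of_isClosed_subset ?_ fun x hx => by simpa using hx.2
  exact (isClosed_le continuous_const continuous_norm).inter
    (isClosed_le continuous_norm continuous_const)

lemma exists_bound_dreflect (l : ℝ) {a : ℝ} (ha : 0 < a) (b : ℝ) : ∃ K : ℝ, 0 ≤ K ∧
    ∀ x : Euc n, a ≤ ‖x‖ → ‖x‖ ≤ b → ‖dreflect l x‖ ≤ K ∧
      ‖fderiv ℝ (dreflect l (n := n)) x‖ ≤ K ∧ |(dreflect l x).det| ≤ K := by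
  have hsub : {x : Euc n | a ≤ ‖x‖ ∧ ‖x‖ ≤ b} ⊆ {0}ᶜ := fun x hx h0 => by
    rw [Set.mem_singleton_iff] at h0
    have := hx.1
    rw [h0, norm_zero] at this
    linarith
  have hK := isCompact_annulus (n := n) a b
  obtain ⟨K1, h1⟩ := hK.exists_bound_of_continuousOn ((continuousOn_dreflect l).mono hsub)
  obtain ⟨K2, h2⟩ := hK.exists_bound_of_continuousOn (E := Euc n →L[ℝ] Euc n →L[ℝ] Euc n)
    ((continuousOn_fderiv_dreflect l).mono hsub)
  obtain ⟨K3, h3⟩ := hK.exists_bound_of_continuousOn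
    (ContinuousLinearMap.continuous_det.comp_continuousOn ((continuousOn_dreflect l).mono hsub))
  refine ⟨max 0 (max K1 (max K2 K3)), le_max_left _ _, fun x hxa hxb => ⟨?_, ?_, ?_⟩⟩
  · exact (h1 x ⟨hxa, hxb⟩).trans (by simp)
  · exact (h2 x ⟨hxa, hxb⟩).trans (by simp)
  · exact (h3 x ⟨hxa, hxb⟩).trans (by simp)

/-- Change of variables by a reflection: integrals over the outer annulus are controlled by
integrals over the ball. -/
lemma setIntegral_reflect_le {l r : ℝ} (hl : 0 < l) (hlr : l * (r - 1) < 1) :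
    ∃ K : ℝ, 0 ≤ K ∧ ∀ g : Euc n → ℝ, Continuous g → (∀ x, 0 ≤ g x) →
      ∫ x in {x : Euc n | 1 < ‖x‖ ∧ ‖x‖ < r}, g (reflect l x) ≤ K * ∫ x in ball 0 1, g x := by
  have hlm : l * l⁻¹ = 1 := mul_inv_cancel₀ hl.ne'
  have hml : l⁻¹ * l = 1 := inv_mul_cancel₀ hl.ne'
  have hpos : 0 < 1 - l * (r - 1) := by linarith
  obtain ⟨K, hK, hb⟩ := exists_bound_dreflect (n := n) l⁻¹ hpos 1
  refine ⟨K, hK, fun g hg hg0 => ?_⟩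
  set T : Set (Euc n) := {y | 1 - l * (r - 1) < ‖y‖ ∧ ‖y‖ < 1} with hT
  have hTo : IsOpen T := (isOpen_lt continuous_const continuous_norm).inter
    (isOpen_lt continuous_norm continuous_const)
  have hT0 : ∀ y ∈ T, y ≠ 0 := fun y hy h0 => by
    have := hy.1; rw [h0, norm_zero] at this; linarith
  have hTb : T ⊆ ball 0 1 := fun y hy => by simpa using hy.2
  have hT1 : ∀ y ∈ T, 0 < 1 + l⁻¹ - l⁻¹ * ‖y‖ := fun y hy => by
    have := inv_pos.2 hl
    nlinarith [hy.2]
  have hleft : Set.LeftInvOn (reflect l) (reflect l⁻¹) T := fun y hy =>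
    reflect_reflect hml (hT0 y hy) (hT1 y hy)
  have himg : reflect l⁻¹ '' T = {x : Euc n | 1 < ‖x‖ ∧ ‖x‖ < r} := by
    ext x
    constructor
    · rintro ⟨y, hy, rfl⟩
      simp only [Set.mem_ofPred_eq]
      rw [norm_reflect _ (hT0 y hy) (hT1 y hy).le]
      have h1 : 0 < l⁻¹ := inv_pos.2 hl
      have h2 : l⁻¹ * (1 - l * (r - 1)) < l⁻¹ * ‖y‖ := mul_lt_mul_of_pos_left hy.1 h1
      have h3 : l⁻¹ * ‖y‖ < l⁻¹ * 1 := mul_lt_mul_of_pos_left hy.2 h1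
      have h4 : l⁻¹ * (1 - l * (r - 1)) = l⁻¹ - (r - 1) := by field_simp
      constructor <;> linarith
    · rintro ⟨h1, h2⟩
      have hx0 : x ≠ 0 := fun h0 => by rw [h0, norm_zero] at h1; linarith
      have h3 : 0 < 1 + l - l * ‖x‖ := by nlinarith
      refine ⟨reflect l x, ?_, reflect_reflect hlm hx0 h3⟩
      rw [hT, Set.mem_ofPred_eq, norm_reflect l hx0 h3.le]
      constructor <;> nlinarith
  rw [← himg, integral_image_eq_integral_abs_det_fderiv_smul volume hTo.measurableSet
    (fun y hy => (hasFDerivAt_reflect l⁻¹ (hT0 y hy)).hasFDerivWithinAt) hleft.injOn]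
  have hgi : IntegrableOn g (ball 0 1) :=
    (hg.continuousOn.integrableOn_compact (isCompact_closedBall 0 1)).mono_set
      ball_subset_closedBall
  calc _ ≤ ∫ y in T, K * g y := by
        refine integral_mono_of_nonneg (.of_forall fun y => ?_) ((hgi.mono_set hTb).const_mul K) ?_
        · exact mul_nonneg (abs_nonneg _) (hg0 _)
        · refine (ae_restrict_iff' hTo.measurableSet).2 (.of_forall fun y hy => ?_)
          simp only [smul_eq_mul]
          rw [hleft hy]
          exact mul_le_mul_of_nonneg_right (hb y hy.1.le hy.2.le).2.2 (hg0 _)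
    _ = K * ∫ y in T, g y := integral_const_mul _ _
    _ ≤ _ := mul_le_mul_of_nonneg_left
        (setIntegral_mono_set hgi (.of_forall hg0) hTb.eventuallyLE) hK

end Korn

namespace Korn
variable {n : ℕ}
open Filter Topology
open scoped ContDiff RealInnerProductSpace

/-- Twice the symmetric part of a linear map, as a bilinear form. -/
noncomputable def symForm (L : Euc n →L[ℝ] Euc n) (v w : Euc n) : ℝ := ⟪L v, w⟫ + ⟪L w, v⟫

/-- The size of the symmetrized gradient plus the size of the field. -/
noncomputable def symSize (u : Euc n → Euc n) (x : Euc n) : ℝ :=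
  ∑ a : Fin n × Fin n, |symForm (fderiv ℝ u x) (bv a.1) (bv a.2)| + ‖u x‖

/-- Pull-back of a vector field by a reflection. -/
noncomputable def pull (l : ℝ) (u : Euc n → Euc n) (x : Euc n) : Euc n :=
  dreflect l x (u (reflect l x))

/-- The derivative of `pull l u`. -/
noncomputable def dpull (l : ℝ) (u : Euc n → Euc n) (x : Euc n) : Euc n →L[ℝ] Euc n :=
  (dreflect l x).comp ((fderiv ℝ u (reflect l x)).comp (dreflect l x)) +
    (fderiv ℝ (dreflect l) x).flip (u (reflect l x))

lemma symForm_eq_sum (L : Euc n →L[ℝ] Euc n) (v w : Euc n) :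
    symForm L v w = ∑ a : Fin n × Fin n, v a.1 * w a.2 * symForm L (bv a.1) (bv a.2) := by
  have hrep : ∀ z : Euc n, z = ∑ a, z a • bv a := fun z => by
    ext i
    simp [Pi.single_apply]
  have key : ∀ v w : Euc n, ⟪L v, w⟫ = ∑ a, ∑ b, v a * w b * ⟪L (bv a), bv b⟫ := fun v w => by
    conv_lhs => rw [hrep v, hrep w]
    simp only [map_sum, map_smul, sum_inner, inner_sum, inner_smul_left, inner_smul_right,
      RCLike.conj_to_real]
    rw [Finset.sum_comm]
    refine Finset.sum_congr rfl fun a _ => ?_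
    rw [Finset.mul_sum]
    exact Finset.sum_congr rfl fun b _ => by ring
  rw [symForm, key v w, key w v, Finset.sum_comm (γ := Fin n) (f := fun a b => w a * v b * _),
    ← Finset.sum_add_distrib, Fintype.sum_prod_type]
  refine Finset.sum_congr rfl fun a _ => ?_
  rw [← Finset.sum_add_distrib]
  refine Finset.sum_congr rfl fun b _ => ?_
  rw [symForm]; ring

lemma abs_symForm_le (L : Euc n →L[ℝ] Euc n) (v w : Euc n) :
    |symForm L v w| ≤ ‖v‖ * ‖w‖ * ∑ a : Fin n × Fin n, |symForm L (bv a.1) (bv a.2)| := by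
  rw [symForm_eq_sum, Finset.mul_sum]
  refine (Finset.abs_sum_le_sum_abs _ _).trans (Finset.sum_le_sum fun a _ => ?_)
  rw [abs_mul, abs_mul]
  gcongr
  · exact PiLp.norm_apply_le v a.1
  · exact PiLp.norm_apply_le w a.2

lemma symSize_nonneg (u : Euc n → Euc n) (x : Euc n) : 0 ≤ symSize u x := by
  unfold symSize; positivity

lemma continuous_symForm_fderiv {u : Euc n → Euc n} (hu : ContDiff ℝ 1 u) (v w : Euc n) :
    Continuous fun x => symForm (fderiv ℝ u x) v w := by
  have h := hu.continuous_fderiv one_ne_zero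
  unfold symForm
  exact ((h.clm_apply continuous_const).inner continuous_const).add
    ((h.clm_apply continuous_const).inner continuous_const)

lemma continuous_symSize {u : Euc n → Euc n} (hu : ContDiff ℝ 1 u) : Continuous (symSize u) :=
  (continuous_finsetSum _ fun _ _ => (continuous_symForm_fderiv hu _ _).abs).add hu.continuous.norm

lemma hasFDerivAt_pull (l : ℝ) {u : Euc n → Euc n} (hu : ContDiff ℝ 1 u) {x : Euc n}
    (hx : x ≠ 0) : HasFDerivAt (pull l u) (dpull l u x) x := by
  have h1 := ((contDiffAt_dreflect l hx).differentiableAt one_ne_zero).hasFDerivAt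
  have h2 := ((hu.differentiable one_ne_zero) (reflect l x)).hasFDerivAt.comp x
    (hasFDerivAt_reflect l hx)
  exact h1.clm_apply h2

lemma continuousOn_dpull (l : ℝ) {u : Euc n → Euc n} (hu : ContDiff ℝ 1 u) :
    ContinuousOn (dpull l u) {0}ᶜ := by
  have h1 := continuousOn_dreflect (n := n) l
  have h2 := (hu.continuous_fderiv one_ne_zero).comp_continuousOn (continuousOn_reflect (n := n) l)
  have h3 := hu.continuous.comp_continuousOn (continuousOn_reflect (n := n) l)
  refine (h1.clm_comp (h2.clm_comp h1)).add ?_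
  have h4 : ContinuousOn (fun x => (fderiv ℝ (dreflect l (n := n)) x).flip) {0}ᶜ :=
    (ContinuousLinearMap.flipₗᵢ ℝ (Euc n) (Euc n) (Euc n)).continuous.comp_continuousOn
      (continuousOn_fderiv_dreflect (n := n) l)
  exact h4.clm_apply h3

lemma symForm_dpull (l : ℝ) (u : Euc n → Euc n) (x v w : Euc n) :
    symForm (dpull l u x) v w =
      symForm (fderiv ℝ u (reflect l x)) (dreflect l x v) (dreflect l x w)
      + (⟪fderiv ℝ (dreflect l) x v (u (reflect l x)), w⟫
        + ⟪fderiv ℝ (dreflect l) x w (u (reflect l x)), v⟫) := by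
  simp only [symForm, dpull, add_apply, ContinuousLinearMap.comp_apply,
    ContinuousLinearMap.flip_apply, inner_add_left, inner_dreflect]
  ring

lemma norm_bv (a : Fin n) : ‖(bv a : Euc n)‖ = 1 := by simp

lemma abs_symForm_dpull_le {l K : ℝ} (hK : 0 ≤ K) (u : Euc n → Euc n) {x : Euc n}
    (h1 : ‖dreflect l x‖ ≤ K) (h2 : ‖fderiv ℝ (dreflect l (n := n)) x‖ ≤ K) (a b : Fin n) :
    |symForm (dpull l u x) (bv a) (bv b)| ≤ (K * K + 2 * K) * symSize u (reflect l x) := by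
  have hA : ∀ a : Fin n, ‖dreflect l x (bv a)‖ ≤ K := fun a =>
    ((dreflect l x).le_opNorm _).trans (by rw [norm_bv, mul_one]; exact h1)
  have hD : ∀ (a b : Fin n) (z : Euc n), |⟪fderiv ℝ (dreflect l) x (bv a) z, bv b⟫| ≤ K * ‖z‖ := by
    intro a b z
    refine (abs_real_inner_le_norm _ _).trans ?_
    rw [norm_bv, mul_one]
    refine (ContinuousLinearMap.le_opNorm₂ _ _ _).trans ?_
    rw [norm_bv, mul_one]
    gcongr
  have hS : 0 ≤ ∑ a : Fin n × Fin n,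
      |symForm (fderiv ℝ u (reflect l x)) (bv a.1) (bv a.2)| := by positivity
  rw [symForm_dpull]
  have e1 := abs_symForm_le (fderiv ℝ u (reflect l x)) (dreflect l x (bv a)) (dreflect l x (bv b))
  have e2 : ‖dreflect l x (bv a)‖ * ‖dreflect l x (bv b)‖ ≤ K * K := by
    gcongr
    · exact hA a
    · exact hA b
  have e3 := e1.trans (mul_le_mul_of_nonneg_right e2 hS)
  have e4 := hD a b (u (reflect l x))
  have e5 := hD b a (u (reflect l x))
  have e6 := abs_add_le (symForm (fderiv ℝ u (reflect l x)) (dreflect l x (bv a))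
    (dreflect l x (bv b))) (⟪fderiv ℝ (dreflect l) x (bv a) (u (reflect l x)), bv b⟫
        + ⟪fderiv ℝ (dreflect l) x (bv b) (u (reflect l x)), bv a⟫)
  have e7 := abs_add_le ⟪fderiv ℝ (dreflect l) x (bv a) (u (reflect l x)), bv b⟫
    ⟪fderiv ℝ (dreflect l) x (bv b) (u (reflect l x)), bv a⟫
  unfold symSize
  nlinarith [mul_nonneg hK hS, mul_nonneg (mul_nonneg hK hK) (norm_nonneg (u (reflect l x)))]

/-- The extension of a vector field from the unit ball by a combination of reflections. -/
noncomputable def outer (u : Euc n → Euc n) (x : Euc n) : Euc n :=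
  (6 : ℝ) • pull 1 u x - (8 : ℝ) • pull 2 u x + (3 : ℝ) • pull 3 u x

/-- The derivative of `outer u`. -/
noncomputable def douter (u : Euc n → Euc n) (x : Euc n) : Euc n →L[ℝ] Euc n :=
  (6 : ℝ) • dpull 1 u x - (8 : ℝ) • dpull 2 u x + (3 : ℝ) • dpull 3 u x

lemma outer_of_norm_eq_one (u : Euc n → Euc n) {x : Euc n} (hx : ‖x‖ = 1) : outer u x = u x := by
  simp only [outer, pull, reflect_of_norm_eq_one _ hx, dreflect, sub_apply, smul_apply,
    ContinuousLinearMap.id_apply]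
  module

lemma douter_of_norm_eq_one (u : Euc n → Euc n) {x : Euc n} (hx : ‖x‖ = 1) :
    douter u x = fderiv ℝ u x := by
  have hx0 : x ≠ 0 := fun h => by simp [h] at hx
  ext1 v
  simp only [douter, dpull, reflect_of_norm_eq_one _ hx, fderiv_dreflect _ hx0, sub_apply,
    smul_apply, add_apply, ContinuousLinearMap.comp_apply, ContinuousLinearMap.flip_apply,
    dreflect, ContinuousLinearMap.id_apply, map_sub, map_smul]
  module

/-- The `C¹` extension of a vector field from the unit ball. -/
noncomputable def extend (u : Euc n → Euc n) (x : Euc n) : Euc n :=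
  if ‖x‖ ≤ 1 then u x else outer u x

lemma extend_of_one_le (u : Euc n → Euc n) {x : Euc n} (hx : 1 ≤ ‖x‖) :
    extend u x = outer u x := by
  rcases hx.eq_or_lt with h | h
  · rw [extend, if_pos h.ge, outer_of_norm_eq_one u h.symm]
  · rw [extend, if_neg (not_le.2 h)]

lemma hasFDerivAt_extend {u : Euc n → Euc n} (hu : ContDiff ℝ 1 u) (x : Euc n) :
    HasFDerivAt (extend u) (if ‖x‖ ≤ 1 then fderiv ℝ u x else douter u x) x := by
  have hin : IsClosed {x : Euc n | ‖x‖ ≤ 1} := isClosed_le continuous_norm continuous_const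
  have hout : IsClosed {x : Euc n | 1 ≤ ‖x‖} := isClosed_le continuous_const continuous_norm
  rw [← hasFDerivWithinAt_univ]
  have huniv : (Set.univ : Set (Euc n)) = {x | ‖x‖ ≤ 1} ∪ {x | 1 ≤ ‖x‖} := by
    ext y; simpa using le_total _ _
  rw [huniv]
  refine HasFDerivWithinAt.union ?_ ?_
  · by_cases hx : ‖x‖ ≤ 1
    · rw [if_pos hx]
      refine ((hu.differentiable one_ne_zero) x).hasFDerivAt.hasFDerivWithinAt.congr
        (fun y hy => if_pos hy) (if_pos hx)
    · exact .of_notMem_closure (by rwa [hin.closure_eq])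
  · by_cases hx : 1 ≤ ‖x‖
    · have hx0 : x ≠ 0 := fun h => by simp [h] at hx; linarith
      have hd : (if ‖x‖ ≤ 1 then fderiv ℝ u x else douter u x) = douter u x := by
        split_ifs with h
        · exact (douter_of_norm_eq_one u (le_antisymm h hx)).symm
        · rfl
      rw [hd]
      have h := ((((hasFDerivAt_pull 1 hu hx0).const_smul (6 : ℝ)).sub
        ((hasFDerivAt_pull 2 hu hx0).const_smul (8 : ℝ))).add
        ((hasFDerivAt_pull 3 hu hx0).const_smul (3 : ℝ))).hasFDerivWithinAt (s := {x | 1 ≤ ‖x‖})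
      exact h.congr (fun y hy => extend_of_one_le u hy) (extend_of_one_le u hx)
    · exact .of_notMem_closure (by rwa [hout.closure_eq])

lemma contDiff_extend {u : Euc n → Euc n} (hu : ContDiff ℝ 1 u) : ContDiff ℝ 1 (extend u) := by
  rw [contDiff_one_iff_hasFDerivAt]
  refine ⟨_, ?_, hasFDerivAt_extend hu⟩
  refine continuous_if_le continuous_norm continuous_const
    (hu.continuous_fderiv one_ne_zero).continuousOn ?_ fun x hx => (douter_of_norm_eq_one u hx).symm
  have hsub : {x : Euc n | 1 ≤ ‖x‖} ⊆ {0}ᶜ := fun x hx h0 => by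
    rw [Set.mem_singleton_iff] at h0
    have : (1 : ℝ) ≤ ‖x‖ := hx
    rw [h0, norm_zero] at this
    linarith
  have h := fun l : ℝ => (continuousOn_dpull l hu).mono hsub
  exact (((h 1).const_smul (6 : ℝ)).sub ((h 2).const_smul (8 : ℝ))).add ((h 3).const_smul (3 : ℝ))

end Korn

namespace Korn
variable {n : ℕ}
open Filter Topology
open scoped ContDiff RealInnerProductSpace

/-- Korn's first inequality for compactly supported `C¹` maps. -/
lemma korn_compact_field (n : ℕ) {p : ℝ} (hp : 1 < p) (hp2 : p < 2) :
    ∃ C : ℝ, 0 ≤ C ∧ ∀ U : Euc n → Euc n, ContDiff ℝ 1 U → HasCompactSupport U →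
      ∀ i j, ∫ x, |fderiv ℝ U x (bv j) i| ^ p ≤
        C * ∑ a : Fin n × Fin n, ∫ x, |symForm (fderiv ℝ U x) (bv a.1) (bv a.2)| ^ p := by
  obtain ⟨C, hC, h⟩ := korn_compact n hp hp2
  refine ⟨C, hC, fun U hU hc i j => ?_⟩
  have hpd : ∀ a b x, pd a (fun x => U x b) x = fderiv ℝ U x (bv a) b := fun a b x => by
    have h1 : HasFDerivAt (fun x => U x b)
        ((EuclideanSpace.proj (𝕜 := ℝ) b : Euc n →L[ℝ] ℝ).comp (fderiv ℝ U x)) x :=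
      (EuclideanSpace.proj (𝕜 := ℝ) b : Euc n →L[ℝ] ℝ).hasFDerivAt.comp x
        ((hU.differentiable one_ne_zero) x).hasFDerivAt
    rw [pd, h1.fderiv]
    rfl
  have hin : ∀ (v : Euc n) (b : Fin n), ⟪v, bv b⟫ = v b := fun v b => by
    simpa using EuclideanSpace.inner_single_right (𝕜 := ℝ) b 1 v
  have hk := h (fun a x => U x a) (fun a => contDiff_euclidean.1 hU a)
    (fun a => hc.comp_left (g := fun v : Euc n => v a) rfl) i j
  simp only [hpd] at hk
  refine hk.trans_eq ?_
  congr 1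
  refine Finset.sum_congr rfl fun a _ => ?_
  simp only [symForm, hin]
  congr 1 with x
  rw [add_comm]

lemma norm_outer_le_and_symForm_douter_le (n : ℕ) : ∃ K : ℝ, 0 ≤ K ∧
    ∀ (u : Euc n → Euc n) (x : Euc n), 1 ≤ ‖x‖ → ‖x‖ ≤ 13 / 10 →
      ‖outer u x‖ ≤ K * ∑ k : Fin 3, symSize u (reflect (k + 1) x) ∧
      ∀ a b : Fin n, |symForm (douter u x) (bv a) (bv b)| ≤
        K * ∑ k : Fin 3, symSize u (reflect (k + 1) x) := by
  have hK := fun l : ℝ => exists_bound_dreflect (n := n) l one_pos (13 / 10)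
  choose K hK0 hK1 using hK
  have hpull : ∀ l u (x : Euc n), 1 ≤ ‖x‖ → ‖x‖ ≤ 13 / 10 →
      ‖pull l u x‖ ≤ K l * symSize u (reflect l x) := fun l u x h1 h2 => by
    refine (ContinuousLinearMap.le_opNorm _ _).trans ?_
    have h3 : ‖u (reflect l x)‖ ≤ symSize u (reflect l x) :=
      le_add_of_nonneg_left (by positivity)
    have := (hK1 l x h1 h2).1
    have := hK0 l
    gcongr
  set M := K 1 + K 2 + K 3 + (K 1 * K 1 + 2 * K 1) + (K 2 * K 2 + 2 * K 2)
    + (K 3 * K 3 + 2 * K 3) with hM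
  have k1 := hK0 1
  have k2 := hK0 2
  have k3 := hK0 3
  have k11 := mul_nonneg k1 k1
  have k22 := mul_nonneg k2 k2
  have k33 := mul_nonneg k3 k3
  refine ⟨8 * M, by positivity, fun u x h1 h2 => ?_⟩
  have s : ∀ l, 0 ≤ symSize u (reflect l x) := fun l => symSize_nonneg u _
  have hsum : ∑ k : Fin 3, symSize u (reflect (k + 1) x) = symSize u (reflect 1 x)
      + symSize u (reflect 2 x) + symSize u (reflect 3 x) := by
    rw [Fin.sum_univ_three]
    norm_num
  have hmain : ∀ X1 X2 X3 : ℝ, X1 ≤ M * symSize u (reflect 1 x) →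
      X2 ≤ M * symSize u (reflect 2 x) → X3 ≤ M * symSize u (reflect 3 x) →
      6 * X1 + 8 * X2 + 3 * X3 ≤ 8 * M * ∑ k : Fin 3, symSize u (reflect (k + 1) x) := by
    intro X1 X2 X3 e1 e2 e3
    have hM0 : 0 ≤ M := by positivity
    rw [hsum]
    nlinarith [mul_nonneg hM0 (s 1), mul_nonneg hM0 (s 2), mul_nonneg hM0 (s 3)]
  constructor
  · have e : ‖outer u x‖ ≤ 6 * ‖pull 1 u x‖ + 8 * ‖pull 2 u x‖ + 3 * ‖pull 3 u x‖ := by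
      unfold outer
      refine (norm_add_le _ _).trans
        (add_le_add ((norm_sub_le _ _).trans (add_le_add ?_ ?_)) ?_) <;>
      simp [norm_smul]
    refine e.trans (hmain _ _ _ ((hpull 1 u x h1 h2).trans ?_) ((hpull 2 u x h1 h2).trans ?_)
      ((hpull 3 u x h1 h2).trans ?_)) <;>
    exact mul_le_mul_of_nonneg_right (by linarith) (s _)
  · intro a b
    have hd := fun l : ℝ => abs_symForm_dpull_le (hK0 l) u (hK1 l x h1 h2).1 (hK1 l x h1 h2).2.1 a b
    have e0 : symForm (douter u x) (bv a) (bv b) = 6 * symForm (dpull 1 u x) (bv a) (bv b)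
        - 8 * symForm (dpull 2 u x) (bv a) (bv b) + 3 * symForm (dpull 3 u x) (bv a) (bv b) := by
      simp only [symForm, douter, add_apply, sub_apply, smul_apply, inner_add_left, inner_sub_left,
        inner_smul_left, RCLike.conj_to_real]
      ring
    have e : |symForm (douter u x) (bv a) (bv b)| ≤ 6 * |symForm (dpull 1 u x) (bv a) (bv b)|
        + 8 * |symForm (dpull 2 u x) (bv a) (bv b)|
        + 3 * |symForm (dpull 3 u x) (bv a) (bv b)| := by
      rw [e0]
      refine (abs_add_le _ _).trans (add_le_add ((abs_sub _ _).trans (add_le_add ?_ ?_)) ?_) <;>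
      simp [abs_mul]
    refine e.trans (hmain _ _ _ ((hd 1).trans ?_) ((hd 2).trans ?_) ((hd 3).trans ?_)) <;>
    exact mul_le_mul_of_nonneg_right (by linarith) (s _)

/-- A cutoff function equal to one near the closed unit ball. -/
noncomputable def ballCutoff (n : ℕ) : ContDiffBump (0 : Euc n) where
  rIn := 9 / 8
  rOut := 5 / 4
  rIn_pos := by norm_num
  rIn_lt_rOut := by norm_num

/-- The compactly supported extension of a vector field from the unit ball. -/
noncomputable def cutExtend (u : Euc n → Euc n) (x : Euc n) : Euc n :=
  ballCutoff n x • extend u x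

lemma contDiff_cutExtend {u : Euc n → Euc n} (hu : ContDiff ℝ 1 u) : ContDiff ℝ 1 (cutExtend u) :=
  (ballCutoff n).contDiff.smul (contDiff_extend hu)

lemma hasCompactSupport_cutExtend (u : Euc n → Euc n) : HasCompactSupport (cutExtend u) :=
  (ballCutoff n).hasCompactSupport.smul_right

lemma fderiv_cutExtend_of_norm_lt_one {u : Euc n → Euc n} {x : Euc n} (hx : ‖x‖ < 1) :
    fderiv ℝ (cutExtend u) x = fderiv ℝ u x := by
  refine Filter.EventuallyEq.fderiv_eq ?_
  filter_upwards [(isOpen_lt continuous_norm continuous_const).mem_nhds hx] with y hy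
  have hy' : ‖y‖ ≤ 1 := le_of_lt hy
  have : ballCutoff n y = 1 := (ballCutoff n).one_of_mem_closedBall (by
    simp only [ballCutoff, mem_closedBall, dist_zero_right]; linarith)
  rw [cutExtend, this, one_smul, extend, if_pos hy']

lemma fderiv_cutExtend_of_le_norm {u : Euc n → Euc n} {x : Euc n} (hx : 13 / 10 ≤ ‖x‖) :
    fderiv ℝ (cutExtend u) x = 0 := by
  have h5 : (5 / 4 : ℝ) < ‖x‖ := by linarith
  have h : cutExtend u =ᶠ[𝓝 x] fun _ => 0 := by
    filter_upwards [(isOpen_lt continuous_const continuous_norm).mem_nhds h5] with y hy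
    have hy' : 5 / 4 ≤ ‖y‖ := le_of_lt hy
    have : ballCutoff n y = 0 := (ballCutoff n).zero_of_le_dist (by
      simpa [ballCutoff] using hy')
    rw [cutExtend, this, zero_smul]
  rw [h.fderiv_eq]
  simp

lemma abs_symForm_cutExtend_le (n : ℕ) : ∃ K : ℝ, 0 ≤ K ∧
    ∀ u : Euc n → Euc n, ContDiff ℝ 1 u → ∀ x : Euc n, 1 < ‖x‖ → ‖x‖ ≤ 13 / 10 →
      ∀ a b : Fin n, |symForm (fderiv ℝ (cutExtend u) x) (bv a) (bv b)| ≤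
        K * ∑ k : Fin 3, symSize u (reflect (k + 1) x) := by
  obtain ⟨K, hK, h⟩ := norm_outer_le_and_symForm_douter_le n
  have hη : ContDiff ℝ 1 (ballCutoff n) := (ballCutoff n).contDiff
  obtain ⟨M, hM⟩ := ((ballCutoff n).hasCompactSupport.fderiv ℝ).exists_bound_of_continuous
    (hη.continuous_fderiv one_ne_zero)
  have hM0 : 0 ≤ M := (norm_nonneg _).trans (hM 0)
  refine ⟨K + 2 * (M * K), by positivity, fun u hu x h1 h2 a b => ?_⟩
  obtain ⟨ho, hs⟩ := h u x h1.le h2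
  have hd := ((hη.differentiable one_ne_zero) x).hasFDerivAt.smul (hasFDerivAt_extend hu x)
  rw [if_neg (not_le.2 h1)] at hd
  have hd' : fderiv ℝ (cutExtend u) x = _ := hd.fderiv
  rw [hd']
  have e0 : symForm (ballCutoff n x • douter u x
      + (fderiv ℝ (ballCutoff n) x).smulRight (extend u x)) (bv a) (bv b)
      = ballCutoff n x * symForm (douter u x) (bv a) (bv b)
        + (fderiv ℝ (ballCutoff n) x (bv a) * ⟪outer u x, bv b⟫
          + fderiv ℝ (ballCutoff n) x (bv b) * ⟪outer u x, bv a⟫) := by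
    rw [extend_of_one_le u h1.le]
    simp only [symForm, add_apply, smul_apply, ContinuousLinearMap.smulRight_apply, inner_add_left,
      inner_smul_left, RCLike.conj_to_real]
    ring
  rw [e0]
  set S := K * ∑ k : Fin 3, symSize u (reflect (k + 1) x) with hS
  have hSn : 0 ≤ S := (norm_nonneg _).trans ho
  have e1 : |ballCutoff n x * symForm (douter u x) (bv a) (bv b)| ≤ 1 * S := by
    rw [abs_mul, abs_of_nonneg (ballCutoff n).nonneg]
    exact mul_le_mul (ballCutoff n).le_one (hs a b) (abs_nonneg _) zero_le_one
  have e2 : ∀ a b : Fin n, |fderiv ℝ (ballCutoff n) x (bv a) * ⟪outer u x, bv b⟫| ≤ M * S := by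
    intro a b
    rw [abs_mul]
    refine mul_le_mul ?_ ?_ (abs_nonneg _) hM0
    · refine ((fderiv ℝ (ballCutoff n) x).le_opNorm (bv a)).trans ?_
      rw [norm_bv, mul_one]
      exact hM x
    · refine (abs_real_inner_le_norm _ _).trans ?_
      rw [norm_bv, mul_one]
      exact ho
  refine (abs_add_le _ _).trans ((add_le_add e1 ((abs_add_le _ _).trans
    (add_le_add (e2 a b) (e2 b a)))).trans_eq ?_)
  rw [hS]; ring

/-- Korn's inequality on the unit ball, with the field itself on the right-hand side. -/
lemma korn_ball (n : ℕ) {p : ℝ} (hp : 1 < p) (hp2 : p < 2) :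
    ∃ C : ℝ, 0 ≤ C ∧ ∀ u : Euc n → Euc n, ContDiff ℝ 1 u → ∀ i j,
      ∫ x in ball 0 1, |fderiv ℝ u x (bv j) i| ^ p ≤ C * ∫ x in ball 0 1, symSize u x ^ p := by
  obtain ⟨C, hC, hkorn⟩ := korn_compact_field n hp hp2
  obtain ⟨K, hK, hbound⟩ := abs_symForm_cutExtend_le n
  have hp0 : 0 < p := by linarith
  have hrefl := fun k : Fin 3 => setIntegral_reflect_le (n := n) (l := (k : ℝ) + 1) (r := 13 / 10)
    (by positivity) (by
      have : ((k : ℕ) : ℝ) ≤ 2 := by exact_mod_cast Nat.lt_succ_iff.1 k.2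
      linarith)
  choose R hR0 hR using hrefl
  set D := K ^ p * (3 : ℝ) ^ (p - 1) with hD
  refine ⟨C * ∑ _a : Fin n × Fin n, (1 + D * ∑ k, R k), mul_nonneg hC
    (Finset.sum_nonneg fun _ _ => add_nonneg zero_le_one (mul_nonneg (by positivity)
      (Finset.sum_nonneg fun k _ => hR0 k))), fun u hu i j => ?_⟩
  set A : Set (Euc n) := {x | 1 < ‖x‖ ∧ ‖x‖ < 13 / 10} with hA
  have hAo : IsOpen A := (isOpen_lt continuous_const continuous_norm).inter
    (isOpen_lt continuous_norm continuous_const)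
  set S := fun x => symSize u x ^ p with hSdef
  have hScont : Continuous S := (continuous_symSize hu).rpow_const fun _ => .inr hp0.le
  have hS0 : ∀ x, 0 ≤ S x := fun x => Real.rpow_nonneg (symSize_nonneg u x) p
  have hSi : IntegrableOn S (ball 0 1) :=
    (hScont.continuousOn.integrableOn_compact (isCompact_closedBall 0 1)).mono_set
      ball_subset_closedBall
  have hSA : ∀ k : Fin 3, IntegrableOn (fun x => S (reflect (k + 1) x)) A := fun k => by
    have hsub : {x : Euc n | 1 ≤ ‖x‖ ∧ ‖x‖ ≤ 13 / 10} ⊆ {0}ᶜ := fun x hx h0 => by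
      rw [Set.mem_singleton_iff] at h0
      have := hx.1
      rw [h0, norm_zero] at this
      linarith
    exact ((hScont.comp_continuousOn ((continuousOn_reflect _).mono hsub)).integrableOn_compact
      (isCompact_annulus _ _)).mono_set fun x hx => ⟨hx.1.le, hx.2.le⟩
  have hgA : IntegrableOn (fun x => D * ∑ k : Fin 3, S (reflect (k + 1) x)) A :=
    (integrable_finsetSum _ fun k _ => hSA k).const_mul D
  have hpt : ∀ a : Fin n × Fin n, ∀ x ∈ A,
      |symForm (fderiv ℝ (cutExtend u) x) (bv a.1) (bv a.2)| ^ p ≤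
        D * ∑ k : Fin 3, S (reflect (k + 1) x) := fun a x hx => by
    have h1 := Real.rpow_le_rpow (abs_nonneg _) (hbound u hu x hx.1 hx.2.le a.1 a.2) hp0.le
    rw [Real.mul_rpow hK (Finset.sum_nonneg fun k _ => symSize_nonneg u _)] at h1
    have h2 := sum_rpow_le (Finset.univ : Finset (Fin 3))
      (x := fun k => symSize u (reflect ((k : ℝ) + 1) x)) (fun k => symSize_nonneg u _) hp.le
    refine h1.trans ?_
    rw [hD, mul_assoc]
    refine mul_le_mul_of_nonneg_left (h2.trans_eq ?_) (by positivity)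
    simp [hSdef]
  have hest : ∀ a : Fin n × Fin n,
      ∫ x, |symForm (fderiv ℝ (cutExtend u) x) (bv a.1) (bv a.2)| ^ p ≤
        (1 + D * ∑ k, R k) * ∫ x in ball 0 1, S x := fun a => by
    have hsph : ∀ᵐ x : Euc n, ‖x‖ ≠ 1 := by
      have h0 : volume (sphere (0 : Euc n) 1) = 0 :=
        Measure.addHaar_sphere_of_ne_zero _ _ one_ne_zero
      filter_upwards [compl_mem_ae_iff.2 h0] with x hx h
      exact hx (by simpa using h)
    calc _ ≤ ∫ x, ((ball 0 1).indicator S x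
          + A.indicator (fun x => D * ∑ k : Fin 3, S (reflect (k + 1) x)) x) := by
          refine integral_mono_of_nonneg (.of_forall fun x => by positivity)
            ((hSi.integrable_indicator measurableSet_ball).add
              (hgA.integrable_indicator hAo.measurableSet)) ?_
          filter_upwards [hsph] with x hx
          rcases lt_or_gt_of_ne hx with h | h
          · have hxB : x ∈ ball (0 : Euc n) 1 := by simpa using h
            have hxA : x ∉ A := fun hh => absurd hh.1 (not_lt.2 h.le)
            rw [Set.indicator_of_mem hxB, Set.indicator_of_notMem hxA, add_zero,
              fderiv_cutExtend_of_norm_lt_one h]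
            refine Real.rpow_le_rpow (abs_nonneg _) ?_ hp0.le
            have := Finset.single_le_sum (f := fun a : Fin n × Fin n =>
              |symForm (fderiv ℝ u x) (bv a.1) (bv a.2)|) (fun a _ => abs_nonneg _)
              (Finset.mem_univ a)
            exact this.trans (le_add_of_nonneg_right (norm_nonneg _))
          · have hxB : x ∉ ball (0 : Euc n) 1 := by simpa using h.le
            rw [Set.indicator_of_notMem hxB, zero_add]
            by_cases hxA : x ∈ A
            · rw [Set.indicator_of_mem hxA]
              exact hpt a x hxA
            · have h3 : 13 / 10 ≤ ‖x‖ := not_lt.1 fun hh => hxA ⟨h, hh⟩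
              rw [Set.indicator_of_notMem hxA, fderiv_cutExtend_of_le_norm h3]
              simp [symForm, Real.zero_rpow hp0.ne']
      _ = (∫ x in ball 0 1, S x) + D * ∑ k : Fin 3, ∫ x in A, S (reflect (k + 1) x) := by
          rw [integral_add (hSi.integrable_indicator measurableSet_ball)
            (hgA.integrable_indicator hAo.measurableSet), integral_indicator measurableSet_ball,
            integral_indicator hAo.measurableSet, integral_const_mul,
            integral_finsetSum _ fun k _ => hSA k]
      _ ≤ (∫ x in ball 0 1, S x) + D * ∑ k : Fin 3, R k * ∫ x in ball 0 1, S x := by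
          gcongr with k
          exact hR k S hScont hS0
      _ = _ := by rw [← Finset.sum_mul]; ring
  have hu1 : ∫ x in ball 0 1, |fderiv ℝ u x (bv j) i| ^ p
      ≤ ∫ x, |fderiv ℝ (cutExtend u) x (bv j) i| ^ p := by
    have hU := contDiff_cutExtend hu
    have hcont : Continuous fun x => |fderiv ℝ (cutExtend u) x (bv j) i| ^ p := by
      refine Continuous.rpow_const ?_ fun _ => .inr hp0.le
      exact ((EuclideanSpace.proj (𝕜 := ℝ) i).continuous.comp
        ((hU.continuous_fderiv one_ne_zero).clm_apply continuous_const)).abs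
    have hcomp : HasCompactSupport fun x => |fderiv ℝ (cutExtend u) x (bv j) i| ^ p :=
      ((hasCompactSupport_cutExtend u).fderiv ℝ).comp_left
        (g := fun L : Euc n →L[ℝ] Euc n => |L (bv j) i| ^ p) (by simp [Real.zero_rpow hp0.ne'])
    rw [setIntegral_congr_fun (g := fun x => |fderiv ℝ (cutExtend u) x (bv j) i| ^ p)
      measurableSet_ball fun x hx => ?_]
    · exact setIntegral_le_integral (hcont.integrable_of_hasCompactSupport hcomp)
        (.of_forall fun x => by positivity)
    · have hx' : ‖x‖ < 1 := by simpa using hx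
      simp only [fderiv_cutExtend_of_norm_lt_one hx']
  refine hu1.trans ((hkorn _ (contDiff_cutExtend hu) (hasCompactSupport_cutExtend u) i j).trans ?_)
  rw [mul_assoc, Finset.sum_mul]
  exact mul_le_mul_of_nonneg_left (Finset.sum_le_sum fun a _ => hest a) hC

end Korn

namespace Korn
variable {n : ℕ}
open Filter Topology
open scoped ContDiff RealInnerProductSpace

/-- Jensen's inequality for powers with respect to a finite measure. -/
lemma integral_rpow_le {α : Type*} [MeasurableSpace α] {μ : Measure α} [IsFiniteMeasure μ]
    {p : ℝ} (hp : 1 ≤ p) {f : α → ℝ} (hf0 : ∀ x, 0 ≤ f x) (hf : Integrable f μ)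
    (hfp : Integrable (fun x => f x ^ p) μ) :
    (∫ x, f x ∂μ) ^ p ≤ μ.real Set.univ ^ (p - 1) * ∫ x, f x ^ p ∂μ := by
  have hp0 : 0 < p := by linarith
  rcases eq_or_ne μ 0 with rfl | hμ
  · simp [Real.zero_rpow hp0.ne']
  have : NeZero μ := ⟨hμ⟩
  have hm : 0 < μ.real Set.univ := by
    rw [measureReal_def, ENNReal.toReal_pos_iff]
    exact ⟨by simpa [pos_iff_ne_zero] using hμ, measure_lt_top _ _⟩
  have h := (convexOn_rpow hp).map_average_le (μ := μ) (f := f)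
    (continuousOn_id.rpow_const fun _ _ => .inr hp0.le) isClosed_Ici (.of_forall hf0) hf hfp
  rw [average_eq, average_eq, smul_eq_mul, smul_eq_mul,
    Real.mul_rpow (by positivity) (integral_nonneg hf0)] at h
  have e1 : μ.real Set.univ ^ p * ((μ.real Set.univ)⁻¹ ^ p * (∫ x, f x ∂μ) ^ p)
      = (∫ x, f x ∂μ) ^ p := by
    rw [← mul_assoc, ← Real.mul_rpow hm.le (by positivity), mul_inv_cancel₀ hm.ne', Real.one_rpow,
      one_mul]
  have e2 : μ.real Set.univ ^ (p - 1) = μ.real Set.univ ^ p * (μ.real Set.univ)⁻¹ := by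
    rw [Real.rpow_sub hm, Real.rpow_one, div_eq_mul_inv]
  rw [← e1, e2, mul_assoc]
  exact mul_le_mul_of_nonneg_left h (by positivity)

/-- Contracting the unit ball towards one of its points. -/
lemma setIntegral_contract_le {a : ℝ} (ha : 0 < a) (ha1 : a ≤ 1) {w : Euc n} (hw : ‖w‖ ≤ 1)
    {f : Euc n → ℝ} (hf : Continuous f) (hf0 : ∀ x, 0 ≤ f x) :
    ∫ x in ball 0 1, f (a • x + (1 - a) • w) ≤ (a ^ n)⁻¹ * ∫ x in ball 0 1, f x := by
  have hfi : Integrable ((ball 0 1).indicator f) :=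
    ((hf.continuousOn.integrableOn_compact (isCompact_closedBall 0 1)).mono_set
      ball_subset_closedBall).integrable_indicator measurableSet_ball
  have hfi2 : Integrable fun x : Euc n => (ball 0 1).indicator f (a • x + (1 - a) • w) :=
    (hfi.comp_add_right ((1 - a) • w)).comp_smul ha.ne'
  rw [← integral_indicator measurableSet_ball]
  calc _ ≤ ∫ x, (ball 0 1).indicator f (a • x + (1 - a) • w) := by
        refine integral_mono_of_nonneg (.of_forall fun x =>
          Set.indicator_nonneg (fun _ _ => hf0 _) x) hfi2 (.of_forall fun x => ?_)
        by_cases hx : x ∈ ball (0 : Euc n) 1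
        · have hx' : ‖x‖ < 1 := by simpa using hx
          have hin : a • x + (1 - a) • w ∈ ball (0 : Euc n) 1 := by
            rw [mem_ball_zero_iff]
            refine (norm_add_le _ _).trans_lt ?_
            rw [norm_smul, norm_smul, Real.norm_of_nonneg ha.le,
              Real.norm_of_nonneg (by linarith : 0 ≤ 1 - a)]
            nlinarith
          simp only [Set.indicator_of_mem hx, Set.indicator_of_mem hin, le_refl]
        · rw [Set.indicator_of_notMem hx]
          exact Set.indicator_nonneg (fun _ _ => hf0 _) _
    _ = (a ^ n)⁻¹ * ∫ x in ball 0 1, f x := by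
        rw [Measure.integral_comp_smul volume
          (fun x => (ball 0 1).indicator f (x + (1 - a) • w)) a,
          integral_add_right_eq_self, integral_indicator measurableSet_ball,
          finrank_euclideanSpace_fin, abs_of_pos (by positivity), smul_eq_mul]

/-- The increment along a segment is bounded by the integral of the derivative. -/
lemma norm_sub_le_integral_fderiv {v : Euc n → Euc n} (hv : ContDiff ℝ 1 v) (x y : Euc n) :
    ‖v y - v x‖ ≤ ‖y - x‖ * ∫ t in Set.Icc (0 : ℝ) 1, ‖fderiv ℝ v (x + t • (y - x))‖ := by
  have hd : ∀ t : ℝ, HasDerivAt (fun t : ℝ => v (x + t • (y - x)))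
      (fderiv ℝ v (x + t • (y - x)) (y - x)) t := fun t => by
    have h1 : HasDerivAt (fun t : ℝ => x + t • (y - x)) (y - x) t := by
      simpa using ((hasDerivAt_id t).smul_const (y - x)).const_add x
    exact ((hv.differentiable one_ne_zero) _).hasFDerivAt.comp_hasDerivAt t h1
  have hc : Continuous fun t : ℝ => fderiv ℝ v (x + t • (y - x)) :=
    (hv.continuous_fderiv one_ne_zero).comp (by fun_prop)
  have hftc := intervalIntegral.integral_eq_sub_of_hasDerivAt (a := 0) (b := 1) (fun t _ => hd t)
    ((hc.clm_apply continuous_const).intervalIntegrable _ _)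
  simp only [one_smul, zero_smul, add_zero, add_sub_cancel] at hftc
  rw [← hftc, integral_Icc_eq_integral_Ioc, ← intervalIntegral.integral_of_le zero_le_one,
    ← intervalIntegral.integral_const_mul]
  refine intervalIntegral.norm_integral_le_of_norm_le zero_le_one (.of_forall fun t _ => ?_)
    ((hc.norm.const_mul _).intervalIntegrable _ _)
  rw [mul_comm]
  exact ContinuousLinearMap.le_opNorm _ _

set_option maxHeartbeats 1000000 in
/-- On the unit ball, the `L^p` norm of a map is controlled by a small multiple of the `L^p` norm
of its derivative and a large multiple of its `L¹` norm. -/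
lemma integral_rpow_norm_le (n : ℕ) {p : ℝ} (hp : 1 < p) {ε : ℝ} (hε : 0 < ε) :
    ∃ C : ℝ, 0 ≤ C ∧ ∀ v : Euc n → Euc n, ContDiff ℝ 1 v →
      ∫ x in ball 0 1, ‖v x‖ ^ p ≤ ε * (∫ x in ball 0 1, ‖fderiv ℝ v x‖ ^ p)
        + C * (∫ x in ball 0 1, ‖v x‖) ^ p := by
  have hp0 : 0 < p := by linarith
  obtain ⟨δ, hδ, hδ2, hδε⟩ : ∃ δ : ℝ, 0 < δ ∧ δ ≤ 1 / 2 ∧ 2 ^ p * 2 ^ n * (2 * δ) ^ p ≤ ε := by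
    have hlim : Tendsto (fun δ : ℝ => 2 ^ p * 2 ^ n * (2 * δ) ^ p) (𝓝 0) (𝓝 0) := by
      have : Continuous fun δ : ℝ => (2 : ℝ) ^ p * 2 ^ n * (2 * δ) ^ p :=
        continuous_const.mul ((continuous_const.mul continuous_id).rpow_const fun _ => .inr hp0.le)
      simpa [Real.zero_rpow hp0.ne'] using this.tendsto 0
    have h1 := (hlim.mono_left (nhdsWithin_le_nhds (s := Set.Ioi 0))).eventually_le_const hε
    have h2 : ∀ᶠ δ : ℝ in 𝓝[>] 0, δ ∈ Set.Ioc (0 : ℝ) (1 / 2) :=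
      Ioc_mem_nhdsGT (by norm_num)
    obtain ⟨δ, h3, h4⟩ := (h1.and h2).exists
    exact ⟨δ, h4.1, h4.2, h3⟩
  set B : Set (Euc n) := ball 0 1 with hB
  set m := volume.real B with hm
  have hm0 : 0 < m := ENNReal.toReal_pos (measure_ball_pos _ _ one_pos).ne' measure_ball_lt_top.ne
  refine ⟨2 ^ p * m ^ (1 - p) * (δ ^ n)⁻¹ ^ p, by positivity, fun v hv => ?_⟩
  set g := fun x => ‖fderiv ℝ v x‖ with hg
  have hgc : Continuous g := (hv.continuous_fderiv one_ne_zero).norm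
  set I := ∫ x in B, ‖v x‖ with hI
  have hI0 : 0 ≤ I := integral_nonneg fun _ => norm_nonneg _
  set P : Measure (Euc n × ℝ) :=
    (volume.restrict B).prod (volume.restrict (Set.Icc (0 : ℝ) 1)) with hP
  have : IsFiniteMeasure (volume.restrict B) := ⟨by
    rw [Measure.restrict_apply_univ]; exact measure_ball_lt_top⟩
  have hPm : P.real Set.univ = m := by
    rw [hP, ← Set.univ_prod_univ, measureReal_prod_prod]
    simp [hm]
  set h := fun (x : Euc n) (q : Euc n × ℝ) => g (x + q.2 • (δ • (q.1 - x))) with hh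
  have hhc : Continuous (Function.uncurry h) := hgc.comp (by fun_prop)
  have hxc : ∀ x, Continuous (h x) := fun x => hgc.comp (by fun_prop)
  have hPint : ∀ F : Euc n × ℝ → ℝ, Continuous F → Integrable F P := fun F hF => by
    rw [hP, Measure.prod_restrict]
    exact (hF.continuousOn.integrableOn_compact
      ((isCompact_closedBall (0 : Euc n) 1).prod isCompact_Icc)).mono_set
      (Set.prod_mono ball_subset_closedBall subset_rfl)
  have hBint : ∀ F : Euc n → ℝ, Continuous F → IntegrableOn F B := fun F hF =>
    (hF.continuousOn.integrableOn_compact (isCompact_closedBall 0 1)).mono_set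
      ball_subset_closedBall
  have hpoint : ∀ x ∈ B, m * ‖v x‖ ≤ 2 * δ * (∫ q, h x q ∂P) + (δ ^ n)⁻¹ * I := by
    intro x hx
    have hx' : ‖x‖ < 1 := by simpa [hB] using hx
    have hcv : Continuous fun z : Euc n => ‖v (δ • z + (1 - δ) • x)‖ :=
      (hv.continuous.comp (by fun_prop)).norm
    have hinner : IntegrableOn (fun z => ∫ t in Set.Icc (0 : ℝ) 1, h x (z, t)) B :=
      (hPint _ (hxc x)).integral_prod_left
    calc m * ‖v x‖ = ∫ z in B, ‖v x‖ := by rw [setIntegral_const, smul_eq_mul]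
      _ ≤ ∫ z in B, (2 * δ * (∫ t in Set.Icc (0 : ℝ) 1, h x (z, t))
          + ‖v (δ • z + (1 - δ) • x)‖) := by
          refine setIntegral_mono_on (hBint _ continuous_const)
            ((hinner.const_mul _).add (hBint _ hcv)) measurableSet_ball fun z hz => ?_
          have hz' : ‖z‖ < 1 := by simpa [hB] using hz
          have h1 := norm_sub_le_integral_fderiv hv x (δ • z + (1 - δ) • x)
          have h2 : δ • z + (1 - δ) • x - x = δ • (z - x) := by module
          rw [h2] at h1
          have h3 : ‖δ • (z - x)‖ ≤ 2 * δ := by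
            rw [norm_smul, Real.norm_of_nonneg hδ.le]
            have := norm_sub_le z x
            nlinarith
          have h4 : 0 ≤ ∫ t in Set.Icc (0 : ℝ) 1, ‖fderiv ℝ v (x + t • (δ • (z - x)))‖ :=
            integral_nonneg fun _ => norm_nonneg _
          have h5 := h1.trans (mul_le_mul_of_nonneg_right h3 h4)
          have h6 := norm_sub_norm_le (v x) (v (δ • z + (1 - δ) • x))
          rw [norm_sub_rev] at h6
          linarith
      _ = 2 * δ * (∫ q, h x q ∂P) + ∫ z in B, ‖v (δ • z + (1 - δ) • x)‖ := by
          rw [integral_add (hinner.const_mul _) (hBint _ hcv), integral_const_mul,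
            hP, integral_prod _ (hPint _ (hxc x))]
      _ ≤ _ := by
          gcongr
          exact setIntegral_contract_le hδ (by linarith) hx'.le hv.continuous.norm
            fun _ => norm_nonneg _
  have hpow : ∀ x ∈ B, ‖v x‖ ^ p ≤ 2 ^ p * (2 * δ) ^ p * m⁻¹ * (∫ q, h x q ^ p ∂P)
      + 2 ^ p * m ^ (-p) * (δ ^ n)⁻¹ ^ p * I ^ p := by
    intro x hx
    have hh0 : ∀ q, 0 ≤ h x q := fun q => norm_nonneg _
    have hH0 : 0 ≤ ∫ q, h x q ∂P := integral_nonneg hh0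
    have h1 := Real.rpow_le_rpow (by positivity) (hpoint x hx) hp0.le
    have h2 := add_rpow_le (x := 2 * δ * ∫ q, h x q ∂P) (y := (δ ^ n)⁻¹ * I) (by positivity)
      (by positivity) hp0.le
    have h3 := integral_rpow_le hp.le hh0 (hPint _ (hxc x))
      (hPint _ ((hxc x).rpow_const fun _ => .inr hp0.le))
    rw [hPm] at h3
    rw [Real.mul_rpow hm0.le (norm_nonneg _)] at h1
    rw [Real.mul_rpow (by positivity) hH0, Real.mul_rpow (by positivity) hI0] at h2
    have h4 := h1.trans (h2.trans (mul_le_mul_of_nonneg_left (add_le_add_left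
      (mul_le_mul_of_nonneg_left h3 (by positivity : 0 ≤ (2 * δ) ^ p)) _) (by positivity)))
    have h5 := mul_le_mul_of_nonneg_left h4 (by positivity : 0 ≤ m ^ (-p))
    have e1 : m ^ (-p) * m ^ p = 1 := by rw [← Real.rpow_add hm0]; simp
    have e2 : m ^ (-p) * m ^ (p - 1) = m⁻¹ := by
      rw [← Real.rpow_add hm0, ← Real.rpow_neg_one]; congr 1; ring
    rw [← mul_assoc, e1, one_mul] at h5
    refine h5.trans_eq ?_
    rw [← e2]
    ring
  have hcpow : Continuous (Function.uncurry fun x q => h x q ^ p) :=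
    hhc.rpow_const fun _ => .inr hp0.le
  have hfull : Integrable (Function.uncurry fun x q => h x q ^ p) ((volume.restrict B).prod P) := by
    rw [hP, Measure.prod_restrict, Measure.prod_restrict]
    exact (hcpow.continuousOn.integrableOn_compact ((isCompact_closedBall (0 : Euc n) 1).prod
      ((isCompact_closedBall (0 : Euc n) 1).prod isCompact_Icc))).mono_set
      (Set.prod_mono ball_subset_closedBall (Set.prod_mono ball_subset_closedBall subset_rfl))
  have houter : IntegrableOn (fun x => ∫ q, h x q ^ p ∂P) B := hfull.integral_prod_left
  have hswap : ∫ x in B, ∫ q, h x q ^ p ∂P ≤ 2 ^ n * m * ∫ x in B, g x ^ p := by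
    rw [integral_integral_swap hfull]
    have hsupp : ∀ᵐ q ∂P, ‖q.1‖ < 1 ∧ q.2 ∈ Set.Icc (0 : ℝ) 1 := by
      rw [hP, Measure.prod_restrict]
      refine (ae_restrict_iff' (measurableSet_ball.prod measurableSet_Icc)).2 (.of_forall ?_)
      rintro q ⟨h1, h2⟩
      exact ⟨by simpa [hB] using h1, h2⟩
    calc _ ≤ ∫ _q, (2 ^ n * ∫ x in B, g x ^ p) ∂P := by
          refine integral_mono_of_nonneg (.of_forall fun q => integral_nonneg fun x =>
            Real.rpow_nonneg (norm_nonneg _) _) (integrable_const _) ?_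
          filter_upwards [hsupp] with q hq
          have hs0 : 0 ≤ q.2 * δ := mul_nonneg hq.2.1 hδ.le
          have hs1 : q.2 * δ ≤ 1 / 2 := by nlinarith [hq.2.2, hq.2.1]
          have h1 := setIntegral_contract_le (a := 1 - q.2 * δ) (by linarith) (by linarith)
            hq.1.le (f := fun x => g x ^ p) (hgc.rpow_const fun _ => .inr hp0.le)
            fun x => Real.rpow_nonneg (norm_nonneg _) _
          have e : ∀ x : Euc n, (1 - q.2 * δ) • x + (1 - (1 - q.2 * δ)) • q.1
              = x + q.2 • (δ • (q.1 - x)) := fun x => by module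
          simp only [e] at h1
          refine h1.trans (mul_le_mul_of_nonneg_right ?_ (integral_nonneg fun x =>
            Real.rpow_nonneg (norm_nonneg _) _))
          rw [← inv_pow]
          refine pow_le_pow_left₀ (inv_nonneg.2 (by linarith)) ?_ n
          rw [inv_le_comm₀ (by linarith) (by norm_num)]
          linarith
      _ = _ := by rw [integral_const, hPm, smul_eq_mul]; ring
  calc _ ≤ ∫ x in B, (2 ^ p * (2 * δ) ^ p * m⁻¹ * (∫ q, h x q ^ p ∂P)
      + 2 ^ p * m ^ (-p) * (δ ^ n)⁻¹ ^ p * I ^ p) := by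
        refine setIntegral_mono_on (hBint _ (hv.continuous.norm.rpow_const fun _ => .inr hp0.le))
          ((houter.const_mul _).add (hBint _ continuous_const))
          measurableSet_ball hpow
    _ = 2 ^ p * (2 * δ) ^ p * m⁻¹ * (∫ x in B, ∫ q, h x q ^ p ∂P)
      + m * (2 ^ p * m ^ (-p) * (δ ^ n)⁻¹ ^ p * I ^ p) := by
        rw [integral_add (houter.const_mul _) (hBint _ continuous_const),
          integral_const_mul, setIntegral_const, smul_eq_mul]
    _ ≤ 2 ^ p * (2 * δ) ^ p * m⁻¹ * (2 ^ n * m * ∫ x in B, g x ^ p)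
      + m * (2 ^ p * m ^ (-p) * (δ ^ n)⁻¹ ^ p * I ^ p) := by gcongr
    _ = 2 ^ p * 2 ^ n * (2 * δ) ^ p * (∫ x in B, g x ^ p)
      + 2 ^ p * m ^ (1 - p) * (δ ^ n)⁻¹ ^ p * I ^ p := by
        have e : m ^ (1 - p) = m * m ^ (-p) := by
          rw [sub_eq_add_neg, Real.rpow_add hm0, Real.rpow_one]
        rw [e]
        field_simp
    _ ≤ _ := by gcongr

end Korn

namespace Korn
variable {n : ℕ}
open Filter Topology
open scoped ContDiff RealInnerProductSpace

lemma frob_nonneg (M : Matrix (Fin n) (Fin n) ℝ) : 0 ≤ frob M := Real.sqrt_nonneg _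

lemma abs_entry_le_frob (M : Matrix (Fin n) (Fin n) ℝ) (i j : Fin n) : |M i j| ≤ frob M := by
  refine Real.abs_le_sqrt ?_
  have h1 := Finset.single_le_sum (f := fun j => M i j ^ 2) (fun j _ => sq_nonneg _)
    (Finset.mem_univ j)
  have h2 := Finset.single_le_sum (f := fun i => ∑ j, M i j ^ 2)
    (fun i _ => Finset.sum_nonneg fun j _ => sq_nonneg _) (Finset.mem_univ i)
  exact h1.trans h2

lemma frob_le_sum_abs (M : Matrix (Fin n) (Fin n) ℝ) :
    frob M ≤ ∑ a : Fin n × Fin n, |M a.1 a.2| := by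
  refine Real.sqrt_le_iff.2 ⟨by positivity, ?_⟩
  rw [← Fintype.sum_prod_type']
  refine (Finset.sum_le_sum fun a _ => (sq_abs (M a.1 a.2)).ge).trans ?_
  exact Finset.sum_sq_le_sq_sum_of_nonneg fun a _ => abs_nonneg _

lemma norm_fderiv_le_sum (v : Euc n → Euc n) (x : Euc n) :
    ‖fderiv ℝ v x‖ ≤ ∑ a : Fin n × Fin n, |jacobian v x a.1 a.2| := by
  refine ContinuousLinearMap.opNorm_le_bound _ (by positivity) fun z => ?_
  have hz : z = ∑ a, z a • bv a := by
    ext i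
    simp [Pi.single_apply]
  have hcol : ∀ j : Fin n, ‖fderiv ℝ v x (bv j)‖ ≤ ∑ i, |jacobian v x i j| := fun j => by
    rw [EuclideanSpace.norm_eq]
    refine Real.sqrt_le_iff.2 ⟨by positivity, ?_⟩
    exact Finset.sum_sq_le_sq_sum_of_nonneg fun a _ => abs_nonneg _
  calc ‖fderiv ℝ v x z‖ = ‖∑ j, z j • fderiv ℝ v x (bv j)‖ := by
        conv_lhs => rw [hz]
        simp only [map_sum, map_smul]
    _ ≤ ∑ j, ‖z‖ * ∑ i, |jacobian v x i j| := by
        refine (norm_sum_le _ _).trans (Finset.sum_le_sum fun j _ => ?_)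
        rw [norm_smul]
        exact mul_le_mul (PiLp.norm_apply_le z j) (hcol j) (norm_nonneg _) (norm_nonneg _)
    _ = _ := by
        rw [← Finset.mul_sum, Finset.sum_comm, Fintype.sum_prod_type, mul_comm]

lemma symSize_le (v : Euc n → Euc n) (x : Euc n) :
    symSize v x ≤ 2 * (n * n) * frob (symGrad v x) + ‖v x‖ := by
  refine add_le_add_left ?_ _
  have hs : ∀ a : Fin n × Fin n, |symForm (fderiv ℝ v x) (bv a.1) (bv a.2)|
      ≤ 2 * frob (symGrad v x) := fun a => by
    have hin : ∀ (v : Euc n) (b : Fin n), ⟪v, bv b⟫ = v b := fun v b => by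
      simpa using EuclideanSpace.inner_single_right (𝕜 := ℝ) b 1 v
    have h1 : symForm (fderiv ℝ v x) (bv a.1) (bv a.2) = 2 * symGrad v x a.1 a.2 := by
      simp only [symForm, hin, symGrad, jacobian]
      ring
    rw [h1, abs_mul, abs_two]
    exact mul_le_mul_of_nonneg_left (abs_entry_le_frob _ _ _) zero_le_two
  refine (Finset.sum_le_sum fun a _ => hs a).trans_eq ?_
  simp
  ring

lemma continuous_jacobian {v : Euc n → Euc n} (hv : ContDiff ℝ 1 v) (i j : Fin n) :
    Continuous fun x => jacobian v x i j :=
  (EuclideanSpace.proj (𝕜 := ℝ) i).continuous.comp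
    ((hv.continuous_fderiv one_ne_zero).clm_apply continuous_const)

/-- Korn's inequality on the unit ball with an `L¹` lower-order term. -/
lemma korn_ball_frob (n : ℕ) {p : ℝ} (hp : 1 < p) (hp2 : p < 2) :
    ∃ C : ℝ, 0 ≤ C ∧ ∀ v : Euc n → Euc n, ContDiff ℝ 1 v →
      ∫ x in ball 0 1, frob (jacobian v x) ^ p ≤
        C * (∫ x in ball 0 1, frob (symGrad v x) ^ p) + C * (∫ x in ball 0 1, ‖v x‖) ^ p := by
  have hp0 : 0 < p := by linarith
  obtain ⟨C, hC, hkorn⟩ := korn_ball n hp hp2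
  set A := ((n * n : ℕ) : ℝ) ^ (p - 1) * (n * n * C) with hA
  have hA0 : 0 ≤ A := by positivity
  set D := A * 2 ^ p * (2 * (n * n)) ^ p with hD
  set F := A * 2 ^ p with hF
  have hD0 : 0 ≤ D := by positivity
  have hF0 : 0 ≤ F := by positivity
  obtain ⟨E, hE, habs⟩ := integral_rpow_norm_le n hp (ε := 1 / (2 * F + 1)) (by positivity)
  refine ⟨2 * D + 2 * (F * E), by positivity, fun v hv => ?_⟩
  have hBint : ∀ f : Euc n → ℝ, Continuous f → IntegrableOn f (ball 0 1) := fun f hf =>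
    (hf.continuousOn.integrableOn_compact (isCompact_closedBall 0 1)).mono_set
      ball_subset_closedBall
  have hjc := continuous_jacobian hv
  have hsc : Continuous fun x => frob (symGrad v x) := by
    unfold frob symGrad
    refine Real.continuous_sqrt.comp (continuous_finsetSum _ fun i _ =>
      continuous_finsetSum _ fun j _ => ?_)
    exact (((hjc i j).add (hjc j i)).div_const 2).pow 2
  have hfc : Continuous fun x => frob (jacobian v x) := by
    unfold frob
    exact Real.continuous_sqrt.comp (continuous_finsetSum _ fun i _ =>
      continuous_finsetSum _ fun j _ => (hjc i j).pow 2)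
  have hDc : Continuous fun x => ∑ a : Fin n × Fin n, |jacobian v x a.1 a.2| :=
    continuous_finsetSum _ fun a _ => (hjc a.1 a.2).abs
  have hpc : ∀ f : Euc n → ℝ, Continuous f → Continuous fun x => f x ^ p := fun f hf =>
    hf.rpow_const fun _ => .inr hp0.le
  set X := ∫ x in ball 0 1, (∑ a : Fin n × Fin n, |jacobian v x a.1 a.2|) ^ p with hX
  set Y := ∫ x in ball 0 1, frob (symGrad v x) ^ p with hY
  set Z := ∫ x in ball 0 1, ‖v x‖ ^ p with hZ
  set I := (∫ x in ball 0 1, ‖v x‖) ^ p with hI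
  have hI0 : 0 ≤ I := Real.rpow_nonneg (integral_nonneg fun _ => norm_nonneg _) _
  have hY0 : 0 ≤ Y := integral_nonneg fun _ => Real.rpow_nonneg (frob_nonneg _) _
  have hX0 : 0 ≤ X := integral_nonneg fun _ => by positivity
  have hleft : ∫ x in ball 0 1, frob (jacobian v x) ^ p ≤ X :=
    integral_mono (hBint _ (hpc _ hfc)) (hBint _ (hpc _ hDc)) fun x =>
      Real.rpow_le_rpow (frob_nonneg _) (frob_le_sum_abs _) hp0.le
  have hgrad : ∫ x in ball 0 1, ‖fderiv ℝ v x‖ ^ p ≤ X :=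
    integral_mono (hBint _ (hpc _ (hv.continuous_fderiv one_ne_zero).norm)) (hBint _ (hpc _ hDc))
      fun x => Real.rpow_le_rpow (norm_nonneg _) (norm_fderiv_le_sum _ _) hp0.le
  have hsize : ∫ x in ball 0 1, symSize v x ^ p ≤ 2 ^ p * ((2 * (n * n)) ^ p * Y + Z) := by
    calc _ ≤ ∫ x in ball 0 1, 2 ^ p * ((2 * (n * n)) ^ p * frob (symGrad v x) ^ p + ‖v x‖ ^ p) := by
          refine integral_mono (hBint _ (hpc _ (continuous_symSize hv))) (hBint _ ?_) fun x => ?_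
          · exact continuous_const.mul ((continuous_const.mul (hpc _ hsc)).add
              (hpc _ hv.continuous.norm))
          · have h0 := frob_nonneg (symGrad v x)
            have h1 := Real.rpow_le_rpow (symSize_nonneg v x) (symSize_le v x) hp0.le
            have h2 := add_rpow_le (x := 2 * (n * n) * frob (symGrad v x)) (by positivity)
              (norm_nonneg (v x)) hp0.le
            rw [Real.mul_rpow (by positivity) h0] at h2
            exact h1.trans h2
      _ = _ := by
          rw [integral_const_mul, integral_add ((hBint _ (hpc _ hsc)).const_mul _)
            (hBint _ (hpc _ hv.continuous.norm)), integral_const_mul]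
  have hXle : X ≤ A * ∫ x in ball 0 1, symSize v x ^ p := by
    calc X ≤ ∫ x in ball 0 1, ((n * n : ℕ) : ℝ) ^ (p - 1)
          * ∑ a : Fin n × Fin n, |jacobian v x a.1 a.2| ^ p := by
          refine integral_mono (hBint _ (hpc _ hDc)) (hBint _ (continuous_const.mul
            (continuous_finsetSum _ fun a _ => hpc _ (hjc a.1 a.2).abs))) fun x => ?_
          have := sum_rpow_le (Finset.univ : Finset (Fin n × Fin n))
            (x := fun a => |jacobian v x a.1 a.2|) (fun _ => abs_nonneg _) hp.le
          simpa using this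
      _ = ((n * n : ℕ) : ℝ) ^ (p - 1)
          * ∑ a : Fin n × Fin n, ∫ x in ball 0 1, |jacobian v x a.1 a.2| ^ p := by
          rw [integral_const_mul, integral_finsetSum _ fun a _ => hBint _ (hpc _ (hjc a.1 a.2).abs)]
      _ ≤ ((n * n : ℕ) : ℝ) ^ (p - 1)
          * ∑ _a : Fin n × Fin n, C * ∫ x in ball 0 1, symSize v x ^ p := by
          gcongr with a
          exact hkorn v hv a.1 a.2
      _ = _ := by
          rw [Finset.sum_const, hA]
          simp
          ring
  have h1 : X ≤ D * Y + F * Z := by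
    refine (hXle.trans (mul_le_mul_of_nonneg_left hsize hA0)).trans_eq ?_
    rw [hD, hF]; ring
  have h2 : Z ≤ 1 / (2 * F + 1) * X + E * I :=
    (habs v hv).trans (add_le_add_left (mul_le_mul_of_nonneg_left hgrad (by positivity)) _)
  have h3 : F * (1 / (2 * F + 1)) ≤ 1 / 2 := by
    rw [mul_one_div, div_le_div_iff₀ (by positivity) two_pos]
    linarith
  have h4 : F * Z ≤ 1 / 2 * X + F * E * I := by
    calc F * Z ≤ F * (1 / (2 * F + 1) * X + E * I) := mul_le_mul_of_nonneg_left h2 hF0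
      _ = F * (1 / (2 * F + 1)) * X + F * E * I := by ring
      _ ≤ _ := by gcongr
  have h5 : 0 ≤ F * E * Y := by positivity
  have h6 : 0 ≤ D * I := by positivity
  nlinarith

/-- Averages over a ball are averages over the unit ball after rescaling. -/
lemma average_ball_eq {G : Type*} [NormedAddCommGroup G] [NormedSpace ℝ G] (x₀ : Euc n) {ρ : ℝ}
    (hρ : 0 < ρ) (f : Euc n → G) :
    ⨍ x in ball x₀ ρ, f x = (volume.real (ball (0 : Euc n) 1))⁻¹ •
      ∫ y in ball 0 1, f (x₀ + ρ • y) := by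
  have hind : ∀ y : Euc n, (ball 0 1).indicator (fun y => f (x₀ + ρ • y)) y
      = (ball x₀ ρ).indicator f (x₀ + ρ • y) := fun y => by
    have hiff : x₀ + ρ • y ∈ ball x₀ ρ ↔ y ∈ ball (0 : Euc n) 1 := by
      rw [mem_ball_iff_norm, add_sub_cancel_left, norm_smul, Real.norm_of_nonneg hρ.le,
        mem_ball_zero_iff, mul_lt_iff_lt_one_right hρ]
    by_cases hy : y ∈ ball (0 : Euc n) 1
    · rw [Set.indicator_of_mem hy, Set.indicator_of_mem (hiff.2 hy)]
    · rw [Set.indicator_of_notMem hy, Set.indicator_of_notMem (mt hiff.1 hy)]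
  have hI : ∫ y in ball 0 1, f (x₀ + ρ • y) = (ρ ^ n)⁻¹ • ∫ x in ball x₀ ρ, f x := by
    rw [← integral_indicator measurableSet_ball, integral_congr_ae (.of_forall hind),
      Measure.integral_comp_smul volume (fun z => (ball x₀ ρ).indicator f (x₀ + z)) ρ,
      integral_add_left_eq_self, integral_indicator measurableSet_ball,
      finrank_euclideanSpace_fin, abs_of_pos (by positivity)]
  have hvol : volume.real (ball x₀ ρ) = ρ ^ n * volume.real (ball (0 : Euc n) 1) := by
    rw [measureReal_def, Measure.addHaar_ball_of_pos _ _ hρ, ENNReal.toReal_mul,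
      ENNReal.toReal_ofReal (by positivity), finrank_euclideanSpace_fin, measureReal_def]
  rw [setAverage_eq, hvol, hI, smul_smul, mul_inv, mul_comm]

/-- A `C¹` map near a closed ball agrees on the ball with a globally `C¹` map. -/
lemma exists_contDiff_eqOn_ball {u : Euc n → Euc n} {O : Set (Euc n)} {x₀ : Euc n} {ρ : ℝ}
    (hρ : 0 < ρ) (hO : IsOpen O) (hsub : closedBall x₀ ρ ⊆ O) (hu : ContDiffOn ℝ 1 u O) :
    ∃ w : Euc n → Euc n, ContDiff ℝ 1 w ∧ Set.EqOn w u (ball x₀ ρ) := by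
  obtain ⟨δ, hδ, hδO⟩ := (isCompact_closedBall x₀ ρ).exists_cthickening_subset_open hO hsub
  rw [cthickening_closedBall hδ.le hρ.le] at hδO
  let χ : ContDiffBump x₀ := ⟨ρ, ρ + δ, hρ, by linarith⟩
  refine ⟨fun x => χ x • u x, contDiff_iff_contDiffAt.2 fun x => ?_, fun x hx => ?_⟩
  · by_cases hx : x ∈ O
    · exact χ.contDiffAt.smul (hu.contDiffAt (hO.mem_nhds hx))
    · have hx' : x ∉ tsupport χ := fun h => hx (hδO (by
        rw [χ.tsupport_eq] at h
        simpa [χ, add_comm] using h))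
      have : (fun x => χ x • u x) =ᶠ[𝓝 x] fun _ => 0 := by
        filter_upwards [notMem_tsupport_iff_eventuallyEq.1 hx'] with y hy
        rw [hy, Pi.zero_apply, zero_smul]
      exact contDiffAt_const.congr_of_eventuallyEq this
  · have : χ x = 1 := χ.one_of_mem_closedBall (ball_subset_closedBall hx)
    simp only [this, one_smul]

end Korn

/-- **Sobolev–Korn inequality.** For `n ≥ 2`, `1 < p < 2`, there is
`c = c(n,p) > 0` such that for every ball `B_ρ(x₀)` and every vector field `u` that is `C¹`
on an open neighborhood of the closed ball,
`⨍_{B_ρ} |Du|^p ≤ c ⨍_{B_ρ} |𝓔u|^p + c (⨍_{B_ρ} |u − (u)_{x₀,ρ}|/ρ)^p`. -/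
theorem stmt_7 (n : ℕ) (hn : 2 ≤ n) (p : ℝ) (hp₁ : 1 < p) (hp₂ : p < 2) :
    ∃ c : ℝ, 0 < c ∧
      ∀ (x₀ : EuclideanSpace ℝ (Fin n)) (ρ : ℝ), 0 < ρ →
      ∀ u : EuclideanSpace ℝ (Fin n) → EuclideanSpace ℝ (Fin n),
      ∀ O : Set (EuclideanSpace ℝ (Fin n)),
        IsOpen O → closedBall x₀ ρ ⊆ O → ContDiffOn ℝ 1 u O →
        (⨍ x in ball x₀ ρ, frob (jacobian u x) ^ p) ≤
          (c * ⨍ x in ball x₀ ρ, frob (symGrad u x) ^ p) +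
          c * (⨍ x in ball x₀ ρ, ‖u x - ⨍ y in ball x₀ ρ, u y‖ / ρ) ^ p := by
  obtain ⟨C, hC, hkorn⟩ := Korn.korn_ball_frob n hp₁ hp₂
  set m := volume.real (ball (0 : EuclideanSpace ℝ (Fin n)) 1) with hm
  have hm0 : 0 < m := ENNReal.toReal_pos (measure_ball_pos _ _ one_pos).ne' measure_ball_lt_top.ne
  have hmp : 0 ≤ C * m ^ (p - 1) := by positivity
  refine ⟨C + C * m ^ (p - 1) + 1, by positivity, fun x₀ ρ hρ u O hO hsub hu => ?_⟩
  obtain ⟨w, hw, hwu⟩ := Korn.exists_contDiff_eqOn_ball hρ hO hsub hu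
  set a := ⨍ y in ball x₀ ρ, u y with ha
  set v := fun y : EuclideanSpace ℝ (Fin n) => ρ⁻¹ • (w (x₀ + ρ • y) - a) with hv
  have hvd : ContDiff ℝ 1 v := by
    have h1 : ContDiff ℝ 1 fun y : EuclideanSpace ℝ (Fin n) => x₀ + ρ • y := by fun_prop
    have h2 : ContDiff ℝ 1 fun y : EuclideanSpace ℝ (Fin n) => w (x₀ + ρ • y) := hw.comp h1
    exact (h2.sub contDiff_const).const_smul ρ⁻¹
  have hmem : ∀ y ∈ ball (0 : EuclideanSpace ℝ (Fin n)) 1, x₀ + ρ • y ∈ ball x₀ ρ := fun y hy => by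
    rw [mem_ball_iff_norm, add_sub_cancel_left, norm_smul, Real.norm_of_nonneg hρ.le]
    exact mul_lt_of_lt_one_right hρ (by simpa using hy)
  have hfd : ∀ y ∈ ball (0 : EuclideanSpace ℝ (Fin n)) 1,
      fderiv ℝ v y = fderiv ℝ u (x₀ + ρ • y) := fun y hy => by
    have h1 : fderiv ℝ u (x₀ + ρ • y) = fderiv ℝ w (x₀ + ρ • y) :=
      (hwu.eventuallyEq_of_mem (isOpen_ball.mem_nhds (hmem y hy))).symm.fderiv_eq
    have h2 : HasFDerivAt (fun y : EuclideanSpace ℝ (Fin n) => x₀ + ρ • y)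
        (ρ • ContinuousLinearMap.id ℝ (EuclideanSpace ℝ (Fin n))) y :=
      ((hasFDerivAt_id y).const_smul ρ).const_add x₀
    have h3 := ((((hw.differentiable one_ne_zero) (x₀ + ρ • y)).hasFDerivAt.comp y h2).sub_const
      a).const_smul ρ⁻¹
    rw [h1]
    refine HasFDerivAt.fderiv (h3.congr_fderiv ?_)
    ext1 z
    simp [smul_smul, hρ.ne']
  have hjac : ∀ y ∈ ball (0 : EuclideanSpace ℝ (Fin n)) 1,
      jacobian v y = jacobian u (x₀ + ρ • y) := fun y hy => by
    ext i j
    simp only [jacobian, hfd y hy]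
  have hsym : ∀ y ∈ ball (0 : EuclideanSpace ℝ (Fin n)) 1,
      symGrad v y = symGrad u (x₀ + ρ • y) := fun y hy => by
    ext i j
    simp only [symGrad, hjac y hy]
  have hnorm : ∀ y ∈ ball (0 : EuclideanSpace ℝ (Fin n)) 1,
      ‖v y‖ = ‖u (x₀ + ρ • y) - a‖ / ρ := fun y hy => by
    rw [hv, norm_smul, hwu (hmem y hy), norm_inv, Real.norm_of_nonneg hρ.le, inv_mul_eq_div]
  have h := hkorn v hvd
  rw [setIntegral_congr_fun (g := fun y => frob (jacobian u (x₀ + ρ • y)) ^ p) measurableSet_ball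
      (fun y hy => by simp only [hjac y hy]),
    setIntegral_congr_fun (f := fun y => frob (symGrad v y) ^ p)
      (g := fun y => frob (symGrad u (x₀ + ρ • y)) ^ p) measurableSet_ball
      (fun y hy => by simp only [hsym y hy]),
    setIntegral_congr_fun (f := fun y => ‖v y‖) (g := fun y => ‖u (x₀ + ρ • y) - a‖ / ρ)
      measurableSet_ball hnorm] at h
  rw [Korn.average_ball_eq x₀ hρ (fun x => frob (jacobian u x) ^ p),
    Korn.average_ball_eq x₀ hρ (fun x => frob (symGrad u x) ^ p),
    Korn.average_ball_eq x₀ hρ (fun x => ‖u x - a‖ / ρ)]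
  simp only [smul_eq_mul, ← hm]
  set Y := ∫ y in ball (0 : EuclideanSpace ℝ (Fin n)) 1, frob (symGrad u (x₀ + ρ • y)) ^ p with hY
  set I := ∫ y in ball (0 : EuclideanSpace ℝ (Fin n)) 1, ‖u (x₀ + ρ • y) - a‖ / ρ with hI
  have hY0 : 0 ≤ Y := integral_nonneg fun _ => Real.rpow_nonneg (Korn.frob_nonneg _) _
  have hI0 : 0 ≤ I := integral_nonneg fun _ => by positivity
  have hIp : I ^ p = m ^ p * (m⁻¹ * I) ^ p := by
    rw [← Real.mul_rpow hm0.le (by positivity), mul_inv_cancel_left₀ hm0.ne']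
  have hmm : m ^ (p - 1) = m⁻¹ * m ^ p := by
    rw [Real.rpow_sub hm0, Real.rpow_one, div_eq_inv_mul]
  have hJ0 : 0 ≤ (m⁻¹ * I) ^ p := by positivity
  calc _ ≤ m⁻¹ * (C * Y + C * I ^ p) := mul_le_mul_of_nonneg_left h (by positivity)
    _ = C * (m⁻¹ * Y) + C * m ^ (p - 1) * (m⁻¹ * I) ^ p := by rw [hIp, hmm]; ring
    _ ≤ _ := by
      gcongr
      · linarith
      · linarith
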